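/- Proposition 8.5 (weight-3/2 zero-frequency limits): For every real r > 0, the series Σ_{even c>0} K(r²,0,c,ν_Θ³)·c^{−2s} and Σ_{odd c̃>0} K̃(r²,0,c̃,ν_Θ³)·c̃^{−2s} converge absolutely for every real s > 3/4, and lim_{s→3/4⁺} (1/Γ(s−3/4))·Σ_{even c>0} K(r²,0,c,ν_Θ³)·c^{−2s} = e(−1/8)·sin(πr²)/(π²·r·sinh(πr)) and lim_{s→3/4⁺} (1/Γ(s−3/4))·Σ_{odd c̃>0} K̃(r²,0,c̃,ν_Θ³)·c̃^{−2s} = e(3/8)·sin(πr²)/(π²·r·sinh(πr)). -/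

import Mathlib

open Complex Real Filter Topology BigOperators MeasureTheory

noncomputable section

/-- `ee x = exp(2πix)`. -/
def ee (x : ℂ) : ℂ := Complex.exp (2 * (π : ℂ) * Complex.I * x)

/-- `ε_d`: equals 1 if `d ≡ 1 (mod 4)` and `i` if `d ≡ 3 (mod 4)`. -/
def epsFactor (d : ℕ) : ℂ := if d % 4 = 1 then 1 else Complex.I

/-- Real-variable Kloosterman sum, even modulus `c`:
`K(t,n,c,ν_Θ^w) = Σ_a ε_{d_a}^w (2c/d_a)^w e((t a + n d_a)/(2c))`, the sum over `-c < a < c`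
with `gcd(a,2c)=1` and `d_a` the inverse of `a` modulo `2c` in `(0,2c)`. -/
def RKe (t : ℝ) (n : ℤ) (c : ℕ) (w : ℕ) : ℂ :=
  ∑ a ∈ Finset.Ico (-(c : ℤ) + 1) (c : ℤ), ∑ d ∈ Finset.Ico 1 (2 * c),
    if (a * d) % (2 * (c : ℤ)) = 1 then
      epsFactor d ^ w * ((jacobiSym (2 * (c : ℤ)) d : ℤ) : ℂ) ^ w *
        ee (((t * a + (n : ℝ) * d) / (2 * c) : ℝ) : ℂ)
    else 0

/-- Real-variable Kloosterman sum, odd modulus `c`: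
`K̃(t,n,c,ν_Θ^w) = e(w/8) ε_c^{-w} Σ_b (-2c_b/c)^w e((t b - n c_b)/(2c))`, the sum over even
`-c < b < c` with `gcd(b,c)=1`, where `c_b` is the unique even integer in `[0,2c)` with
`b c_b ≡ -1 (mod c)`.  (For `c = 1` this gives `e(w/8)`.) -/
def RKo (t : ℝ) (n : ℤ) (c : ℕ) (w : ℕ) : ℂ :=
  ee ((w : ℂ) / 8) * (epsFactor c)⁻¹ ^ w *
    ∑ b ∈ Finset.Ico (-(c : ℤ) + 1) (c : ℤ), ∑ cb ∈ Finset.range (2 * c),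
      if b % 2 = 0 ∧ cb % 2 = 0 ∧ (b * cb) % (c : ℤ) = (-1) % (c : ℤ) then
        ((jacobiSym (-(2 * (cb : ℤ))) c : ℤ) : ℂ) ^ w *
          ee (((t * b - (n : ℝ) * cb) / (2 * c) : ℝ) : ℂ)
      else 0

/-- The theta-type sum `∑ exp(-π (c l + r)² / p)` over all integers `l`. -/
def thetaShift (p : ℂ) (c : ℕ) (r : ℤ) : ℂ :=
  ∑' l : ℤ, cexp (-π / p * (c * l + r) ^ 2)

lemma summable_cexp_quadratic {a : ℂ} (ha : 0 < a.re) (b : ℂ) :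
    Summable fun n : ℤ => cexp (-π * a * n ^ 2 + 2 * π * b * n) := by
  have h : Summable (fun n : ℤ => jacobiTheta₂_term n (-I * b) (I * a)) := by
    rw [summable_jacobiTheta₂_term_iff]
    simpa using ha
  refine h.congr fun n => ?_
  unfold jacobiTheta₂_term
  congr 1
  linear_combination (-2 * (π : ℂ) * b * n + π * n ^ 2 * a) * I_sq

lemma thetaShift_exponent {p : ℂ} (hp : 0 < p.re) (c : ℕ) (hc : 0 < c) (r : ℤ) (l : ℤ) :
    -π / p * (c * l + r) ^ 2 = -(π : ℂ) / (p / c ^ 2) * (l + I * (-I * r / c)) ^ 2 := by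
  have hc' : (c : ℂ) ≠ 0 := by exact_mod_cast hc.ne'
  have hp' : p ≠ 0 := by rintro rfl; simp at hp
  have : (l : ℂ) + I * (-I * r / c) = (c * l + r) / c := by
    field_simp
    linear_combination (-(r : ℂ)) * I_sq
  rw [this]
  field_simp

lemma div_natCast_sq_re_pos {p : ℂ} (hp : 0 < p.re) {c : ℕ} (hc : 0 < c) :
    0 < (p / (c : ℂ) ^ 2).re := by
  have : p / (c : ℂ) ^ 2 = p / (((c : ℝ) ^ 2 : ℝ) : ℂ) := by push_cast; rfl
  rw [this, Complex.div_ofReal_re]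
  positivity

lemma thetaShift_eq {p : ℂ} (hp : 0 < p.re) (c : ℕ) (hc : 0 < c) (r : ℤ) :
    thetaShift p c r = (p / (c : ℂ) ^ 2) ^ (1 / 2 : ℂ) *
      ∑' n : ℤ, cexp (-π * (p / c ^ 2) * n ^ 2 + 2 * π * (-I * r / c) * n) := by
  have h0 := div_natCast_sq_re_pos hp hc
  rw [Complex.tsum_exp_neg_quadratic h0]
  have : (p / (c : ℂ) ^ 2) ^ (1 / 2 : ℂ) ≠ 0 := by
    rw [Ne, Complex.cpow_eq_zero_iff]
    rintro ⟨h, -⟩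
    rw [h] at h0; simp at h0
  rw [← mul_assoc, mul_one_div_cancel this, one_mul]
  unfold thetaShift
  exact tsum_congr fun l => by rw [thetaShift_exponent hp c hc r l]

lemma tendsto_thetaShift_dual {ι : Type*} {F : Filter ι} {p : ι → ℂ}
    (hp : Tendsto (fun i => (p i).re) F atTop) (c : ℕ) (hc : 0 < c) (r : ℤ) :
    Tendsto (fun i => ∑' n : ℤ,
      cexp (-π * (p i / c ^ 2) * n ^ 2 + 2 * π * (-I * r / c) * n)) F (𝓝 1) := by
  have hc' : (0 : ℝ) < c := by exact_mod_cast hc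
  have hn : ∀ i (n : ℤ), ‖cexp (-π * (p i / c ^ 2) * n ^ 2 + 2 * π * (-I * r / c) * n)‖
      = Real.exp (-π * ((p i).re / c ^ 2) * n ^ 2) := by
    intro i n
    rw [Complex.norm_exp]
    congr 1
    have e1 : -π * (p i / c ^ 2) * n ^ 2 + 2 * π * (-I * r / c) * n
      = ((-π * n ^ 2 / c ^ 2 : ℝ) : ℂ) * p i + ((-2 * π * r * n / c : ℝ) : ℂ) * I := by
      push_cast; ring
    rw [e1]
    simp only [add_re, re_ofReal_mul, I_re, mul_zero, add_zero]
    ring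
  have hs : Summable fun n : ℤ => Real.exp (-π * 1 * n ^ 2) := by
    have := (summable_cexp_quadratic (a := 1) (by simp) 0).norm
    refine this.congr fun n => ?_
    rw [Complex.norm_exp]
    congr 1
    have : (-π * 1 * (n : ℂ) ^ 2 + 2 * π * 0 * n) = ((-π * 1 * (n : ℝ) ^ 2 : ℝ) : ℂ) := by
      push_cast; ring
    rw [this, ofReal_re]
  have key := tendsto_tsum_of_dominated_convergence (𝓕 := F)
    (f := fun i (n : ℤ) => cexp (-π * (p i / c ^ 2) * n ^ 2 + 2 * π * (-I * r / c) * n))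
    (g := fun n : ℤ => if n = 0 then (1 : ℂ) else 0) hs ?_ ?_
  · simpa using key
  · intro n
    by_cases h : n = 0
    · simp [h, tendsto_const_nhds]
    · rw [if_neg h, tendsto_zero_iff_norm_tendsto_zero]
      simp_rw [hn]
      refine Real.tendsto_exp_atBot.comp ?_
      have h2 : (0 : ℝ) < π * (n : ℝ) ^ 2 / c ^ 2 := by
        have : (n : ℝ) ≠ 0 := by exact_mod_cast h
        positivity
      have := hp.const_mul_atTop h2
      refine (tendsto_neg_atTop_atBot.comp this).congr fun i => ?_
      simp only [Function.comp]
      ring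
  · filter_upwards [hp.eventually_ge_atTop ((c : ℝ) ^ 2)] with i hi n
    rw [hn]
    apply Real.exp_le_exp.2
    have h1 : 1 ≤ (p i).re / (c : ℝ) ^ 2 := by
      rw [le_div_iff₀ (by positivity)]; linarith
    have h2 : 0 ≤ π * (n : ℝ) ^ 2 := by positivity
    nlinarith

lemma tsum_cexp_eq_sum_thetaShift {A p : ℂ} {a c : ℕ} (hc : 0 < c) (hac : Even (a * c))
    (hp : 0 < p.re) (s : ℤ) (hA : A = 1 / p + I * s * a / c) :
    ∑' n : ℤ, cexp (-π * A * n ^ 2) =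
      ∑ x ∈ Finset.range c, cexp (-π * I * s * a / c * x ^ 2) * thetaShift p c x := by
  have : NeZero c := ⟨hc.ne'⟩
  have hc' : (c : ℂ) ≠ 0 := by exact_mod_cast hc.ne'
  have hp' : p ≠ 0 := by rintro rfl; simp at hp
  have hAre : 0 < A.re := by
    have : I * (s : ℂ) * a / c = (((s : ℝ) * a / c : ℝ) : ℂ) * I := by push_cast; ring
    rw [hA, this, add_re, re_ofReal_mul, I_re, mul_zero, add_zero, one_div, inv_re]
    exact div_pos hp (normSq_pos.2 hp')
  have hsum : Summable fun n : ℤ => cexp (-π * A * n ^ 2) := by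
    simpa using summable_cexp_quadratic hAre 0
  rw [← (Int.divModEquiv c).symm.tsum_eq]
  have hterm : ∀ q : ℤ × Fin c, cexp (-π * A * (((Int.divModEquiv c).symm q : ℤ) : ℂ) ^ 2) =
      cexp (-π * I * s * a / c * ((q.2 : ℕ) : ℂ) ^ 2) *
        cexp (-π / p * (c * q.1 + ((q.2 : ℕ) : ℤ)) ^ 2) := by
    rintro ⟨l, x⟩
    have e0 : (((Int.divModEquiv c).symm (l, x) : ℤ) : ℂ) = l * c + ((x : ℕ) : ℂ) := by
      simp [Int.divModEquiv]
    rw [e0, ← Complex.exp_add, Complex.exp_eq_exp_iff_exists_int]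
    obtain ⟨m, hm⟩ := hac
    have hm' : (a : ℂ) * c = m + m := by exact_mod_cast hm
    refine ⟨-(s * m * l ^ 2 + s * a * l * x), ?_⟩
    rw [hA]
    push_cast
    field_simp
    linear_combination (-s * I * p * l ^ 2 * c) * hm'
  simp_rw [hterm]
  have hsum2 : Summable fun q : ℤ × Fin c =>
      cexp (-π * I * s * a / c * ((q.2 : ℕ) : ℂ) ^ 2) *
        cexp (-π / p * (c * q.1 + ((q.2 : ℕ) : ℤ)) ^ 2) := by
    refine ((Int.divModEquiv c).symm.summable_iff.2 hsum).congr fun q => ?_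
    exact hterm q
  have hth : ∀ x : Fin c, Summable fun l : ℤ =>
      cexp (-π / p * (c * l + ((x : ℕ) : ℤ)) ^ 2) := by
    intro x
    have h := hsum2.comp_injective (i := fun l : ℤ => (l, x)) (fun a b h => by simpa using h)
    have h2 := h.mul_left (cexp (-π * I * s * a / c * ((x : ℕ) : ℂ) ^ 2))⁻¹
    refine h2.congr fun l => ?_
    simp only [Function.comp]
    rw [← mul_assoc, inv_mul_cancel₀ (Complex.exp_ne_zero _), one_mul]
  rw [← (Equiv.prodComm (Fin c) ℤ).tsum_eq]
  have hsum3 := (Equiv.prodComm (Fin c) ℤ).summable_iff.2 hsum2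
  simp only [Function.comp_def] at hsum3
  rw [Summable.tsum_prod hsum3, tsum_fintype]
  rw [Finset.sum_range]
  refine Finset.sum_congr rfl fun x _ => ?_
  simp only [Equiv.prodComm_apply, Prod.swap_prod_mk]
  rw [tsum_mul_left]
  rfl

lemma mul_ofReal_cpow_of_pos {R : ℝ} (hR : 0 < R) {z : ℂ} (hz : z ≠ 0) (s : ℂ) :
    (z * (R : ℂ)) ^ s = z ^ s * (R : ℂ) ^ s := by
  have hR' : (R : ℂ) ≠ 0 := by exact_mod_cast hR.ne'
  rw [cpow_def_of_ne_zero (mul_ne_zero hz hR'), cpow_def_of_ne_zero hz, cpow_def_of_ne_zero hR',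
    mul_comm z, Complex.log_ofReal_mul hR hz, ← Complex.exp_add, Complex.ofReal_log hR.le]
  ring_nf

/-- The Landsberg–Schaar relation. -/
lemma landsberg_schaar (a c : ℕ) (ha : 0 < a) (hc : 0 < c) (hac : Even (a * c)) :
    ∑ x ∈ Finset.range c, ee (a * x ^ 2 / (2 * c)) =
      (√((c : ℝ) / a) : ℂ) * ee (1 / 8) * ∑ n ∈ Finset.range a, ee (-(c * n ^ 2 / (2 * a))) := by
  have ha' : (a : ℂ) ≠ 0 := by exact_mod_cast ha.ne'
  have hc' : (c : ℂ) ≠ 0 := by exact_mod_cast hc.ne'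
  have haR : (0 : ℝ) < a := by exact_mod_cast ha
  have hcR : (0 : ℝ) < c := by exact_mod_cast hc
  set p2 : ℝ → ℂ := fun R => (((a : ℝ) ^ 2 * R / c ^ 2 : ℝ) : ℂ) + (((a : ℝ) / c : ℝ) : ℂ) * I
    with hp2
  have hp2re : ∀ R, (p2 R).re = (a : ℝ) ^ 2 / c ^ 2 * R := by
    intro R
    simp only [hp2, add_re, ofReal_re, re_ofReal_mul, I_re, mul_zero, add_zero]
    ring
  set A : ℝ → ℂ := fun R => ((1 / R : ℝ) : ℂ) - (((a : ℝ) / c : ℝ) : ℂ) * I with hA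
  have hAre : ∀ R, (A R).re = 1 / R := by
    intro R
    simp only [hA, sub_re, ofReal_re, re_ofReal_mul, I_re, mul_zero, sub_zero]
  have hinv : ∀ R : ℝ, 0 < R → 1 / A R = 1 / p2 R + I * ((1 : ℤ) : ℂ) * c / a := by
    intro R hR
    have h1 : A R ≠ 0 := by
      intro h
      have := hAre R
      rw [h] at this
      simp only [zero_re] at this
      have : 0 < 1 / R := by positivity
      linarith
    have h2 : p2 R ≠ 0 := by
      intro h
      have h3 := hp2re R
      rw [h] at h3
      simp only [zero_re] at h3
      have : 0 < (a : ℝ) ^ 2 / c ^ 2 * R := by positivity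
      linarith
    have hR' : (R : ℂ) ≠ 0 := by exact_mod_cast hR.ne'
    rw [div_add_div _ _ h2 ha', div_eq_div_iff h1 (mul_ne_zero h2 ha')]
    simp only [hA, hp2]
    push_cast
    field_simp
    linear_combination ((a : ℂ) * R * c * I + a ^ 2 * R ^ 2 - c ^ 2) * I_sq
  have hkey : ∀ R : ℝ, 0 < R →
      (1 / (c : ℂ) ^ 2) ^ (1 / 2 : ℂ) * ∑ x ∈ Finset.range c, cexp (-π * I * ((-1 : ℤ) : ℂ) * a / c * x ^ 2) *
        (∑' n : ℤ, cexp (-π * ((R : ℂ) / c ^ 2) * n ^ 2 + 2 * π * (-I * ((x : ℤ) : ℂ) / c) * n)) =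
      1 / A R ^ (1 / 2 : ℂ) * ((p2 R / (a : ℂ) ^ 2 / R) ^ (1 / 2 : ℂ) *
        ∑ x ∈ Finset.range a, cexp (-π * I * ((1 : ℤ) : ℂ) * c / a * x ^ 2) *
        (∑' n : ℤ, cexp (-π * (p2 R / a ^ 2) * n ^ 2 + 2 * π * (-I * ((x : ℤ) : ℂ) / a) * n))) := by
    intro R hR
    have hR' : (R : ℂ) ≠ 0 := by exact_mod_cast hR.ne'
    have hRc : (R : ℂ) ^ (1 / 2 : ℂ) ≠ 0 := by
      rw [Ne, Complex.cpow_eq_zero_iff]; tauto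
    have hApos : 0 < (A R).re := by rw [hAre]; positivity
    have hp2pos : 0 < (p2 R).re := by rw [hp2re]; positivity
    have hp2ne : p2 R ≠ 0 := by
      intro h; rw [h] at hp2pos; simp at hp2pos
    have h1 := Complex.tsum_exp_neg_quadratic hApos 0
    have h2 := tsum_cexp_eq_sum_thetaShift (A := A R) (p := (R : ℂ)) (s := -1) hc hac
      (by simpa using hR) (by simp only [hA]; push_cast; ring)
    have h3 := tsum_cexp_eq_sum_thetaShift (A := 1 / A R) (p := p2 R) (s := 1) ha
      (by rwa [mul_comm]) hp2pos (hinv R hR)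
    simp only [mul_zero, zero_mul, add_zero] at h1
    have e1 : (∑' n : ℤ, cexp (-π / A R * n ^ 2)) = ∑' n : ℤ, cexp (-π * (1 / A R) * n ^ 2) :=
      tsum_congr fun n => by rw [mul_one_div]
    rw [h2, e1, h3] at h1
    simp_rw [thetaShift_eq (p := (R : ℂ)) (by simpa using hR) c hc,
      thetaShift_eq hp2pos a ha] at h1
    have e2 : (R : ℂ) / (c : ℂ) ^ 2 = 1 / (c : ℂ) ^ 2 * (R : ℂ) := by ring
    have e3 : p2 R / (a : ℂ) ^ 2 = p2 R / (a : ℂ) ^ 2 / R * (R : ℂ) := by field_simp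
    have e4 : ((R : ℂ) / (c : ℂ) ^ 2) ^ (1 / 2 : ℂ) =
        (1 / (c : ℂ) ^ 2) ^ (1 / 2 : ℂ) * (R : ℂ) ^ (1 / 2 : ℂ) := by
      rw [e2, mul_ofReal_cpow_of_pos hR (by simp [hc.ne'])]
    have e5 : (p2 R / (a : ℂ) ^ 2) ^ (1 / 2 : ℂ) =
        (p2 R / (a : ℂ) ^ 2 / R) ^ (1 / 2 : ℂ) * (R : ℂ) ^ (1 / 2 : ℂ) := by
      rw [e3, mul_ofReal_cpow_of_pos hR (by simp [hp2ne, ha', hR']), ← e3]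
    rw [e4, e5] at h1
    have h4 := congrArg (fun z => z / (R : ℂ) ^ (1 / 2 : ℂ)) h1
    simp only [Finset.mul_sum, Finset.sum_div] at h4 ⊢
    convert h4 using 1
    · refine Finset.sum_congr rfl fun x _ => ?_
      field_simp
    · refine Finset.sum_congr rfl fun x _ => ?_
      field_simp
  have hRC : Tendsto (fun R : ℝ => ((R : ℂ)).re) atTop atTop := by
    simp only [ofReal_re]; exact tendsto_id
  have hPC : Tendsto (fun R : ℝ => (p2 R).re) atTop atTop := by
    simp_rw [hp2re]
    exact tendsto_id.const_mul_atTop (by positivity)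
  have hinvR : Tendsto (fun R : ℝ => ((1 / R : ℝ) : ℂ)) atTop (𝓝 ((0 : ℝ) : ℂ)) := by
    refine (Complex.continuous_ofReal.tendsto 0).comp ?_
    exact (tendsto_inv_atTop_zero (𝕜 := ℝ)).congr fun R => (one_div R).symm
  have hslit : ((0 : ℝ) : ℂ) - (((a : ℝ) / c : ℝ) : ℂ) * I ∈ slitPlane := by
    rw [mem_slitPlane_iff]
    right
    simp [ha.ne', hc.ne']
  have hAlim : Tendsto (fun R : ℝ => A R ^ (1 / 2 : ℂ)) atTop
      (𝓝 ((((0 : ℝ) : ℂ) - (((a : ℝ) / c : ℝ) : ℂ) * I) ^ (1 / 2 : ℂ))) := by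
    exact ((hinvR.sub_const _)).cpow tendsto_const_nhds hslit
  have hplim : Tendsto (fun R : ℝ => (p2 R / (a : ℂ) ^ 2 / R) ^ (1 / 2 : ℂ)) atTop
      (𝓝 ((1 / (c : ℂ) ^ 2) ^ (1 / 2 : ℂ))) := by
    have h1 : Tendsto (fun R : ℝ => p2 R / (a : ℂ) ^ 2 / R) atTop (𝓝 (1 / (c : ℂ) ^ 2)) := by
      have h2 : Tendsto (fun R : ℝ => 1 / (c : ℂ) ^ 2 + ((1 / R : ℝ) : ℂ) * (I / (a * c))) atTop
          (𝓝 (1 / (c : ℂ) ^ 2 + ((0 : ℝ) : ℂ) * (I / (a * c)))) :=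
        (hinvR.mul_const _).const_add _
      simp only [ofReal_zero, zero_mul, add_zero] at h2
      refine h2.congr' ?_
      filter_upwards [eventually_gt_atTop 0] with R hR
      have hR' : (R : ℂ) ≠ 0 := by exact_mod_cast hR.ne'
      simp only [hp2]
      push_cast
      field_simp
    refine h1.cpow tendsto_const_nhds ?_
    rw [mem_slitPlane_iff]
    left
    have : (1 / (c : ℂ) ^ 2) = ((1 / (c : ℝ) ^ 2 : ℝ) : ℂ) := by push_cast; rfl
    rw [this, ofReal_re]; positivity
  have hA0 : (((0 : ℝ) : ℂ) - (((a : ℝ) / c : ℝ) : ℂ) * I) ^ (1 / 2 : ℂ) ≠ 0 := by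
    rw [Ne, Complex.cpow_eq_zero_iff]
    rintro ⟨h, -⟩
    rw [h] at hslit
    simp at hslit
  have hlim1 := (tendsto_finsetSum (Finset.range c) (fun x _ =>
    (tendsto_thetaShift_dual hRC c hc x).const_mul
      (cexp (-π * I * ((-1 : ℤ) : ℂ) * a / c * x ^ 2)))).const_mul ((1 / (c : ℂ) ^ 2) ^ (1 / 2 : ℂ))
  have hlim2 := (((tendsto_const_nhds (x := (1 : ℂ))).div hAlim hA0).mul
    (hplim.mul (tendsto_finsetSum (Finset.range a) (fun x _ =>
    (tendsto_thetaShift_dual hPC a ha x).const_mul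
      (cexp (-π * I * ((1 : ℤ) : ℂ) * c / a * x ^ 2))))))
  have heq := tendsto_nhds_unique (hlim1.congr' ((eventually_gt_atTop 0).mono hkey)) hlim2
  have hc2 : (1 / (c : ℂ) ^ 2) ^ (1 / 2 : ℂ) ≠ 0 := by
    rw [Ne, Complex.cpow_eq_zero_iff]
    rintro ⟨h, -⟩
    exact absurd h (by simp [hc.ne'])
  have hAval : 1 / (((0 : ℝ) : ℂ) - (((a : ℝ) / c : ℝ) : ℂ) * I) ^ (1 / 2 : ℂ) =
      (√((c : ℝ) / a) : ℂ) * ee (1 / 8) := by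
    have e1 : ((0 : ℝ) : ℂ) - (((a : ℝ) / c : ℝ) : ℂ) * I = (-I) * (((a : ℝ) / c : ℝ) : ℂ) := by
      push_cast; ring
    rw [e1, mul_ofReal_cpow_of_pos (by positivity) (neg_ne_zero.2 I_ne_zero), one_div, mul_inv,
      mul_comm]
    congr 1
    · rw [Real.sqrt_eq_rpow, show (1 / 2 : ℂ) = ((1 / 2 : ℝ) : ℂ) by push_cast; rfl,
        ← Complex.ofReal_cpow (by positivity), ← Complex.ofReal_inv,
        ← Real.inv_rpow (by positivity), inv_div]
    · rw [cpow_def_of_ne_zero (by simp), Complex.log_neg_I, ← Complex.exp_neg]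
      unfold ee
      congr 1
      ring
  rw [hAval] at heq
  simp only [mul_one] at heq
  have heq2 := mul_left_cancel₀ hc2 (heq.trans (show _ = (1 / (c : ℂ) ^ 2) ^ (1 / 2 : ℂ) *
    ((√((c : ℝ) / a) : ℂ) * ee (1 / 8) *
      ∑ x ∈ Finset.range a, cexp (-π * I * ((1 : ℤ) : ℂ) * c / a * x ^ 2)) by ring))
  convert heq2 using 1
  · refine Finset.sum_congr rfl fun x _ => ?_
    unfold ee
    congr 1
    push_cast
    field_simp
  · congr 1
    refine Finset.sum_congr rfl fun x _ => ?_
    unfold ee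
    congr 1
    push_cast
    field_simp

lemma ee_zero : ee 0 = 1 := by simp [ee]

lemma ee_add (x y : ℂ) : ee (x + y) = ee x * ee y := by
  unfold ee; rw [← Complex.exp_add]; congr 1; ring

lemma ee_neg (x : ℂ) : ee (-x) = (ee x)⁻¹ := by
  unfold ee; rw [← Complex.exp_neg]; congr 1; ring

lemma ee_intCast (n : ℤ) : ee n = 1 := by
  unfold ee
  rw [Complex.exp_eq_one_iff]
  exact ⟨n, by ring⟩

lemma ee_natCast (n : ℕ) : ee n = 1 := by simpa using ee_intCast n

lemma ee_natCast_mul (n : ℕ) (x : ℂ) : ee (n * x) = ee x ^ n := by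
  unfold ee; rw [← Complex.exp_nat_mul]; congr 1; ring

lemma ee_eq_of_sub_intCast {x y : ℂ} (n : ℤ) (h : x = y + n) : ee x = ee y := by
  rw [h, ee_add, ee_intCast, mul_one]

lemma norm_ee_ofReal (x : ℝ) : ‖ee x‖ = 1 := by
  unfold ee
  rw [show 2 * (π : ℂ) * I * x = ((2 * π * x : ℝ) : ℂ) * I by push_cast; ring]
  exact Complex.norm_exp_ofReal_mul_I _

lemma conj_ee (x : ℂ) : (starRingEnd ℂ) (ee x) = ee (-(starRingEnd ℂ) x) := by
  unfold ee
  rw [← Complex.exp_conj]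
  congr 1
  simp [Complex.conj_ofReal, Complex.conj_ofNat]

lemma ee_half : ee (1 / 2) = -1 := by
  unfold ee
  rw [show 2 * (π : ℂ) * I * (1 / 2) = π * I by ring, Complex.exp_pi_mul_I]

lemma ee_quarter : ee (1 / 4) = I := by
  unfold ee
  rw [show 2 * (π : ℂ) * I * (1 / 4) = π / 2 * I by ring, Complex.exp_pi_div_two_mul_I]

lemma sum_range_two_mul {M : Type*} [AddCommMonoid M] (F : ℕ → M) (k : ℕ) :
    ∑ x ∈ Finset.range (2 * k), F x = ∑ x ∈ Finset.range k, (F (2 * x) + F (2 * x + 1)) := by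
  induction k with
  | zero => simp
  | succ k ih =>
    rw [show 2 * (k + 1) = 2 * k + 1 + 1 by ring, Finset.sum_range_succ, Finset.sum_range_succ, ih,
      Finset.sum_range_succ, add_assoc]

lemma sum_range_add_self {M : Type*} [AddCommMonoid M] (F : ℕ → M) (k : ℕ) :
    ∑ x ∈ Finset.range (2 * k), F x = ∑ x ∈ Finset.range k, (F x + F (x + k)) := by
  rw [two_mul, Finset.sum_range_add, Finset.sum_add_distrib]
  simp only [add_comm]

lemma sum_range_shift {M : Type*} [AddCommGroup M] (F : ℕ → M) (k : ℕ)
    (hF : ∀ x, F (x + k) = F x) (s : ℕ) :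
    ∑ x ∈ Finset.range k, F (x + s) = ∑ x ∈ Finset.range k, F x := by
  induction s with
  | zero => simp
  | succ s ih =>
    rw [← ih]
    have h := Finset.sum_range_succ' (fun x => F (x + s)) k
    rw [Finset.sum_range_succ] at h
    have h0 : F (k + s) = F (0 + s) := by rw [add_comm k s, hF, zero_add]
    rw [h0] at h
    have h1 := add_right_cancel h
    rw [h1]
    exact Finset.sum_congr rfl fun x _ => by congr 1; ring

lemma sum_range_mul_of_periodic {M : Type*} [AddCommMonoid M] (F : ℕ → M) (k g : ℕ)
    (hF : ∀ x, F (x + k) = F x) :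
    ∑ x ∈ Finset.range (g * k), F x = g • ∑ x ∈ Finset.range k, F x := by
  have hF_eq : ∀ g x, F (g * k + x) = F x := by
    intro g x
    induction g with
    | zero => simp
    | succ g ih => rw [← ih, ← hF (g * k + x)]; congr 1; ring
  induction g with
  | zero => simp
  | succ g ih =>
    rw [add_mul, one_mul, Finset.sum_range_add, ih, succ_nsmul]
    simp_rw [hF_eq]

/-- The quadratic Gauss sum. -/
def gsum (a : ℤ) (k : ℕ) : ℂ := ∑ x ∈ Finset.range k, ee (a * x ^ 2 / k)

/-- The alternating quadratic sum with half-integral coefficient. -/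
def altGauss (j k : ℕ) : ℂ := ∑ x ∈ Finset.range k, (-1) ^ x * ee (j * x ^ 2 / (2 * k))

lemma gsum_add_mul (a m : ℤ) (k : ℕ) : gsum (a + k * m) k = gsum a k := by
  rcases Nat.eq_zero_or_pos k with rfl | hk
  · simp [gsum]
  have hk' : (k : ℂ) ≠ 0 := by exact_mod_cast hk.ne'
  refine Finset.sum_congr rfl fun x _ => ?_
  refine ee_eq_of_sub_intCast (m * x ^ 2) ?_
  push_cast
  field_simp

lemma gsum_periodic_aux (a : ℤ) (k : ℕ) (hk : 0 < k) (x : ℕ) :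
    ee (a * ((x + k : ℕ) : ℂ) ^ 2 / k) = ee (a * (x : ℂ) ^ 2 / k) := by
  have hk' : (k : ℂ) ≠ 0 := by exact_mod_cast hk.ne'
  refine ee_eq_of_sub_intCast (a * (2 * x + k)) ?_
  push_cast
  field_simp
  ring

lemma gsum_neg (a : ℤ) (k : ℕ) : gsum (-a) k = (starRingEnd ℂ) (gsum a k) := by
  unfold gsum
  rw [map_sum]
  refine Finset.sum_congr rfl fun x _ => ?_
  rw [conj_ee]
  congr 1
  simp only [map_div₀, map_mul, map_pow, map_natCast, map_intCast]
  push_cast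
  ring

lemma gsum_mul_mul (a : ℤ) (k g : ℕ) (hg : 0 < g) (hk : 0 < k) :
    gsum (g * a) (g * k) = g * gsum a k := by
  have hk' : (k : ℂ) ≠ 0 := by exact_mod_cast hk.ne'
  have hg' : (g : ℂ) ≠ 0 := by exact_mod_cast hg.ne'
  unfold gsum
  rw [← nsmul_eq_mul (α := ℂ),
    ← sum_range_mul_of_periodic (fun x : ℕ => ee (a * x ^ 2 / k)) k g (gsum_periodic_aux a k hk)]
  refine Finset.sum_congr rfl fun x _ => ?_
  congr 1
  push_cast
  field_simp

lemma gsum_odd_two_mod_four (a : ℤ) (h : ℕ) (ha : Odd a) (hh : Odd h) : gsum a (2 * h) = 0 := by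
  have hh0 : 0 < h := hh.pos
  have hh' : (h : ℂ) ≠ 0 := by exact_mod_cast hh0.ne'
  unfold gsum
  rw [sum_range_add_self]
  refine Finset.sum_eq_zero fun x _ => ?_
  have : ee (a * ((x + h : ℕ) : ℂ) ^ 2 / ((2 * h : ℕ) : ℂ)) =
      ee (a * (x : ℂ) ^ 2 / ((2 * h : ℕ) : ℂ)) * ee (1 / 2) := by
    obtain ⟨m, hm⟩ := ha.mul (show Odd (h : ℤ) by exact_mod_cast hh)
    have hm' : (a : ℂ) * h = 2 * m + 1 := by exact_mod_cast hm
    rw [← ee_add]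
    refine ee_eq_of_sub_intCast (a * x + m) ?_
    push_cast
    field_simp
    linear_combination h * hm'
  rw [this, ee_half]; ring

lemma neg_one_pow_mul_ee_half_sq (x : ℕ) : (-1 : ℂ) ^ x * ee (x ^ 2 / 2) = 1 := by
  have : ee (x ^ 2 / 2) = ee (x * (1 / 2)) := by
    obtain ⟨m, hm⟩ := Nat.even_mul_succ_self x
    have hm' : (x : ℂ) * (x + 1) = m + m := by exact_mod_cast hm
    refine ee_eq_of_sub_intCast (m - x) ?_
    push_cast
    linear_combination hm' / 2
  rw [this, ee_natCast_mul, ee_half, ← mul_pow]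
  simp

lemma altGauss_eq_gsum (j k : ℕ) (a : ℤ) (hk : 0 < k) (h : (j : ℤ) = 2 * a + k) :
    altGauss j k = gsum a k := by
  have hk' : (k : ℂ) ≠ 0 := by exact_mod_cast hk.ne'
  have h' : (j : ℂ) = 2 * a + k := by exact_mod_cast h
  refine Finset.sum_congr rfl fun x _ => ?_
  have : (j : ℂ) * x ^ 2 / (2 * k) = x ^ 2 / 2 + a * x ^ 2 / k := by
    rw [h']; field_simp; ring
  rw [this, ee_add, ← mul_assoc, neg_one_pow_mul_ee_half_sq, one_mul]

lemma altGauss_reciprocity (j k : ℕ) (hj : 0 < j) (hk : 0 < k) (h : j % 2 = k % 2) :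
    altGauss j k = (√((k : ℝ) / j) : ℂ) * ee (1 / 8) *
      ∑ n ∈ Finset.range j, ee (-(k * (2 * n + 1) ^ 2 / (8 * j))) := by
  have hj' : (j : ℂ) ≠ 0 := by exact_mod_cast hj.ne'
  have hk' : (k : ℂ) ≠ 0 := by exact_mod_cast hk.ne'
  set E : ℕ → ℂ := fun x => ee (j * x ^ 2 / (2 * k)) with hE
  set F : ℕ → ℂ := fun n => ee (-(k * n ^ 2 / (8 * j))) with hF
  have h1 : ∑ x ∈ Finset.range (2 * k), (-1) ^ x * E x = 2 * altGauss j k := by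
    rw [sum_range_add_self, altGauss, two_mul, ← Finset.sum_add_distrib]
    refine Finset.sum_congr rfl fun x _ => ?_
    congr 1
    rw [pow_add, mul_assoc]
    congr 1
    have e1 : E (x + k) = E x * ee ((j * k : ℕ) / 2) := by
      simp only [hE]
      rw [← ee_add]
      refine ee_eq_of_sub_intCast (j * x) ?_
      push_cast
      field_simp
      ring
    have e2 : (-1 : ℂ) ^ k * ee ((j * k : ℕ) / 2) = 1 := by
      rw [show (((j * k : ℕ) : ℂ) / 2) = ((j * k : ℕ) : ℂ) * (1 / 2) by ring, ee_natCast_mul,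
        ee_half, ← pow_add]
      apply Even.neg_one_pow
      rw [show k + j * k = k * (j + 1) by ring, Nat.even_mul, Nat.even_add_one, Nat.even_iff,
        Nat.even_iff]
      omega
    rw [e1]
    calc _ = E x * ((-1 : ℂ) ^ k * ee ((j * k : ℕ) / 2)) := by ring
      _ = E x := by rw [e2, mul_one]
  have h2 : ∑ x ∈ Finset.range (2 * k), (-1) ^ x * E x =
      2 * ∑ x ∈ Finset.range k, E (2 * x) - ∑ x ∈ Finset.range (2 * k), E x := by
    rw [sum_range_two_mul, sum_range_two_mul, Finset.mul_sum, ← Finset.sum_sub_distrib]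
    refine Finset.sum_congr rfl fun x _ => ?_
    rw [pow_succ, pow_mul]
    norm_num
    ring
  have h3 := landsberg_schaar (4 * j) k (by omega) hk (by rw [mul_assoc]; exact Even.mul_right (by decide) _)
  have h4 := landsberg_schaar (2 * j) (2 * k) (by omega) (by omega) (by rw [mul_assoc]; exact Even.mul_right (by decide) _)
  have e3 : ∑ x ∈ Finset.range k, E (2 * x) =
      ∑ x ∈ Finset.range k, ee (((4 * j : ℕ) : ℂ) * x ^ 2 / (2 * k)) := by
    refine Finset.sum_congr rfl fun x _ => ?_
    simp only [hE]; congr 1; push_cast; ring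
  have e4 : ∑ x ∈ Finset.range (2 * k), E x =
      ∑ x ∈ Finset.range (2 * k), ee (((2 * j : ℕ) : ℂ) * x ^ 2 / (2 * ((2 * k : ℕ) : ℂ))) := by
    refine Finset.sum_congr rfl fun x _ => ?_
    simp only [hE]; congr 1; push_cast; field_simp
  have e5 : (√((k : ℝ) / ((4 * j : ℕ) : ℝ)) : ℝ) = √((k : ℝ) / j) / 2 := by
    rw [show ((k : ℝ) / ((4 * j : ℕ) : ℝ)) = (k / j) / 2 ^ 2 by push_cast; ring]
    rw [Real.sqrt_div' _ (by positivity), Real.sqrt_sq (by norm_num)]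
  have e6 : (((2 * k : ℕ) : ℝ) / ((2 * j : ℕ) : ℝ)) = (k : ℝ) / j := by
    push_cast; rw [mul_div_mul_left _ _ (by norm_num)]
  have e7 : ∑ n ∈ Finset.range (4 * j), ee (-(k * n ^ 2 / (2 * ((4 * j : ℕ) : ℂ)))) =
      ∑ n ∈ Finset.range (2 * (2 * j)), F n := by
    rw [show 2 * (2 * j) = 4 * j by ring]
    refine Finset.sum_congr rfl fun n _ => ?_
    simp only [hF]; congr 1; push_cast; ring
  have e8 : ∑ n ∈ Finset.range (2 * j), ee (-(((2 * k : ℕ) : ℂ) * n ^ 2 / (2 * ((2 * j : ℕ) : ℂ)))) =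
      ∑ n ∈ Finset.range (2 * j), F (2 * n) := by
    refine Finset.sum_congr rfl fun n _ => ?_
    simp only [hF]; congr 1; push_cast; field_simp; ring
  rw [e7, e5] at h3
  rw [e6, e8] at h4
  have h5 : ∑ n ∈ Finset.range (2 * j), F (2 * n + 1) =
      2 * ∑ n ∈ Finset.range j, ee (-(k * (2 * n + 1) ^ 2 / (8 * j))) := by
    rw [sum_range_add_self, Finset.mul_sum]
    refine Finset.sum_congr rfl fun n _ => ?_
    have : F (2 * (n + j) + 1) = F (2 * n + 1) := by
      have : Even (k * (2 * n + 1 + j)) := by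
        rw [Nat.even_mul, Nat.even_iff, Nat.even_iff]; omega
      obtain ⟨m, hm⟩ := this
      have hm' : (k : ℂ) * (2 * n + 1 + j) = m + m := by exact_mod_cast hm
      simp only [hF]
      refine ee_eq_of_sub_intCast (-m) ?_
      push_cast
      field_simp
      linear_combination (-4 * (j : ℂ)) * hm'
    rw [this, ← two_mul]
    simp only [hF]
    push_cast
    rfl
  have h6 : ∑ n ∈ Finset.range (2 * (2 * j)), F n =
      ∑ n ∈ Finset.range (2 * j), F (2 * n) + ∑ n ∈ Finset.range (2 * j), F (2 * n + 1) := by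
    rw [sum_range_two_mul, Finset.sum_add_distrib]
  rw [h1, e3, e4, h3, h4, h6, h5] at h2
  push_cast at h2
  linear_combination h2 / 2

lemma ee_eighth : ee (1 / 8) = (1 + I) / (√2 : ℂ) := by
  unfold ee
  rw [show 2 * (π : ℂ) * I * (1 / 8) = ((π / 4 : ℝ) : ℂ) * I by push_cast; ring, Complex.exp_mul_I,
    ← Complex.ofReal_cos, ← Complex.ofReal_sin, Real.cos_pi_div_four, Real.sin_pi_div_four]
  have h : (√2 : ℂ) * √2 = 2 := by
    rw [← Complex.ofReal_mul, Real.mul_self_sqrt (by norm_num)]; norm_num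
  have h0 : (√2 : ℂ) ≠ 0 := by
    intro h1; rw [h1] at h; norm_num at h
  push_cast
  field_simp
  linear_combination (1 + I) * h

lemma ofReal_sqrt_mul_self {x : ℝ} (hx : 0 ≤ x) : (√x : ℂ) * √x = x := by
  rw [← Complex.ofReal_mul, Real.mul_self_sqrt hx]

lemma ofReal_sqrt_ne_zero {x : ℝ} (hx : 0 < x) : (√x : ℂ) ≠ 0 := by
  exact_mod_cast (Real.sqrt_pos.2 hx).ne'

lemma epsFactor_of_three {d : ℕ} (h : d % 4 = 3) : epsFactor d = I := by
  unfold epsFactor; rw [if_neg (by omega)]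

lemma epsFactor_of_one {d : ℕ} (h : d % 4 = 1) : epsFactor d = 1 := by
  unfold epsFactor; rw [if_pos h]

lemma odd_mod_four {n : ℕ} (h : Odd n) : n % 4 = 1 ∨ n % 4 = 3 := by
  obtain ⟨m, hm⟩ := h; omega

lemma ee_neg_natCast_div_four {n : ℕ} (hn : Odd n) :
    ee (1 / 8) * (1 + ee (-(n / 4))) = (√2 : ℂ) * epsFactor n := by
  have h : (√2 : ℂ) * √2 = 2 := by
    have := ofReal_sqrt_mul_self (x := 2) (by norm_num); simpa using this
  have h0 : (√2 : ℂ) ≠ 0 := by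
    intro h1; rw [h1] at h; norm_num at h
  rw [ee_eighth]
  rcases odd_mod_four hn with h1 | h1
  · rw [epsFactor_of_one h1]
    have e : ee (-((n : ℂ) / 4)) = -I := by
      rw [← Complex.inv_I, ← ee_quarter, ← ee_neg]
      refine ee_eq_of_sub_intCast (-((n / 4 : ℕ) : ℤ)) ?_
      have : (n : ℂ) = 4 * (n / 4 : ℕ) + 1 := by exact_mod_cast (by omega : n = 4 * (n / 4) + 1)
      rw [Int.cast_neg, Int.cast_natCast]
      linear_combination (-1 / 4) * this
    rw [e]
    field_simp
    linear_combination (-1 : ℂ) * I_sq - h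
  · rw [epsFactor_of_three h1]
    have e : ee (-((n : ℂ) / 4)) = I := by
      rw [← ee_quarter]
      refine ee_eq_of_sub_intCast (-((n / 4 : ℕ) : ℤ) - 1) ?_
      have : (n : ℂ) = 4 * (n / 4 : ℕ) + 3 := by exact_mod_cast (by omega : n = 4 * (n / 4) + 3)
      rw [Int.cast_sub, Int.cast_neg, Int.cast_natCast, Int.cast_one]
      linear_combination (-1 / 4) * this
    rw [e]
    field_simp
    linear_combination I_sq - I * h

lemma gsum_odd_reciprocity (b c : ℕ) (hb : Odd b) (hc : Odd c) :
    gsum b c = (√((c : ℝ) / b) : ℂ) * epsFactor (b * c) * (starRingEnd ℂ) (gsum c b) := by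
  have hb0 : 0 < b := hb.pos
  have hc0 : 0 < c := hc.pos
  have hb' : (b : ℂ) ≠ 0 := by exact_mod_cast hb0.ne'
  have h2 : (√2 : ℂ) * √2 = 2 := by
    have := ofReal_sqrt_mul_self (x := 2) (by norm_num); simpa using this
  have h20 : (√2 : ℂ) ≠ 0 := by
    intro h1; rw [h1] at h2; norm_num at h2
  have h := landsberg_schaar (2 * b) c (by omega) hc0
    (by rw [mul_assoc]; exact Even.mul_right (by decide) _)
  have e1 : ∑ x ∈ Finset.range c, ee (((2 * b : ℕ) : ℂ) * x ^ 2 / (2 * c)) = gsum b c := by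
    refine Finset.sum_congr rfl fun x _ => ?_
    congr 1; push_cast; rw [mul_assoc, mul_div_mul_left _ _ (by norm_num)]
  set F : ℕ → ℂ := fun n => ee (-(c * n ^ 2 / (4 * b))) with hF
  have e2 : ∑ n ∈ Finset.range (2 * b), ee (-(c * n ^ 2 / (2 * ((2 * b : ℕ) : ℂ)))) =
      ∑ n ∈ Finset.range (2 * b), F n := by
    refine Finset.sum_congr rfl fun n _ => ?_
    simp only [hF]; congr 1; push_cast; ring
  have e3 : ∑ n ∈ Finset.range b, F (2 * n) = (starRingEnd ℂ) (gsum c b) := by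
    rw [← gsum_neg]
    refine Finset.sum_congr rfl fun n _ => ?_
    simp only [hF]; congr 1; push_cast; field_simp; ring
  have e4 : ∑ n ∈ Finset.range b, F (2 * n + 1) =
      ee (-((b * c : ℕ) / 4)) * ∑ n ∈ Finset.range b, F (2 * n) := by
    obtain ⟨b', hb2⟩ := hb
    rw [← sum_range_shift (fun n => F (2 * n + 1)) b ?_ b', Finset.mul_sum]
    · refine Finset.sum_congr rfl fun n _ => ?_
      have hb3 : (b : ℂ) = 2 * b' + 1 := by exact_mod_cast hb2
      simp only [hF]
      rw [← ee_add]
      refine ee_eq_of_sub_intCast (-(c * n)) ?_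
      push_cast
      have : (2 * ((n : ℂ) + b') + 1) = 2 * n + b := by rw [hb3]; ring
      rw [this]
      field_simp
      ring
    · intro x
      simp only [hF]
      refine ee_eq_of_sub_intCast (-(c * (2 * x + 1 + b))) ?_
      push_cast
      field_simp
      ring
  have e5 : (√((c : ℝ) / ((2 * b : ℕ) : ℝ)) : ℝ) = √((c : ℝ) / b) / √2 := by
    rw [← Real.sqrt_div' _ (by norm_num)]; congr 1; push_cast; field_simp
  rw [e1, e2, sum_range_two_mul, Finset.sum_add_distrib, e4, e3, e5] at h
  rw [h]
  have h3 := ee_neg_natCast_div_four (hb.mul hc)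
  push_cast at h3 ⊢
  field_simp
  linear_combination (√((c : ℝ) / b) : ℂ) * (starRingEnd ℂ) (gsum c b) * h3

theorem gsum_eq_jacobiSym (c : ℕ) (hc : Odd c) (a : ℤ) (hac : a.gcd c = 1) :
    gsum a c = (jacobiSym a c : ℤ) * epsFactor c * (√(c : ℝ) : ℂ) := by
  induction c using Nat.strong_induction_on generalizing a with
  | _ c ih =>
  have hpos : ∀ b : ℕ, Odd b → b < c → b.Coprime c →
      gsum b c = (jacobiSym b c : ℤ) * epsFactor c * (√(c : ℝ) : ℂ) := by
    intro b hb hbc hcop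
    have hb0 : (0 : ℝ) < b := by exact_mod_cast hb.pos
    rw [gsum_odd_reciprocity b c hb hc, ih b hbc hb c (by simpa using hcop.symm)]
    have hs : (√((c : ℝ) / b) : ℂ) * √(b : ℝ) = √(c : ℝ) := by
      rw [← Complex.ofReal_mul, ← Real.sqrt_mul (by positivity), div_mul_cancel₀ _ hb0.ne']
    have hq := jacobiSym.quadratic_reciprocity_if (Nat.odd_iff.1 hb) (Nat.odd_iff.1 hc)
    simp only [map_mul, map_intCast, Complex.conj_ofReal]
    rw [← hq]
    generalize (√((c : ℝ) / b) : ℂ) = u at *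
    generalize (√(b : ℝ) : ℂ) = v at *
    generalize (√(c : ℝ) : ℂ) = w at *
    subst hs
    have hm := Nat.mul_mod b c 4
    rcases odd_mod_four hb with h1 | h1 <;> rcases odd_mod_four hc with h2 | h2 <;>
      rw [h1, h2] at hm <;> simp [h1, h2, epsFactor, hm] <;> ring_nf
    simp
  rcases Nat.lt_or_ge 1 c with hc1 | hc1
  · have hc0 : (0 : ℤ) < c := by omega
    set b0 := a % (c : ℤ) with hb0
    have hb0n := Int.emod_nonneg a hc0.ne'
    have hb0l := Int.emod_lt_of_pos a hc0
    have hgs : gsum a c = gsum b0 c := by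
      rw [← gsum_add_mul b0 (a / c) c]; congr 1; rw [hb0, Int.emod_add_mul_ediv]
    have hcop : b0.gcd c = 1 := by rw [hb0, Int.gcd_emod]; exact hac
    have hJ : jacobiSym a c = jacobiSym b0 c := jacobiSym.mod_left a c
    rw [hgs, hJ]
    rcases Int.even_or_odd b0 with he | ho
    · obtain ⟨b, hb⟩ : ∃ b : ℕ, (b : ℤ) = c - b0 := ⟨(c - b0).toNat, by omega⟩
      have hbodd : Odd b := by
        have : Odd (b : ℤ) := by
          rw [hb]; exact Odd.sub_even (by exact_mod_cast hc) he
        exact_mod_cast this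
      have hb00 : b0 ≠ 0 := by
        rintro h; rw [h] at hcop; simp at hcop; omega
      have hbeq : b0 = -(b : ℤ) + c * 1 := by rw [hb]; ring
      have hbc : b.Coprime c := by
        rw [hbeq] at hcop
        have : (-(b : ℤ)).gcd c = 1 := by
          simpa using hcop
        simpa using this
      rw [hbeq, gsum_add_mul, gsum_neg, hpos b hbodd (by omega) hbc]
      have : jacobiSym (-(b : ℤ) + c * 1) c = jacobiSym (-(b : ℤ)) c := by
        rw [jacobiSym.mod_left, jacobiSym.mod_left (-(b : ℤ))]; congr 1; simp
      rw [this, jacobiSym.neg _ hc]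
      simp only [map_mul, map_intCast, Complex.conj_ofReal]
      rcases odd_mod_four hc with h2 | h2
      · rw [epsFactor_of_one h2, ZMod.χ₄_nat_one_mod_four h2]; simp
      · rw [epsFactor_of_three h2, ZMod.χ₄_nat_three_mod_four h2]; simp
    · obtain ⟨b, hb⟩ : ∃ b : ℕ, (b : ℤ) = b0 := ⟨b0.toNat, by omega⟩
      rw [← hb] at ho hcop ⊢
      exact hpos b (by exact_mod_cast ho) (by omega) (by simpa using hcop)
  · have : c = 1 := by have := hc.pos; omega
    subst this
    simp [gsum, ee_zero, epsFactor]

theorem gsum_four_mul (p a : ℕ) (hp : 0 < p) (ha : Odd a) (hap : a.Coprime p) :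
    gsum a (4 * p) = (1 + I) * (√((4 * p : ℕ) : ℝ) : ℂ) * (starRingEnd ℂ) (epsFactor a) *
      (jacobiSym p a : ℤ) := by
  have ha0 : 0 < a := ha.pos
  have ha' : (a : ℂ) ≠ 0 := by exact_mod_cast ha0.ne'
  have hp' : (p : ℂ) ≠ 0 := by exact_mod_cast hp.ne'
  have h2 : (√2 : ℂ) * √2 = 2 := by
    have := ofReal_sqrt_mul_self (x := 2) (by norm_num); simpa using this
  have h20 : (√2 : ℂ) ≠ 0 := by
    intro h1; rw [h1] at h2; norm_num at h2
  have h := landsberg_schaar (2 * a) (4 * p) (by omega) (by omega)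
    (by rw [mul_assoc]; exact Even.mul_right (by decide) _)
  have e1 : ∑ x ∈ Finset.range (4 * p), ee (((2 * a : ℕ) : ℂ) * x ^ 2 / (2 * ((4 * p : ℕ) : ℂ))) =
      gsum a (4 * p) := by
    refine Finset.sum_congr rfl fun x _ => ?_
    congr 1; push_cast; rw [mul_assoc, mul_div_mul_left _ _ (by norm_num)]
  have e2 : ∑ n ∈ Finset.range (2 * a), ee (-(((4 * p : ℕ) : ℂ) * n ^ 2 / (2 * ((2 * a : ℕ) : ℂ)))) =
      2 * (starRingEnd ℂ) (gsum p a) := by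
    rw [← gsum_neg, show (2 : ℂ) = ((2 : ℕ) : ℂ) by norm_num, gsum, ← nsmul_eq_mul (α := ℂ) 2 (∑ _ ∈ _, _),
      ← sum_range_mul_of_periodic (fun x : ℕ => ee ((-(p : ℤ) : ℤ) * x ^ 2 / a)) a 2 (gsum_periodic_aux (-p) a ha0)]
    refine Finset.sum_congr rfl fun n _ => ?_
    congr 1; push_cast; field_simp; ring
  have e5 : (√(((4 * p : ℕ) : ℝ) / ((2 * a : ℕ) : ℝ)) : ℝ) = √((4 * p : ℕ) : ℝ) / √2 / √(a : ℝ) := by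
    rw [← Real.sqrt_div' _ (by norm_num), ← Real.sqrt_div' _ (by positivity)]
    congr 1; push_cast; field_simp
  have hsa : (√(a : ℝ) : ℂ) ≠ 0 := ofReal_sqrt_ne_zero (by exact_mod_cast ha0)
  rw [e1, e2, gsum_eq_jacobiSym a ha p (by simpa using hap.symm), e5, ee_eighth] at h
  rw [h]
  simp only [map_mul, map_intCast, Complex.conj_ofReal]
  push_cast
  field_simp
  linear_combination (-(√(4 * (p : ℝ)) : ℂ) * (jacobiSym p a : ℤ) *
    (starRingEnd ℂ) (epsFactor a) * (1 + I)) * h2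

/-- Representatives `a` of the residues modulo `k` with `-k ≤ 2 a < k` . -/
def centered (k : ℕ) : Finset ℤ := Finset.Ico (-((k / 2 : ℕ) : ℤ)) (k - (k / 2 : ℕ))

/-- The sum of `f (a / k) G(a, k)` over the centered residues. -/
def gaussTransform (f : ℝ → ℂ) (k : ℕ) : ℂ := ∑ a ∈ centered k, f (a / k) * gsum a k

/-- The sum of `f (a / k) G(a, k)` over the centered residues prime to the modulus. -/
def primGaussTransform (f : ℝ → ℂ) (k : ℕ) : ℂ :=
  ∑ a ∈ centered k, if a.gcd k = 1 then f (a / k) * gsum a k else 0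

lemma jacobiSym_cube (a : ℤ) (n : ℕ) : ((jacobiSym a n : ℤ) : ℂ) ^ 3 = (jacobiSym a n : ℤ) := by
  rcases jacobiSym.trichotomy a n with h | h | h <;> rw [h] <;> norm_num

lemma epsFactor_inv_cube {c : ℕ} (hc : Odd c) : (epsFactor c)⁻¹ ^ 3 = epsFactor c := by
  rcases odd_mod_four hc with h | h
  · rw [epsFactor_of_one h]; norm_num
  · rw [epsFactor_of_three h, inv_I]
    linear_combination (-I) * I_sq

lemma exists_even_neg_inverse {c : ℕ} (hc : Odd c) {b : ℤ} (hb : b.gcd c = 1) :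
    ∃ x : ℕ, x < 2 * c ∧ x % 2 = 0 ∧ (b * x) % (c : ℤ) = (-1) % (c : ℤ) := by
  have hc0 : (0 : ℤ) < c := by exact_mod_cast hc.pos
  obtain ⟨u, hu⟩ : ∃ u : ℤ, (b * u) ≡ -1 [ZMOD c] := by
    obtain ⟨u, hu⟩ := Int.mod_coprime (a := b.natAbs) (b := c) (by simpa [Int.gcd] using hb)
    rcases Int.natAbs_eq b with h | h
    · refine ⟨-u, ?_⟩
      rw [h, mul_neg]; exact hu.neg
    · refine ⟨u, ?_⟩
      rw [h, neg_mul]; exact hu.neg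
  have hv0 := Int.emod_nonneg u hc0.ne'
  have hvl := Int.emod_lt_of_pos u hc0
  have hvu : u % c ≡ u [ZMOD c] := Int.mod_modEq u c
  obtain ⟨v, hv⟩ : ∃ v : ℕ, (v : ℤ) = u % c := ⟨(u % c).toNat, by omega⟩
  rcases Nat.even_or_odd v with he | ho
  · refine ⟨v, by omega, Nat.even_iff.1 he, ?_⟩
    rw [hv]
    exact (hvu.mul_left b).trans hu
  · refine ⟨v + c, by omega, Nat.even_iff.1 (ho.add_odd hc), ?_⟩
    push_cast
    rw [hv]
    have : u % (c : ℤ) + c ≡ u [ZMOD c] := by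
      simp [Int.ModEq]
    exact (this.mul_left b).trans hu

lemma jacobiSym_neg_inverse {c : ℕ} {b x : ℤ} (h : (2 * b * x) % (c : ℤ) = (-1) % (c : ℤ)) :
    jacobiSym (-(2 * x)) c = jacobiSym b c := by
  have h1 : jacobiSym (-(2 * x)) c * jacobiSym b c = 1 := by
    rw [← jacobiSym.mul_left, jacobiSym.mod_left]
    have : (-(2 * x) * b) % (c : ℤ) = 1 % (c : ℤ) := by
      have h2 : (2 * b * x) ≡ -1 [ZMOD c] := h
      have h3 := h2.neg
      rw [neg_neg] at h3
      rw [show -(2 * x) * b = -(2 * b * x) by ring]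
      exact h3
    rw [this, ← jacobiSym.mod_left, jacobiSym.one_left]
  rcases jacobiSym.trichotomy b c with h2 | h2 | h2 <;> rw [h2] at h1 ⊢ <;> omega

theorem RKo_eq (t : ℝ) (c : ℕ) (hc : Odd c) :
    RKo t 0 c 3 = ee (3 / 8) * ((√(c : ℝ) : ℂ))⁻¹ *
      primGaussTransform (fun u => ee ((t * u : ℝ) : ℂ)) c := by
  have hc0 : (0 : ℤ) < c := by exact_mod_cast hc.pos
  have hcR : (0 : ℝ) < c := by exact_mod_cast hc.pos
  have hs : (√(c : ℝ) : ℂ) ≠ 0 := ofReal_sqrt_ne_zero hcR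
  have hinner : ∀ b : ℤ, (∑ cb ∈ Finset.range (2 * c),
      if b % 2 = 0 ∧ cb % 2 = 0 ∧ (b * cb) % (c : ℤ) = (-1) % (c : ℤ) then
        ((jacobiSym (-(2 * (cb : ℤ))) c : ℤ) : ℂ) ^ 3 *
          ee (((t * b - ((0 : ℤ) : ℝ) * cb) / (2 * c) : ℝ) : ℂ)
      else 0) = if b % 2 = 0 ∧ (b / 2).gcd c = 1 then
        ((jacobiSym (b / 2) c : ℤ) : ℂ) * ee ((t * ((b / 2 : ℤ) / c) : ℝ) : ℂ) else 0 := by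
    intro b
    by_cases hb : b % 2 = 0 ∧ (b / 2).gcd c = 1
    · rw [if_pos hb]
      obtain ⟨hb2, hbc⟩ := hb
      obtain ⟨b', rfl⟩ : ∃ b', b = 2 * b' := ⟨b / 2, by omega⟩
      have hdiv : 2 * b' / 2 = b' := by omega
      rw [hdiv] at hbc ⊢
      have hcop : (2 * b').gcd c = 1 := by
        have h2 : (2 : ℤ).gcd c = 1 := by
          have := Nat.coprime_two_left.2 hc
          simpa [Int.gcd] using this
        have := IsCoprime.mul_left (Int.isCoprime_iff_gcd_eq_one.2 h2)
          (Int.isCoprime_iff_gcd_eq_one.2 hbc)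
        exact Int.isCoprime_iff_gcd_eq_one.1 this
      obtain ⟨x, hx1, hx2, hx3⟩ := exists_even_neg_inverse hc hcop
      rw [Finset.sum_eq_single_of_mem x (Finset.mem_range.2 hx1)]
      · rw [if_pos ⟨hb2, hx2, hx3⟩, jacobiSym_cube, jacobiSym_neg_inverse hx3]
        congr 3
        push_cast
        field_simp
        ring
      · intro y hy hyx
        rw [if_neg]
        rintro ⟨-, hy2, hy3⟩
        apply hyx
        rw [Finset.mem_range] at hy
        have h4 : (2 * b') * y ≡ (2 * b') * x [ZMOD c] := hy3.trans hx3.symm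
        have h5 : (y : ℤ) ≡ x [ZMOD c] := by
          have h9 := h4.dvd
          rw [← mul_sub] at h9
          exact (Int.modEq_iff_dvd).2 ((Int.isCoprime_iff_gcd_eq_one.2 hcop).symm.dvd_of_dvd_mul_left h9)
        have h6 : (y : ℤ) ≡ x [ZMOD 2] := by
          unfold Int.ModEq; omega
        have h7 : (y : ℤ) ≡ x [ZMOD (2 * c)] := by
          refine (Int.modEq_and_modEq_iff_modEq_mul ?_).1 ⟨h6, h5⟩
          simpa using hc
        have h8 := h7
        unfold Int.ModEq at h8
        rw [Int.emod_eq_of_lt (by omega) (by omega), Int.emod_eq_of_lt (by omega) (by omega)] at h8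
        exact_mod_cast h8
    · rw [if_neg hb]
      refine Finset.sum_eq_zero fun x _ => ?_
      rw [if_neg]
      rintro ⟨h1, -, h3⟩
      apply hb
      refine ⟨h1, ?_⟩
      obtain ⟨b', rfl⟩ : ∃ b', b = 2 * b' := ⟨b / 2, by omega⟩
      have hdiv : 2 * b' / 2 = b' := by omega
      rw [hdiv]
      have h4 : 2 * b' * x ≡ -1 [ZMOD c] := h3
      obtain ⟨m, hm⟩ := h4.dvd
      rw [← Int.isCoprime_iff_gcd_eq_one]
      exact ⟨-2 * x, -m, by linear_combination hm⟩
  unfold RKo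
  simp_rw [hinner]
  rw [epsFactor_inv_cube hc, primGaussTransform]
  have hsum : ∑ b ∈ Finset.Ico (-(c : ℤ) + 1) (c : ℤ), (if b % 2 = 0 ∧ (b / 2).gcd c = 1 then
        ((jacobiSym (b / 2) c : ℤ) : ℂ) * ee ((t * ((b / 2 : ℤ) / c) : ℝ) : ℂ) else 0) =
      ∑ a ∈ centered c, if a.gcd c = 1 then
        ((jacobiSym a c : ℤ) : ℂ) * ee ((t * (a / c) : ℝ) : ℂ) else 0 := by
    symm
    rw [← Finset.sum_filter, ← Finset.sum_filter]
    refine Finset.sum_bij (fun a _ => 2 * a) ?_ ?_ ?_ ?_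
    · intro a ha
      simp only [Finset.mem_filter, centered, Finset.mem_Ico] at ha ⊢
      obtain ⟨m, hm⟩ := hc
      have : 2 * a / 2 = a := by omega
      rw [this]
      refine ⟨by omega, by omega, ha.2⟩
    · intro a _ b _ h
      simpa using h
    · intro b hb
      simp only [Finset.mem_filter, centered, Finset.mem_Ico] at hb ⊢
      obtain ⟨m, hm⟩ := hc
      exact ⟨b / 2, ⟨by omega, hb.2.2⟩, by omega⟩
    · intro a _
      have : 2 * a / 2 = a := by omega
      simp only [this]
  rw [hsum, Finset.mul_sum, Finset.mul_sum]
  refine Finset.sum_congr rfl fun a _ => ?_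
  split_ifs with h
  · rw [gsum_eq_jacobiSym c hc a h]
    push_cast
    field_simp
  · simp

lemma jacobiSym_four_mul_left (p : ℤ) {n : ℕ} (hn : Odd n) :
    jacobiSym (4 * p) n = jacobiSym p n := by
  rw [jacobiSym.mul_left, jacobiSym.at_four hn, one_mul]

lemma jacobiSym_of_modEq_neg_one {p n : ℕ} (hp : 0 < p) (h : (4 * p : ℤ) ∣ n + 1) :
    jacobiSym p n = 1 := by
  have hn : Odd n := by
    obtain ⟨m, hm⟩ := h
    have : Odd (n : ℤ) := ⟨2 * p * m - 1, by linear_combination hm⟩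
    exact_mod_cast this
  have h4 : (4 * p : ℤ).natAbs = 4 * p := by
    simp [Int.natAbs_mul]
  rw [jacobiSym.mod_right _ hn]
  have h1 : (n % (4 * (p : ℤ).natAbs)) = 4 * p - 1 := by
    simp only [Int.natAbs_natCast]
    have h2 : (4 * p) ∣ n + 1 := by exact_mod_cast h
    obtain ⟨m, hm⟩ := h2
    have hm0 : m ≠ 0 := by rintro rfl; omega
    obtain ⟨m', rfl⟩ := Nat.exists_eq_succ_of_ne_zero hm0
    have : n = (4 * p - 1) + 4 * p * m' := by
      rw [Nat.succ_eq_add_one, mul_add] at hm; omega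
    rw [this, Nat.add_mul_mod_self_left, Nat.mod_eq_of_lt (by omega)]
  rw [h1]
  have hodd : Odd (4 * p - 1) := ⟨2 * p - 1, by omega⟩
  rw [← jacobiSym_four_mul_left _ hodd]
  have : (4 * (p : ℤ)) = 1 + (((4 * p - 1 : ℕ)) : ℤ) := by omega
  rw [this, jacobiSym.mod_left, Int.add_emod_right, ← jacobiSym.mod_left, jacobiSym.one_left]

lemma jacobiSym_of_modEq_one {p n : ℕ} (h : (4 * p : ℤ) ∣ n - 1) : jacobiSym p n = 1 := by
  have hn : Odd n := by
    obtain ⟨m, hm⟩ := h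
    have : Odd (n : ℤ) := ⟨2 * p * m, by linear_combination hm⟩
    exact_mod_cast this
  rw [jacobiSym.mod_right _ hn]
  have h1 : (n % (4 * (p : ℤ).natAbs)) = 1 % (4 * p) := by
    simp only [Int.natAbs_natCast]
    exact ((Nat.modEq_iff_dvd).2 (by push_cast; simpa using h)).symm
  have h2 : jacobiSym p 1 = jacobiSym p (1 % (4 * (p : ℤ).natAbs)) := jacobiSym.mod_right _ odd_one
  rw [h1]
  simp only [Int.natAbs_natCast] at h2
  rw [← h2, jacobiSym.one_right]

lemma jacobiSym_eq_of_mul_eq_one {p : ℤ} {m n : ℕ} (hm : m ≠ 0) (hn : n ≠ 0)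
    (h : jacobiSym p (m * n) = 1) : jacobiSym p m = jacobiSym p n := by
  have := NeZero.mk hm
  have := NeZero.mk hn
  rw [jacobiSym.mul_right] at h
  rcases jacobiSym.trichotomy p m with h2 | h2 | h2 <;> rw [h2] at h ⊢ <;> omega

lemma RKe_summand {p : ℕ} (hp : 0 < p) {a : ℤ} {d : ℕ}
    (h : (a * d) % (4 * (p : ℤ)) = 1) :
    epsFactor d ^ 3 * ((jacobiSym (4 * (p : ℤ)) d : ℤ) : ℂ) ^ 3 =
      ((1 + I) * (√((4 * p : ℕ) : ℝ) : ℂ))⁻¹ * gsum a (4 * p) := by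
  have hs : (√((4 * p : ℕ) : ℝ) : ℂ) ≠ 0 :=
    ofReal_sqrt_ne_zero (by exact_mod_cast (by omega : 0 < 4 * p))
  have hI : (1 + I) ≠ 0 := by
    intro h; simpa using congrArg Complex.re h
  have hdvd : (4 * (p : ℤ)) ∣ a * d - 1 := Int.dvd_self_sub_of_emod_eq h
  have hodd : Odd (a * d) := by
    obtain ⟨m, hm⟩ := hdvd
    exact ⟨2 * p * m, by linear_combination hm⟩
  have hdo : Odd d := by exact_mod_cast (Int.odd_mul.1 hodd).2
  have hao := (Int.odd_mul.1 hodd).1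
  have hcop : IsCoprime a (p : ℤ) := by
    obtain ⟨m, hm⟩ := hdvd
    exact ⟨d, -4 * m, by linear_combination hm⟩
  have h4 : (a * d) % 4 = 1 := by
    obtain ⟨m, hm⟩ := hdvd
    have : a * d = 1 + 4 * (p * m) := by linear_combination hm
    omega
  rw [jacobiSym_cube, jacobiSym_four_mul_left _ hdo]
  obtain ⟨b, hb⟩ := Int.eq_nat_or_neg a
  have hd0 : d ≠ 0 := hdo.pos.ne'
  rcases hb with rfl | rfl
  · have hbo : Odd b := by exact_mod_cast hao
    rw [gsum_four_mul p b hp hbo (Nat.isCoprime_iff_coprime.1 hcop)]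
    have hJ : jacobiSym p d = jacobiSym p b :=
      (jacobiSym_eq_of_mul_eq_one hbo.pos.ne' hd0
        (jacobiSym_of_modEq_one (by push_cast; exact hdvd))).symm
    rw [hJ]
    have hbd : (b * d) % 4 = 1 := by exact_mod_cast h4
    have hm := Nat.mul_mod b d 4
    rcases odd_mod_four hbo with h1 | h1 <;> rcases odd_mod_four hdo with h2 | h2 <;>
      rw [h1, h2, hbd] at hm <;> simp at hm
    · rw [epsFactor_of_one h1, epsFactor_of_one h2]
      simp only [map_one]
      field_simp
    · rw [epsFactor_of_three h1, epsFactor_of_three h2]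
      simp only [conj_I]
      field_simp
      linear_combination ((jacobiSym p b : ℤ) : ℂ) * I_sq
  · have hbo : Odd b := by
      have := hao.neg; rw [neg_neg] at this; exact_mod_cast this
    rw [gsum_neg, gsum_four_mul p b hp hbo (Nat.isCoprime_iff_coprime.1 (by simpa using hcop.neg_left))]
    have hJ : jacobiSym p d = jacobiSym p b :=
      (jacobiSym_eq_of_mul_eq_one hbo.pos.ne' hd0
        (jacobiSym_of_modEq_neg_one hp (by
          obtain ⟨m, hm⟩ := hdvd
          exact ⟨-m, by push_cast; linear_combination -hm⟩))).symm
    rw [hJ]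
    have hbd : (b * d) % 4 = 3 := by
      have : (-(b : ℤ) * d) = -((b * d : ℕ) : ℤ) := by push_cast; ring
      omega
    have hm := Nat.mul_mod b d 4
    rcases odd_mod_four hbo with h1 | h1 <;> rcases odd_mod_four hdo with h2 | h2 <;>
      rw [h1, h2, hbd] at hm <;> simp at hm
    · rw [epsFactor_of_one h1, epsFactor_of_three h2]
      simp only [map_mul, map_add, map_one, conj_I, conj_ofReal, map_intCast]
      field_simp
      linear_combination ((jacobiSym p b : ℤ) : ℂ) * (I + I ^ 2 - 1) * I_sq
    · rw [epsFactor_of_three h1, epsFactor_of_one h2]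
      simp only [map_mul, map_add, map_one, map_neg, neg_neg, conj_I, conj_ofReal, map_intCast]
      field_simp
      linear_combination ((jacobiSym p b : ℤ) : ℂ) * I_sq

theorem RKe_eq (t : ℝ) (c : ℕ) (hc : Even c) (hc0 : 0 < c) :
    RKe t 0 c 3 = ((1 + I) * (√((2 * c : ℕ) : ℝ) : ℂ))⁻¹ *
      primGaussTransform (fun u => ee ((t * u : ℝ) : ℂ)) (2 * c) := by
  obtain ⟨p, rfl⟩ := hc
  have hp : 0 < p := by omega
  have hq : 2 * (p + p) = 4 * p := by ring
  have hqZ : 2 * (((p + p : ℕ) : ℤ)) = 4 * (p : ℤ) := by push_cast; ring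
  have hinner : ∀ a : ℤ, (∑ d ∈ Finset.Ico 1 (2 * (p + p)),
      if (a * d) % (2 * ((p + p : ℕ) : ℤ)) = 1 then
      epsFactor d ^ 3 * ((jacobiSym (2 * ((p + p : ℕ) : ℤ)) d : ℤ) : ℂ) ^ 3 *
        ee (((t * a + ((0 : ℤ) : ℝ) * d) / (2 * ((p + p : ℕ) : ℝ)) : ℝ) : ℂ)
    else 0) = if a.gcd ((4 * p : ℕ) : ℤ) = 1 then ((1 + I) * (√((4 * p : ℕ) : ℝ) : ℂ))⁻¹ *
      (ee ((t * (a / ((4 * p : ℕ) : ℝ)) : ℝ) : ℂ) * gsum a (4 * p)) else 0 := by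
    intro a
    rw [hqZ, hq]
    by_cases hb : a.gcd ((4 * p : ℕ) : ℤ) = 1
    · rw [if_pos hb]
      have hq0 : (0 : ℤ) < 4 * p := by omega
      obtain ⟨u, v, huv⟩ := Int.isCoprime_iff_gcd_eq_one.2 hb
      have hv0 := Int.emod_nonneg u hq0.ne'
      have hvl := Int.emod_lt_of_pos u hq0
      obtain ⟨x, hx⟩ : ∃ x : ℕ, (x : ℤ) = u % (4 * p : ℤ) := ⟨(u % (4 * p : ℤ)).toNat, by omega⟩
      have hax : (a * x) % (4 * (p : ℤ)) = 1 := by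
        have h1 : a * x ≡ 1 [ZMOD (4 * p)] := by
          have h2 : (x : ℤ) ≡ u [ZMOD (4 * p)] := by rw [hx]; exact Int.mod_modEq _ _
          refine (h2.mul_left a).trans ?_
          refine Int.modEq_iff_dvd.2 ⟨v, ?_⟩
          push_cast at huv
          linear_combination -huv
        have h2 := h1
        unfold Int.ModEq at h2
        rw [h2]
        exact Int.emod_eq_of_lt (by norm_num) (by omega)
      have hx0 : x ≠ 0 := by
        rintro rfl; simp at hax
      rw [Finset.sum_eq_single_of_mem x (Finset.mem_Ico.2 ⟨by omega, by omega⟩)]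
      · rw [if_pos hax, RKe_summand hp hax, mul_assoc, mul_comm (gsum _ _)]
        congr 4
        push_cast
        ring
      · intro y hy hyx
        rw [if_neg]
        intro hy3
        apply hyx
        rw [Finset.mem_Ico] at hy
        have h4 : a * y ≡ a * x [ZMOD (4 * p)] := hy3.trans hax.symm
        have h9 := h4.dvd
        rw [← mul_sub] at h9
        have h5 : (y : ℤ) ≡ x [ZMOD (4 * p)] := by
          refine (Int.modEq_iff_dvd).2 (IsCoprime.dvd_of_dvd_mul_left ?_ h9)
          have := (Int.isCoprime_iff_gcd_eq_one.2 hb).symm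
          push_cast at this
          exact this
        have h8 := h5
        unfold Int.ModEq at h8
        rw [Int.emod_eq_of_lt (by omega) (by omega), Int.emod_eq_of_lt (by omega) (by omega)] at h8
        exact_mod_cast h8
    · rw [if_neg hb]
      refine Finset.sum_eq_zero fun x _ => ?_
      rw [if_neg]
      intro h3
      apply hb
      obtain ⟨m, hm⟩ := Int.dvd_self_sub_of_emod_eq h3
      rw [← Int.isCoprime_iff_gcd_eq_one]
      exact ⟨x, -m, by push_cast; linear_combination hm⟩
  unfold RKe
  simp_rw [hinner]
  rw [hq, primGaussTransform, Finset.mul_sum]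
  have hcent : centered (4 * p) = Finset.Ico (-((p + p : ℕ) : ℤ)) ((p + p : ℕ) : ℤ) := by
    unfold centered; congr 1 <;> omega
  rw [hcent]
  have hsub : Finset.Ico (-((p + p : ℕ) : ℤ) + 1) ((p + p : ℕ) : ℤ) ⊆
      Finset.Ico (-((p + p : ℕ) : ℤ)) ((p + p : ℕ) : ℤ) :=
    Finset.Ico_subset_Ico_left (by omega)
  rw [Finset.sum_subset hsub]
  · refine Finset.sum_congr rfl fun a _ => ?_
    split_ifs <;> simp
  · intro a ha hna
    rw [Finset.mem_Ico] at ha hna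
    have : a = -((p + p : ℕ) : ℤ) := by omega
    rw [if_neg]
    rw [this]
    intro h
    have h2 : (2 : ℤ) ∣ 1 := by
      rw [show (1 : ℤ) = ((1 : ℕ) : ℤ) by rfl, ← h]
      exact Int.dvd_coe_gcd (by push_cast; omega) (by push_cast; omega)
    omega

lemma mem_centered {k : ℕ} {a : ℤ} : a ∈ centered k ↔ -(k : ℤ) ≤ 2 * a ∧ 2 * a < k := by
  simp only [centered, Finset.mem_Ico]
  omega

lemma gaussTransform_div_eq_sum_divisors (f : ℝ → ℂ) {k : ℕ} (hk : 0 < k) :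
    gaussTransform f k / k = ∑ q ∈ k.divisors, primGaussTransform f q / q := by
  have hk0 : (k : ℂ) ≠ 0 := by exact_mod_cast hk.ne'
  have hmaps : ∀ a ∈ centered k, k / a.gcd k ∈ k.divisors := fun a _ => by
    rw [Nat.mem_divisors]
    refine ⟨Nat.div_dvd_of_dvd ?_, hk.ne'⟩
    exact_mod_cast Int.gcd_dvd_right a k
  rw [gaussTransform, ← Finset.sum_fiberwise_of_maps_to hmaps, Finset.sum_div]
  refine Finset.sum_congr rfl fun q hq => ?_
  obtain ⟨⟨g, rfl⟩, -⟩ := Nat.mem_divisors.mp hq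
  have hq0 : 0 < q := Nat.pos_of_mul_pos_right hk
  have hg0 : 0 < g := Nat.pos_of_mul_pos_left hk
  have hqC : (q : ℂ) ≠ 0 := by exact_mod_cast hq0.ne'
  have hgC : (g : ℂ) ≠ 0 := by exact_mod_cast hg0.ne'
  have key : ∑ a ∈ centered (q * g) with q * g / a.gcd (q * g : ℕ) = q,
      f (a / (q * g : ℕ)) * gsum a (q * g)
      = ∑ b ∈ centered q, if b.gcd q = 1 then (g : ℂ) * (f (b / q) * gsum b q) else 0 := by
    rw [← Finset.sum_filter]
    symm
    refine Finset.sum_bij (fun b _ => (g : ℤ) * b) ?_ ?_ ?_ ?_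
    · intro b hb
      rw [Finset.mem_filter, mem_centered] at hb ⊢
      obtain ⟨⟨h1, h2⟩, h3⟩ := hb
      have hgZ : (0 : ℤ) < g := by exact_mod_cast hg0
      refine ⟨⟨by push_cast; nlinarith, by push_cast; nlinarith⟩, ?_⟩
      have : (g * b : ℤ).gcd (q * g : ℕ) = g := by
        push_cast
        rw [mul_comm (q : ℤ), Int.gcd_mul_left, h3]
        simp
      rw [this, Nat.mul_div_cancel _ hg0]
    · intro b _ b' _ h
      have hgZ : (g : ℤ) ≠ 0 := by exact_mod_cast hg0.ne'
      exact mul_left_cancel₀ hgZ h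
    · intro a ha
      rw [Finset.mem_filter, mem_centered] at ha
      obtain ⟨⟨h1, h2⟩, h3⟩ := ha
      have hgZ : (0 : ℤ) < g := by exact_mod_cast hg0
      have hd : a.gcd (q * g : ℕ) = g := by
        have hdv : a.gcd (q * g : ℕ) ∣ q * g := by
          exact_mod_cast Int.gcd_dvd_right a (q * g : ℕ)
        have := Nat.div_mul_cancel hdv
        rw [h3] at this
        exact Nat.eq_of_mul_eq_mul_left hq0 this
      have hga : (g : ℤ) ∣ a := by
        have := Int.gcd_dvd_left a (q * g : ℕ)
        rwa [hd] at this
      obtain ⟨b, rfl⟩ := hga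
      refine ⟨b, ?_, rfl⟩
      rw [Finset.mem_filter, mem_centered]
      push_cast at h1 h2 hd
      refine ⟨⟨by nlinarith, by nlinarith⟩, ?_⟩
      rw [mul_comm (q : ℤ), Int.gcd_mul_left] at hd
      simp only [Int.natAbs_natCast] at hd
      exact Nat.eq_of_mul_eq_mul_left hg0 (by simpa using hd)
    · intro b _
      rw [mul_comm q g, gsum_mul_mul b q g hg0 hq0]
      have : (((g : ℤ) * b : ℤ) : ℝ) / ((g * q : ℕ) : ℝ) = b / q := by
        have : (g : ℝ) ≠ 0 := by exact_mod_cast hg0.ne'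
        push_cast
        rw [mul_div_mul_left _ _ this]
      rw [this]
      ring
  rw [key, primGaussTransform, Finset.sum_div, Finset.sum_div]
  refine Finset.sum_congr rfl fun b _ => ?_
  split_ifs
  · push_cast
    field_simp
  · simp

/-- The indicator function of the integers prime to `M`. -/
def copInd (M n : ℕ) : ℝ := if n.Coprime M then 1 else 0

lemma copInd_mul (M a b : ℕ) : copInd M (a * b) = copInd M a * copInd M b := by
  simp only [copInd, Nat.coprime_mul_iff_left]
  split_ifs <;> simp_all

lemma copInd_nonneg (M n : ℕ) : 0 ≤ copInd M n := by
  unfold copInd; split_ifs <;> norm_num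

lemma copInd_le_one (M n : ℕ) : copInd M n ≤ 1 := by
  unfold copInd; split_ifs <;> norm_num

lemma copInd_one_left (n : ℕ) : copInd 1 n = 1 := by simp [copInd]

lemma copInd_mul_div_rpow (M : ℕ) (v : ℝ) (a b : ℕ) :
    copInd M (a * b) / ((a * b : ℕ) : ℝ) ^ v
      = (copInd M a / (a : ℝ) ^ v) * (copInd M b / (b : ℝ) ^ v) := by
  rw [copInd_mul, Nat.cast_mul, Real.mul_rpow (Nat.cast_nonneg a) (Nat.cast_nonneg b),
    mul_div_mul_comm]

lemma copInd_div_rpow_zero (M : ℕ) {v : ℝ} (hv : 0 < v) : copInd M 0 / ((0 : ℕ) : ℝ) ^ v = 0 := by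
  rw [Nat.cast_zero, Real.zero_rpow hv.ne', div_zero]

lemma copInd_div_rpow_nonneg (M : ℕ) (v : ℝ) (n : ℕ) : 0 ≤ copInd M n / (n : ℝ) ^ v :=
  div_nonneg (copInd_nonneg M n) (Real.rpow_nonneg (Nat.cast_nonneg n) v)

lemma summable_copInd_div_rpow (M : ℕ) {v : ℝ} (hv : 1 < v) :
    Summable fun n : ℕ => copInd M n / (n : ℝ) ^ v := by
  refine Summable.of_nonneg_of_le (copInd_div_rpow_nonneg M v) (fun n => ?_)
    (Real.summable_one_div_nat_rpow.mpr hv)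
  exact div_le_div_of_nonneg_right (copInd_le_one M n) (Real.rpow_nonneg (Nat.cast_nonneg n) v)

/-- The sum of `n ^ (-v)` over the positive integers `n` prime to `M`. -/
def zetaCop (M : ℕ) (v : ℝ) : ℝ := ∑' n : ℕ, copInd M n / (n : ℝ) ^ v

/-- Regrouping a sum over pairs according to their product. -/
lemma HasSum.divisorsAntidiagonal {E : Type*} [AddCommMonoid E] [TopologicalSpace E]
    [ContinuousAdd E] [RegularSpace E] {F : ℕ × ℕ → E} {S : E} (hF : HasSum F S)
    (h0 : ∀ p : ℕ × ℕ, p.1 * p.2 = 0 → F p = 0) :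
    HasSum (fun n : ℕ => ∑ p ∈ n.divisorsAntidiagonal, F p) S := by
  have h1 := (Equiv.sigmaFiberEquiv (fun p : ℕ × ℕ => p.1 * p.2)).hasSum_iff.mpr hF
  refine h1.sigma fun n => ?_
  rcases eq_or_ne n 0 with rfl | hn
  · simp only [Nat.divisorsAntidiagonal_zero, Finset.sum_empty]
    convert hasSum_zero with p
    exact h0 _ p.2
  · have h2 : ∀ p : ℕ × ℕ, p.1 * p.2 = n ↔ p ∈ n.divisorsAntidiagonal := fun p => by simp [hn]
    have h3 := (n.divisorsAntidiagonal).hasSum F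
    exact (Equiv.subtypeEquivRight h2).hasSum_iff.mpr h3

lemma HasSum.mul_divisorsAntidiagonal {a b : ℕ → ℂ} {A B : ℂ} (ha : HasSum a A) (hb : HasSum b B)
    (ha0 : a 0 = 0) (hb0 : b 0 = 0) :
    HasSum (fun n : ℕ => ∑ p ∈ n.divisorsAntidiagonal, a p.1 * b p.2) (A * B) := by
  have hs := summable_mul_of_summable_norm ha.summable.norm hb.summable.norm
  refine HasSum.divisorsAntidiagonal (F := fun p => a p.1 * b p.2) (ha.mul hb hs) ?_
  rintro ⟨p, q⟩ h
  rcases mul_eq_zero.mp h with h | h <;> simp_all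

lemma HasSum.real_mul_divisorsAntidiagonal {a b : ℕ → ℝ} {A B : ℝ} (ha : HasSum a A)
    (hb : HasSum b B) (ha0 : a 0 = 0) (hb0 : b 0 = 0) :
    HasSum (fun n : ℕ => ∑ p ∈ n.divisorsAntidiagonal, a p.1 * b p.2) (A * B) := by
  have hs := summable_mul_of_summable_norm ha.summable.norm hb.summable.norm
  refine HasSum.divisorsAntidiagonal (F := fun p => a p.1 * b p.2) (ha.mul hb hs) ?_
  rintro ⟨p, q⟩ h
  rcases mul_eq_zero.mp h with h | h <;> simp_all

lemma zetaCop_pos (M : ℕ) {v : ℝ} (hv : 1 < v) : 0 < zetaCop M v :=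
  (summable_copInd_div_rpow M hv).tsum_pos (copInd_div_rpow_nonneg M v) 1
    (by simp [copInd])

/-- Dirichlet series of the Möbius inverse of a sequence. -/
lemma hasSum_of_sum_divisors {a h : ℕ → ℂ} (M : ℕ) {v : ℝ} (hv : 1 < v)
    (hah : ∀ n > 0, ∑ q ∈ n.divisors, h q = a n) {A : ℂ}
    (ha : HasSum (fun n : ℕ => ((copInd M n / (n : ℝ) ^ v : ℝ) : ℂ) * a n) A) :
    HasSum (fun n : ℕ => ((copInd M n / (n : ℝ) ^ v : ℝ) : ℂ) * h n) (A / zetaCop M v) := by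
  set w : ℕ → ℂ := fun n => ((copInd M n / (n : ℝ) ^ v : ℝ) : ℂ) with hw
  have hw0 : w 0 = 0 := by simp only [hw, copInd_div_rpow_zero M (by linarith : (0 : ℝ) < v), ofReal_zero]
  have hwm : ∀ x y, w (x * y) = w x * w y := fun x y => by
    simp only [hw, copInd_mul_div_rpow, ofReal_mul]
  have hws : HasSum w (zetaCop M v) := by
    have := (summable_copInd_div_rpow M hv).hasSum
    exact Complex.hasSum_ofReal.mpr this
  have hsumm : Summable fun n => w n * h n := by
    have h1 : Summable fun n => w n * (ArithmeticFunction.moebius n : ℂ) := by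
      refine Summable.of_norm_bounded hws.summable.norm fun n => ?_
      rw [norm_mul]
      refine mul_le_of_le_one_right (norm_nonneg _) ?_
      rw [Complex.norm_intCast]
      exact_mod_cast ArithmeticFunction.abs_moebius_le_one
    have h2 := (HasSum.mul_divisorsAntidiagonal h1.hasSum ha (by simp [hw0])
      (show w 0 * a 0 = 0 by rw [hw0, zero_mul])).summable
    refine h2.congr fun n => ?_
    rcases Nat.eq_zero_or_pos n with rfl | hn
    · simp [hw0]
    · rw [← ArithmeticFunction.sum_eq_iff_sum_mul_moebius_eq.mp hah n hn, Finset.mul_sum]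
      refine Finset.sum_congr rfl fun p hp => ?_
      rw [← (Nat.mem_divisorsAntidiagonal.mp hp).1, hwm]
      ring
  have h3 := HasSum.mul_divisorsAntidiagonal hws hsumm.hasSum hw0 (by simp [hw0])
  have h4 : (fun n : ℕ => ∑ p ∈ n.divisorsAntidiagonal, w p.1 * (w p.2 * h p.2))
      = fun n => w n * a n := by
    funext n
    rcases Nat.eq_zero_or_pos n with rfl | hn
    · simp [hw0]
    · rw [← hah n hn, ← Nat.sum_divisorsAntidiagonal' (fun _ y => h y), Finset.mul_sum]
      refine Finset.sum_congr rfl fun p hp => ?_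
      rw [← (Nat.mem_divisorsAntidiagonal.mp hp).1, hwm]
      ring
  rw [h4] at h3
  have h5 := h3.unique ha
  have h6 : (zetaCop M v : ℂ) ≠ 0 := by exact_mod_cast (zetaCop_pos M hv).ne'
  rw [← h5, mul_div_cancel_left₀ _ h6]
  exact hsumm.hasSum

/-- The number of solutions of `x ^ 2 + m = 0` modulo `n`. -/
def sqCount (m : ℤ) (n : ℕ) : ℕ := ((Finset.range n).filter fun x : ℕ => (n : ℤ) ∣ (x : ℤ) ^ 2 + m).card

/-- The sum of the `d` with `d ^ 2 ∣ 4 m`. -/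
def sqDivSum (m : ℤ) : ℝ := ∑ d ∈ (4 * m.natAbs).divisors with d ^ 2 ∣ 4 * m.natAbs, (d : ℝ)

lemma sqDivSum_nonneg (m : ℤ) : 0 ≤ sqDivSum m := Finset.sum_nonneg fun d _ => Nat.cast_nonneg d

lemma sqDivSum_neg (m : ℤ) : sqDivSum (-m) = sqDivSum m := by simp [sqDivSum]

lemma le_sqDivSum {m : ℤ} (hm : m ≠ 0) {d : ℕ} (hd : d ^ 2 ∣ 4 * m.natAbs) : (d : ℝ) ≤ sqDivSum m := by
  refine Finset.single_le_sum (f := fun d : ℕ => (d : ℝ)) (fun d _ => Nat.cast_nonneg d) ?_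
  rw [Finset.mem_filter, Nat.mem_divisors]
  exact ⟨⟨(Dvd.intro_left (d ^ 1) (by ring)).trans hd, by simpa using hm⟩, hd⟩

lemma card_le_of_modEq {n L d : ℕ} (hn : n = L * d) (s : Finset ℕ) (hs : ∀ x ∈ s, x < n)
    (hmod : ∀ x ∈ s, ∀ y ∈ s, (L : ℤ) ∣ (x : ℤ) - y) : s.card ≤ d := by
  rw [← Finset.card_range d]
  refine Finset.card_le_card_of_injOn (fun x => x / L) (fun x hx => ?_) fun x hx y hy hxy => ?_
  · rw [Finset.mem_coe, Finset.mem_range]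
    exact Nat.div_lt_of_lt_mul (hn ▸ hs x hx)
  · have h1 : x % L = y % L := by
      have := hmod y hy x hx
      exact (Nat.modEq_iff_dvd.mpr this)
    have h2 : x / L = y / L := hxy
    rw [← Nat.div_add_mod x L, ← Nat.div_add_mod y L, h1, h2]

lemma sqCount_le {m : ℤ} (hm : m ≠ 0) (n : ℕ) :
    (sqCount m n : ℝ) ≤ sqDivSum m * (n.divisors.card : ℝ) := by
  rcases Nat.eq_zero_or_pos n with rfl | hn
  · simp [sqCount]
  set S := (Finset.range n).filter fun x : ℕ => (n : ℤ) ∣ (x : ℤ) ^ 2 + m with hS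
  rcases S.eq_empty_or_nonempty with h0 | ⟨x₀, hx₀⟩
  · have : sqCount m n = 0 := by rw [sqCount, ← hS, h0, Finset.card_empty]
    rw [this, Nat.cast_zero]
    exact mul_nonneg (sqDivSum_nonneg m) (Nat.cast_nonneg _)
  have hx0 : (n : ℤ) ∣ (x₀ : ℤ) ^ 2 + m := (Finset.mem_filter.mp hx₀).2
  have hmaps : ∀ x ∈ S, ((x : ℤ) - x₀).gcd n ∈ n.divisors := fun x _ => by
    rw [Nat.mem_divisors]
    exact ⟨by exact_mod_cast Int.gcd_dvd_right ((x : ℤ) - x₀) n, hn.ne'⟩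
  have hcard : sqCount m n = ∑ g ∈ n.divisors, (S.filter fun x : ℕ => ((x : ℤ) - x₀).gcd n = g).card := by
    rw [← Finset.card_eq_sum_card_fiberwise hmaps]
    rfl
  rw [hcard, Nat.cast_sum, mul_comm, ← nsmul_eq_mul]
  refine Finset.sum_le_card_nsmul _ _ _ fun g hg => ?_
  obtain ⟨⟨h, rfl⟩, -⟩ := Nat.mem_divisors.mp hg
  have hg0 : 0 < g := Nat.pos_of_mul_pos_right hn
  have hprop : ∀ x ∈ S.filter fun x : ℕ => ((x : ℤ) - x₀).gcd (g * h : ℕ) = g,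
      x < g * h ∧ (g : ℤ) ∣ (x : ℤ) - x₀ ∧ (h : ℤ) ∣ (x : ℤ) + x₀ := by
    intro x hx
    rw [Finset.mem_filter, hS, Finset.mem_filter, Finset.mem_range] at hx
    obtain ⟨⟨h1, h2⟩, h3⟩ := hx
    have hgd : (g : ℤ) ∣ (x : ℤ) - x₀ := h3 ▸ Int.gcd_dvd_left _ _
    refine ⟨h1, hgd, ?_⟩
    obtain ⟨y, hy⟩ := hgd
    have hcop : IsCoprime (h : ℤ) y := by
      rw [hy] at h3
      push_cast at h3
      rw [Int.gcd_mul_left, Int.natAbs_natCast] at h3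
      rw [Int.isCoprime_iff_gcd_eq_one, Int.gcd_comm]
      exact Nat.eq_of_mul_eq_mul_left hg0 (by simpa using h3)
    have h4 : ((g * h : ℕ) : ℤ) ∣ g * (y * ((x : ℤ) + x₀)) := by
      have : (g : ℤ) * (y * ((x : ℤ) + x₀)) = ((x : ℤ) ^ 2 + m) - ((x₀ : ℤ) ^ 2 + m) := by
        rw [← mul_assoc, ← hy]; ring
      rw [this]
      exact dvd_sub h2 hx0
    push_cast at h4
    exact hcop.dvd_of_dvd_mul_left (Int.dvd_of_mul_dvd_mul_left (by exact_mod_cast hg0.ne') h4)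
  set d := g.gcd h with hd
  rcases (S.filter fun x : ℕ => ((x : ℤ) - x₀).gcd (g * h : ℕ) = g).eq_empty_or_nonempty with h0 | ⟨z, hz⟩
  · rw [h0]
    simpa using sqDivSum_nonneg m
  have hdsq : d ^ 2 ∣ 4 * m.natAbs := by
    obtain ⟨-, hz1, hz2⟩ := hprop z hz
    have hdg : (d : ℤ) ∣ g := by exact_mod_cast Nat.gcd_dvd_left g h
    have hdh : (d : ℤ) ∣ h := by exact_mod_cast Nat.gcd_dvd_right g h
    have h5 : (d : ℤ) ∣ 2 * x₀ := by
      rw [show 2 * (x₀ : ℤ) = ((z : ℤ) + x₀) - (z - x₀) by ring]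
      exact dvd_sub (hdh.trans hz2) (hdg.trans hz1)
    have h6 : (d : ℤ) ^ 2 ∣ (x₀ : ℤ) ^ 2 + m := by
      refine dvd_trans ?_ hx0
      rw [sq]; push_cast
      exact mul_dvd_mul hdg hdh
    have h7 : (d : ℤ) ^ 2 ∣ 4 * m := by
      rw [show 4 * m = 4 * ((x₀ : ℤ) ^ 2 + m) - (2 * x₀) ^ 2 by ring]
      exact dvd_sub (h6.mul_left 4) (pow_dvd_pow_of_dvd h5 2)
    have := Int.natAbs_dvd_natAbs.mpr h7
    simpa [Int.natAbs_mul, Int.natAbs_pow] using this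
  refine le_trans ?_ (le_sqDivSum hm hdsq)
  rw [Nat.cast_le]
  refine card_le_of_modEq (L := g.lcm h) (by rw [mul_comm (g.lcm h), Nat.gcd_mul_lcm]) _
    (fun x hx => (hprop x hx).1) fun x hx y hy => ?_
  obtain ⟨-, hx1, hx2⟩ := hprop x hx
  obtain ⟨-, hy1, hy2⟩ := hprop y hy
  have e1 : (g : ℤ) ∣ (x : ℤ) - y := by
    rw [show (x : ℤ) - y = ((x : ℤ) - x₀) - (y - x₀) by ring]
    exact dvd_sub hx1 hy1
  have e2 : (h : ℤ) ∣ (x : ℤ) - y := by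
    rw [show (x : ℤ) - y = ((x : ℤ) + x₀) - (y + x₀) by ring]
    exact dvd_sub hx2 hy2
  have := Int.coe_lcm_dvd e1 e2
  simpa [Int.lcm_natCast_natCast] using this

lemma ee_eq_one_iff (x : ℂ) : ee x = 1 ↔ ∃ n : ℤ, x = n := by
  rw [ee, Complex.exp_eq_one_iff]
  refine exists_congr fun n => ?_
  have : 2 * (π : ℂ) * I ≠ 0 := by simp [Real.pi_ne_zero]
  rw [mul_comm (n : ℂ), mul_right_inj' this]

lemma sum_centered (F : ℤ → ℂ) (k : ℕ) :
    ∑ a ∈ centered k, F a = ∑ i ∈ Finset.range k, F ((i : ℤ) - (k / 2 : ℕ)) := by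
  symm
  refine Finset.sum_bij (fun i _ => (i : ℤ) - (k / 2 : ℕ)) ?_ ?_ ?_ fun _ _ => rfl
  · intro i hi
    rw [Finset.mem_range] at hi
    simp only [centered, Finset.mem_Ico]
    omega
  · intro i _ j _ h
    have h' : (i : ℤ) - (k / 2 : ℕ) = (j : ℤ) - (k / 2 : ℕ) := h
    omega
  · intro a ha
    simp only [centered, Finset.mem_Ico] at ha
    exact ⟨(a + (k / 2 : ℕ)).toNat, by rw [Finset.mem_range]; omega, by omega⟩

lemma sum_centered_ee (M : ℤ) {k : ℕ} (hk : 0 < k) :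
    ∑ a ∈ centered k, ee (a * M / k) = if (k : ℤ) ∣ M then (k : ℂ) else 0 := by
  have hk0 : (k : ℂ) ≠ 0 := by exact_mod_cast hk.ne'
  rw [sum_centered]
  generalize k / 2 = e
  have h1 : ∀ i : ℕ, ee ((((i : ℤ) - (e : ℕ) : ℤ) : ℂ) * M / k)
      = ee (-(e * M / k)) * ee (M / k) ^ i := fun i => by
    rw [← ee_natCast_mul, ← ee_add]
    congr 1; push_cast; ring
  rw [Finset.sum_congr rfl fun i _ => h1 i, ← Finset.mul_sum]
  split_ifs with h
  · obtain ⟨c, rfl⟩ := h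
    have e1 : ee ((((k : ℤ) * c : ℤ) : ℂ) / k) = 1 := by
      rw [ee_eq_one_iff]
      exact ⟨c, by push_cast; field_simp⟩
    have e2 : ee (-(e * (((k : ℤ) * c : ℤ) : ℂ) / k)) = 1 := by
      rw [ee_eq_one_iff]
      exact ⟨-(e * c), by push_cast; field_simp⟩
    rw [e1, e2]
    simp
  · have hne : ee ((M : ℂ) / k) ≠ 1 := by
      rw [Ne, ee_eq_one_iff]
      rintro ⟨c, hc⟩
      refine h ⟨c, ?_⟩
      rw [div_eq_iff hk0, mul_comm] at hc
      exact_mod_cast hc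
    have h2 : ee ((M : ℂ) / k) ^ k = 1 := by
      rw [← ee_natCast_mul, ee_eq_one_iff]
      exact ⟨M, by field_simp⟩
    rw [geom_sum_eq hne, h2, sub_self, zero_div, mul_zero]

lemma gaussTransform_ee (m : ℤ) {k : ℕ} (hk : 0 < k) :
    gaussTransform (fun u => ee ((m * u : ℝ) : ℂ)) k = k * sqCount m k := by
  have h1 : gaussTransform (fun u => ee ((m * u : ℝ) : ℂ)) k
      = ∑ x ∈ Finset.range k, ∑ a ∈ centered k, ee (a * ((x : ℤ) ^ 2 + m : ℤ) / k) := by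
    rw [gaussTransform, Finset.sum_comm]
    refine Finset.sum_congr rfl fun a _ => ?_
    rw [gsum, Finset.mul_sum]
    refine Finset.sum_congr rfl fun x _ => ?_
    rw [← ee_add]
    congr 1
    push_cast
    ring
  rw [h1, Finset.sum_congr rfl fun x _ => sum_centered_ee _ hk, ← Finset.sum_filter,
    Finset.sum_const, nsmul_eq_mul, sqCount, mul_comm]

lemma summable_sqrt_indicator {v : ℝ} (hv : 1 < v) :
    Summable fun q : ℕ => (if IsSquare q then (q.sqrt : ℝ) else 0) / (q : ℝ) ^ v := by
  have hinj : Function.Injective fun d : ℕ => d ^ 2 := Nat.pow_left_injective (by norm_num)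
  rw [← hinj.summable_iff]
  · refine (Real.summable_one_div_nat_rpow.mpr (show 1 < 2 * v - 1 by linarith)).congr fun d => ?_
    simp only [Function.comp_apply, IsSquare.sq, if_true, Nat.sqrt_eq']
    rcases Nat.eq_zero_or_pos d with rfl | hd
    · simp [Real.zero_rpow (show 2 * v - 1 ≠ 0 by linarith)]
    · have hd' : (0 : ℝ) < d := by exact_mod_cast hd
      rw [Nat.cast_pow, ← Real.rpow_natCast, ← Real.rpow_mul hd'.le, Real.rpow_sub hd', Real.rpow_one]
      push_cast
      field_simp
  · intro q hq
    have : ¬ IsSquare q := fun ⟨d, hd⟩ => hq ⟨d, by simp [hd, sq]⟩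
    simp [this]

lemma hasSum_zetaCop (M : ℕ) {v : ℝ} (hv : 1 < v) :
    HasSum (fun n : ℕ => copInd M n / (n : ℝ) ^ v) (zetaCop M v) :=
  (summable_copInd_div_rpow M hv).hasSum

lemma hasSum_card_divisors {v : ℝ} (hv : 1 < v) :
    HasSum (fun n : ℕ => (n.divisors.card : ℝ) / (n : ℝ) ^ v) (zetaCop 1 v ^ 2) := by
  have h1 := hasSum_zetaCop 1 hv
  have h0 := copInd_div_rpow_zero 1 (by linarith : (0 : ℝ) < v)
  have h2 := HasSum.real_mul_divisorsAntidiagonal h1 h1 h0 h0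
  rw [sq]
  convert h2 using 2 with n
  rcases Nat.eq_zero_or_pos n with rfl | hn
  · simp
  have e1 : ∀ p ∈ n.divisorsAntidiagonal,
      copInd 1 p.1 / (p.1 : ℝ) ^ v * (copInd 1 p.2 / (p.2 : ℝ) ^ v) = 1 / (n : ℝ) ^ v := fun p hp => by
    rw [← copInd_mul_div_rpow, (Nat.mem_divisorsAntidiagonal.mp hp).1, copInd_one_left]
  rw [Finset.sum_congr rfl e1, Finset.sum_const, nsmul_eq_mul, ← Nat.map_div_right_divisors,
    Finset.card_map]
  ring

lemma summable_sqDivSum_nat {v : ℝ} (hv : 1 < v) :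
    Summable fun n : ℕ => sqDivSum n / (n : ℝ) ^ v := by
  have h1 := (summable_sqrt_indicator hv).hasSum
  have h2 := HasSum.real_mul_divisorsAntidiagonal h1 (summable_copInd_div_rpow 1 hv).hasSum
    (by simp) (copInd_div_rpow_zero 1 (by linarith : (0 : ℝ) < v))
  have hinj : Function.Injective fun n : ℕ => 4 * n := fun a b h => by simpa using h
  have h3 := (h2.summable.comp_injective hinj).mul_left ((4 : ℝ) ^ v)
  refine h3.congr fun n => ?_
  rcases Nat.eq_zero_or_pos n with rfl | hn
  · simp [sqDivSum]
  simp only [Function.comp_apply, copInd_one_left]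
  have hn' : (0 : ℝ) < n := by exact_mod_cast hn
  have e1 : ∀ p ∈ (4 * n).divisorsAntidiagonal,
      (if IsSquare p.1 then (p.1.sqrt : ℝ) else 0) / (p.1 : ℝ) ^ v * (1 / (p.2 : ℝ) ^ v)
        = (if IsSquare p.1 then (p.1.sqrt : ℝ) else 0) / (4 * n : ℝ) ^ v := fun p hp => by
    have : (4 * n : ℝ) = p.1 * p.2 := by
      exact_mod_cast (Nat.mem_divisorsAntidiagonal.mp hp).1.symm
    rw [this, Real.mul_rpow (Nat.cast_nonneg _) (Nat.cast_nonneg _)]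
    field_simp
  rw [Finset.sum_congr rfl e1, ← Finset.sum_div,
    Nat.sum_divisorsAntidiagonal (fun x _ => if IsSquare x then (x.sqrt : ℝ) else 0),
    Real.mul_rpow (by norm_num) hn'.le, ← Finset.sum_filter]
  have e2 : ∑ q ∈ (4 * n).divisors with IsSquare q, (q.sqrt : ℝ) = sqDivSum n := by
    symm
    refine Finset.sum_bij (fun d _ => d ^ 2) ?_ ?_ ?_ ?_
    · intro d hd
      rw [Finset.mem_filter, Nat.mem_divisors] at hd ⊢
      simp only [Int.natAbs_natCast] at hd
      exact ⟨⟨hd.2, by omega⟩, IsSquare.sq d⟩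
    · exact fun a _ b _ h => Nat.pow_left_injective (by norm_num) h
    · intro q hq
      rw [Finset.mem_filter, Nat.mem_divisors] at hq
      obtain ⟨d, rfl⟩ := hq.2
      refine ⟨d, ?_, sq d⟩
      rw [Finset.mem_filter, Nat.mem_divisors, Int.natAbs_natCast, sq]
      exact ⟨⟨(Dvd.intro _ rfl).trans hq.1.1, hq.1.2⟩, hq.1.1⟩
    · intro d _
      rw [Nat.sqrt_eq']
  rw [e2]
  have h4 : (4 : ℝ) ^ v ≠ 0 := (Real.rpow_pos_of_pos (by norm_num) v).ne'
  field_simp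

lemma summable_sqDivSum {v : ℝ} (hv : 1 < v) :
    Summable fun m : ℤ => sqDivSum m / |(m : ℝ)| ^ v := by
  refine Summable.of_nat_of_neg ?_ ?_
  · simpa using summable_sqDivSum_nat hv
  · simpa [sqDivSum_neg] using summable_sqDivSum_nat hv

/-- The Dirichlet series counting the solutions of `x ^ 2 + m = 0` to moduli prime to `M`. -/
def sqSeries (M : ℕ) (m : ℤ) (v : ℝ) : ℝ := ∑' n : ℕ, copInd M n / (n : ℝ) ^ v * sqCount m n

lemma sqCount_term_le {m : ℤ} (hm : m ≠ 0) (M : ℕ) (v : ℝ) (n : ℕ) :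
    copInd M n / (n : ℝ) ^ v * sqCount m n ≤ sqDivSum m * ((n.divisors.card : ℝ) / (n : ℝ) ^ v) := by
  have h := sqCount_le hm n
  have h1 : copInd M n / (n : ℝ) ^ v ≤ 1 / (n : ℝ) ^ v :=
    div_le_div_of_nonneg_right (copInd_le_one M n) (Real.rpow_nonneg (Nat.cast_nonneg n) v)
  calc _ ≤ 1 / (n : ℝ) ^ v * (sqDivSum m * (n.divisors.card : ℝ)) :=
        mul_le_mul h1 h (Nat.cast_nonneg _) (by positivity)
    _ = _ := by ring

lemma summable_sqSeries {m : ℤ} (hm : m ≠ 0) (M : ℕ) {v : ℝ} (hv : 1 < v) :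
    Summable fun n : ℕ => copInd M n / (n : ℝ) ^ v * sqCount m n :=
  Summable.of_nonneg_of_le
    (fun n => mul_nonneg (copInd_div_rpow_nonneg M v n) (Nat.cast_nonneg _))
    (sqCount_term_le hm M v) ((hasSum_card_divisors hv).summable.mul_left _)

lemma sqSeries_nonneg (M : ℕ) (m : ℤ) (v : ℝ) : 0 ≤ sqSeries M m v :=
  tsum_nonneg fun n => mul_nonneg (copInd_div_rpow_nonneg M v n) (Nat.cast_nonneg _)

lemma sqSeries_le {m : ℤ} (hm : m ≠ 0) (M : ℕ) {v : ℝ} (hv : 1 < v) :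
    sqSeries M m v ≤ sqDivSum m * zetaCop 1 v ^ 2 := by
  rw [← (hasSum_card_divisors hv).tsum_eq, ← tsum_mul_left]
  exact (summable_sqSeries hm M hv).tsum_le_tsum (sqCount_term_le hm M v)
    ((hasSum_card_divisors hv).summable.mul_left _)

lemma totient_mul_le_mul_totient (e q : ℕ) : (e * q).totient ≤ e * q.totient := by
  induction e using Nat.recOnPrimePow generalizing q with
  | zero => simp
  | one => simp
  | prime_pow_mul a p n hp _ _ ih =>
    have hprime : ∀ q, (p * q).totient ≤ p * q.totient := fun q => by
      by_cases h : p ∣ q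
      · rw [Nat.totient_mul_of_prime_of_dvd hp h]
      · rw [Nat.totient_mul_of_prime_of_not_dvd hp h]
        exact Nat.mul_le_mul_right _ (Nat.sub_le p 1)
    have hpow : ∀ n q, (p ^ n * q).totient ≤ p ^ n * q.totient := fun n => by
      induction n with
      | zero => simp
      | succ n ihn =>
        intro q
        calc (p ^ (n + 1) * q).totient = (p * (p ^ n * q)).totient := by ring_nf
          _ ≤ p * (p ^ n * q).totient := hprime _
          _ ≤ p * (p ^ n * q.totient) := Nat.mul_le_mul_left _ (ihn q)
          _ = p ^ (n + 1) * q.totient := by ring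
    calc (p ^ n * a * q).totient = (p ^ n * (a * q)).totient := by ring_nf
      _ ≤ p ^ n * (a * q).totient := hpow n _
      _ ≤ p ^ n * (a * q.totient) := Nat.mul_le_mul_left _ (ih q)
      _ = p ^ n * a * q.totient := by ring

lemma card_units_fiber_mul_totient {h q : ℕ} [NeZero h] [NeZero q] (hq : q ∣ h) (r : (ZMod q)ˣ) :
    (Finset.univ.filter fun u : (ZMod h)ˣ => ZMod.unitsMap hq u = r).card * q.totient = h.totient := by
  have hs := ZMod.unitsMap_surjective hq
  have h1 : ∑ s : (ZMod q)ˣ, (Finset.univ.filter fun u : (ZMod h)ˣ => ZMod.unitsMap hq u = s).card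
      = h.totient := by
    rw [← ZMod.card_units_eq_totient h, ← Finset.card_univ]
    exact (Finset.card_eq_sum_card_fiberwise fun _ _ => Finset.mem_univ _).symm
  rw [← h1, ← ZMod.card_units_eq_totient q, mul_comm, ← smul_eq_mul, ← Finset.card_univ,
    ← Finset.sum_const]
  exact Finset.sum_congr rfl fun s _ =>
    MonoidHom.card_fiber_eq_of_mem_range (ZMod.unitsMap hq) (hs r) (hs s)

/-- The `y` prime to `h` with `g y + m = 0` modulo `h`. -/
def linearSols (m : ℤ) (g h : ℕ) : Finset ℕ :=
  (Finset.range h).filter fun y => y.Coprime h ∧ (h : ℤ) ∣ g * y + m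

lemma card_linearSols (m : ℤ) (g : ℕ) {h : ℕ} (hh : 0 < h) :
    (linearSols m g h).card
      = if g.gcd h = m.gcd h then h.totient / (h / m.gcd h).totient else 0 := by
  split_ifs with hgcd
  · set e := m.gcd h with he
    have he0 : 0 < e := Int.gcd_pos_of_ne_zero_right _ (by exact_mod_cast hh.ne')
    obtain ⟨q, hq⟩ : e ∣ h := by exact_mod_cast Int.gcd_dvd_right m h
    have hq0 : 0 < q := Nat.pos_of_ne_zero fun h0 => by simp [h0] at hq; omega
    obtain ⟨g₁, hg⟩ : e ∣ g := hgcd ▸ Nat.gcd_dvd_left g h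
    obtain ⟨m₁, hm⟩ : (e : ℤ) ∣ m := Int.gcd_dvd_left m h
    have hg1 : g₁.Coprime q := by
      rw [hg, hq, Nat.gcd_mul_left] at hgcd
      exact Nat.eq_of_mul_eq_mul_left he0 (by simpa using hgcd)
    have hm1 : IsCoprime m₁ (q : ℤ) := by
      rw [hm, hq] at he
      push_cast at he
      rw [Int.gcd_mul_left, Int.natAbs_natCast] at he
      rw [Int.isCoprime_iff_gcd_eq_one]
      exact (Nat.eq_of_mul_eq_mul_left he0 (by simpa using he)).symm
    have hqh : q ∣ h := ⟨e, by rw [hq, mul_comm]⟩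
    have : NeZero h := ⟨hh.ne'⟩
    have : NeZero q := ⟨hq0.ne'⟩
    have hu : IsUnit ((-m₁ : ℤ) : ZMod q) := by
      rw [ZMod.coe_int_isUnit_iff_isCoprime]
      exact (hm1.neg_left).symm
    set gu := ZMod.unitOfCoprime g₁ hg1 with hgu
    set r : (ZMod q)ˣ := gu⁻¹ * hu.unit with hr
    have hdiv : h / e = q := by rw [hq, Nat.mul_div_cancel_left _ he0]
    rw [hdiv]
    have hkey : ∀ (y : ℕ) (hc : y.Coprime h),
        ZMod.unitsMap hqh (ZMod.unitOfCoprime y hc) = r ↔ (h : ℤ) ∣ g * y + m := by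
      intro y hc
      have hval : ((ZMod.unitsMap hqh (ZMod.unitOfCoprime y hc) : (ZMod q)ˣ) : ZMod q) = (y : ZMod q) := by
        rw [ZMod.unitsMap_def, Units.coe_map, ZMod.coe_unitOfCoprime]
        simp
      rw [hr, eq_inv_mul_iff_mul_eq, Units.ext_iff, Units.val_mul, hval, hgu, ZMod.coe_unitOfCoprime,
        IsUnit.unit_spec]
      have h1 : (h : ℤ) ∣ g * y + m ↔ (q : ℤ) ∣ g₁ * y + m₁ := by
        have : (g * y + m : ℤ) = e * (g₁ * y + m₁) := by
          rw [hm, hg]; push_cast; ring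
        rw [this, hq, Nat.cast_mul, mul_dvd_mul_iff_left (by exact_mod_cast he0.ne')]
      rw [h1, ← ZMod.intCast_zmod_eq_zero_iff_dvd]
      push_cast
      rw [eq_neg_iff_add_eq_zero]
    have hcard : (linearSols m g h).card
        = (Finset.univ.filter fun u : (ZMod h)ˣ => ZMod.unitsMap hqh u = r).card := by
      refine Finset.card_bij (fun y hy => ZMod.unitOfCoprime y (Finset.mem_filter.mp hy).2.1) ?_ ?_ ?_
      · intro y hy
        rw [Finset.mem_filter]
        exact ⟨Finset.mem_univ _, (hkey y _).mpr (Finset.mem_filter.mp hy).2.2⟩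
      · intro y hy z hz hyz
        have h1 : ((y : ℕ) : ZMod h) = z := by
          simpa using congrArg (fun u : (ZMod h)ˣ => (u : ZMod h)) hyz
        rw [ZMod.natCast_eq_natCast_iff'] at h1
        have hy' := Finset.mem_range.mp (Finset.mem_filter.mp hy).1
        have hz' := Finset.mem_range.mp (Finset.mem_filter.mp hz).1
        rwa [Nat.mod_eq_of_lt hy', Nat.mod_eq_of_lt hz'] at h1
      · intro u hu'
        have hc := ZMod.val_coe_unit_coprime u
        have h1 : ZMod.unitOfCoprime (u : ZMod h).val hc = u := by
          ext
          simp
        refine ⟨(u : ZMod h).val, ?_, h1⟩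
        rw [linearSols, Finset.mem_filter, Finset.mem_range]
        refine ⟨ZMod.val_lt _, hc, (hkey _ hc).mp ?_⟩
        rw [h1]
        exact (Finset.mem_filter.mp hu').2
    rw [hcard]
    exact (Nat.div_eq_of_eq_mul_left (Nat.totient_pos.mpr hq0)
      (card_units_fiber_mul_totient hqh r).symm).symm
  · rw [Finset.card_eq_zero, Finset.eq_empty_iff_forall_notMem]
    intro y hy
    obtain ⟨-, hc, hd⟩ := Finset.mem_filter.mp hy
    refine hgcd ?_
    obtain ⟨c, hc'⟩ := hd
    have h1 : m = h * c + -(g * y) := by rw [← hc']; ring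
    have h2 : m.gcd h = ((g * y : ℕ) : ℤ).gcd h := by
      rw [h1, Int.gcd_comm, Int.gcd_comm _ (h : ℤ)]
      simp
    rw [h2, Int.gcd_natCast_natCast, Nat.Coprime.gcd_mul_right_cancel g hc]

lemma card_fiber_gcd (l : ℤ) {g h : ℕ} (hg : 0 < g) (hh : 0 < h) :
    ((Finset.range (g * h)).filter fun x : ℕ =>
      ((g * h : ℕ) : ℤ) ∣ (x : ℤ) ^ 2 + -l ^ 2 ∧ ((x : ℤ) - l).gcd (g * h : ℕ) = g).card
      = (linearSols (2 * l) g h).card := by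
  symm
  have hn : (0 : ℤ) < (g : ℤ) * h := by positivity
  have hspec : ∀ y : ℕ, (((g : ℤ) * y + l) % ((g : ℤ) * h)).toNat < g * h ∧
      ∃ c : ℤ, ((((g : ℤ) * y + l) % ((g : ℤ) * h)).toNat : ℤ) = g * y + l + g * h * c := by
    intro y
    have h1 := Int.emod_nonneg ((g : ℤ) * y + l) hn.ne'
    have h2 := Int.emod_lt_of_pos ((g : ℤ) * y + l) hn
    refine ⟨?_, -(((g : ℤ) * y + l) / ((g : ℤ) * h)), ?_⟩
    · zify
      rwa [Int.toNat_of_nonneg h1]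
    · rw [Int.toNat_of_nonneg h1]
      have := Int.emod_add_mul_ediv ((g : ℤ) * y + l) ((g : ℤ) * h)
      linear_combination this
  refine Finset.card_bij (fun y _ => (((g : ℤ) * y + l) % ((g : ℤ) * h)).toNat) ?_ ?_ ?_
  · intro y hy
    obtain ⟨-, hc, hd⟩ := Finset.mem_filter.mp hy
    obtain ⟨hx1, hx2⟩ := hspec y
    set x := (((g : ℤ) * y + l) % ((g : ℤ) * h)).toNat with hx
    obtain ⟨c, hx2⟩ := hx2
    rw [Finset.mem_filter, Finset.mem_range]
    have hxl : (x : ℤ) - l = g * (y + h * c) := by linear_combination hx2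
    refine ⟨hx1, ?_, ?_⟩
    · obtain ⟨b, hb⟩ := hd
      refine ⟨(y + h * c) * (b + g * c), ?_⟩
      push_cast
      linear_combination ((x : ℤ) + l) * hxl + (g : ℤ) * (y + h * c) * (hx2 + hb)
    · rw [hxl]
      push_cast
      rw [Int.gcd_mul_left, Int.gcd_comm, Int.gcd_add_mul_left_right, Int.gcd_comm,
        Int.gcd_natCast_natCast, hc, Int.natAbs_natCast, mul_one]
  · intro y hy z hz hyz
    obtain ⟨-, c, hc⟩ := hspec y
    obtain ⟨-, b, hb⟩ := hspec z
    rw [show (((g : ℤ) * y + l) % ((g : ℤ) * h)).toNat = (((g : ℤ) * z + l) % ((g : ℤ) * h)).toNat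
      from hyz] at hc
    have h1 : (g : ℤ) * (y - z) = g * (h * (b - c)) := by linear_combination hb - hc
    have h2 := mul_left_cancel₀ (by exact_mod_cast hg.ne' : (g : ℤ) ≠ 0) h1
    have hy' := Finset.mem_range.mp (Finset.mem_filter.mp hy).1
    have hz' := Finset.mem_range.mp (Finset.mem_filter.mp hz).1
    have h3 : z ≡ y [MOD h] := Nat.modEq_iff_dvd.mpr ⟨_, h2⟩
    exact (Nat.ModEq.eq_of_lt_of_lt h3 hz' hy').symm
  · intro x hx
    rw [Finset.mem_filter, Finset.mem_range] at hx
    obtain ⟨hx0, hx1, hx2⟩ := hx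
    obtain ⟨y, hy⟩ : (g : ℤ) ∣ (x : ℤ) - l := by
      have := Int.gcd_dvd_left ((x : ℤ) - l) (g * h : ℕ)
      rwa [hx2] at this
    have hhZ : (0 : ℤ) < h := by exact_mod_cast hh
    have hym : (((y % h).toNat : ℕ) : ℤ) = y % h := Int.toNat_of_nonneg (Int.emod_nonneg _ hhZ.ne')
    have hyd : (y % h : ℤ) = y - h * (y / h) := by have := Int.emod_add_mul_ediv y h; linarith
    have hcop : y.gcd h = 1 := by
      rw [hy] at hx2
      push_cast at hx2
      rw [Int.gcd_mul_left, Int.natAbs_natCast] at hx2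
      exact Nat.eq_of_mul_eq_mul_left hg (by simpa using hx2)
    refine ⟨(y % h).toNat, ?_, ?_⟩
    · rw [linearSols, Finset.mem_filter, Finset.mem_range]
      refine ⟨?_, ?_, ?_⟩
      · have := Int.emod_lt_of_pos y hhZ
        omega
      · rw [Nat.Coprime, ← Int.gcd_natCast_natCast, hym, Int.gcd_emod, hcop]
      · rw [hym, hyd]
        have h1 : ((g * h : ℕ) : ℤ) ∣ g * (y * (g * y + 2 * l)) := by
          have : (g : ℤ) * (y * (g * y + 2 * l)) = (x : ℤ) ^ 2 + -l ^ 2 := by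
            linear_combination (-((g : ℤ) * y + x + l)) * hy
          rwa [this]
        push_cast at h1
        have h2 := Int.dvd_of_mul_dvd_mul_left (by exact_mod_cast hg.ne') h1
        have h3 : IsCoprime (h : ℤ) y := by
          rw [Int.isCoprime_iff_gcd_eq_one, Int.gcd_comm, hcop]
        have h4 := h3.dvd_of_dvd_mul_left h2
        obtain ⟨b, hb⟩ := h4
        exact ⟨b - g * (y / h), by linear_combination hb⟩
    · obtain ⟨h1, c, h2⟩ := hspec (y % h).toNat
      set z := (((g : ℤ) * (y % h).toNat + l) % ((g : ℤ) * h)).toNat with hz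
      rw [hym, hyd] at h2
      have h3 : z ≡ x [MOD g * h] := by
        rw [Nat.modEq_iff_dvd]
        exact ⟨y / h - c, by push_cast; linear_combination hy - h2⟩
      exact Nat.ModEq.eq_of_lt_of_lt h3 h1 hx0

lemma sqCount_neg_sq (l : ℤ) (n : ℕ) :
    sqCount (-l ^ 2) n = ∑ p ∈ n.divisorsAntidiagonal,
      if p.1.gcd p.2 = (2 * l).gcd p.2 then p.2.totient / (p.2 / (2 * l).gcd p.2).totient else 0 := by
  rcases Nat.eq_zero_or_pos n with rfl | hn
  · simp [sqCount]
  have hmaps : ∀ x ∈ (Finset.range n).filter fun x : ℕ => (n : ℤ) ∣ (x : ℤ) ^ 2 + -l ^ 2,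
      ((x : ℤ) - l).gcd n ∈ n.divisors := fun x _ => by
    rw [Nat.mem_divisors]
    exact ⟨by exact_mod_cast Int.gcd_dvd_right ((x : ℤ) - l) n, hn.ne'⟩
  rw [sqCount, Finset.card_eq_sum_card_fiberwise hmaps,
    ← Nat.sum_divisorsAntidiagonal (fun g _ => (((Finset.range n).filter fun x : ℕ =>
      (n : ℤ) ∣ (x : ℤ) ^ 2 + -l ^ 2).filter fun x : ℕ => ((x : ℤ) - l).gcd n = g).card)]
  refine Finset.sum_congr rfl fun p hp => ?_
  obtain ⟨hp1, -⟩ := Nat.mem_divisorsAntidiagonal.mp hp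
  rw [← hp1] at hn
  have h1 := Nat.pos_of_mul_pos_right hn
  have h2 := Nat.pos_of_mul_pos_left hn
  rw [← card_linearSols _ _ h2, ← card_fiber_gcd l h1 h2, Finset.filter_filter, hp1]

lemma HasSum.of_eq {ι : Type*} {f g : ι → ℝ} {a b : ℝ} (h : HasSum f a) (hfg : ∀ i, g i = f i)
    (hab : b = a) : HasSum g b := by
  rwa [funext hfg, hab]

lemma sum_moebius_divisors {R : Type*} [Ring R] (n : ℕ) :
    ∑ d ∈ n.divisors, (ArithmeticFunction.moebius d : R) = if n = 1 then 1 else 0 := by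
  have h := congrArg (fun f : ArithmeticFunction ℤ => f n) ArithmeticFunction.coe_zeta_mul_moebius
  rw [ArithmeticFunction.coe_zeta_mul_apply, ArithmeticFunction.one_apply] at h
  rw [← Int.cast_sum, h]
  split_ifs <;> simp

/-- The Euler factor `∏ (1 - p ^ (-v))` over primes `p ∣ q` not dividing `M`, written as a sum. -/
def mobSum (M q : ℕ) (v : ℝ) : ℝ :=
  ∑ d ∈ q.divisors, (ArithmeticFunction.moebius d : ℝ) * (copInd M d / (d : ℝ) ^ v)

lemma coprime_indicator {g q : ℕ} (hq : 0 < q) :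
    (if g.Coprime q then (1 : ℝ) else 0)
      = ∑ d ∈ q.divisors, if d ∣ g then (ArithmeticFunction.moebius d : ℝ) else 0 := by
  have hpos : 0 < g.gcd q := Nat.gcd_pos_of_pos_right g hq
  have h1 : q.divisors.filter (fun d => d ∣ g) = (g.gcd q).divisors := by
    ext d
    rw [Finset.mem_filter, Nat.mem_divisors, Nat.mem_divisors, Nat.dvd_gcd_iff]
    exact ⟨fun h => ⟨⟨h.2, h.1.1⟩, hpos.ne'⟩, fun h => ⟨⟨h.1.2, hq.ne'⟩, h.1.1⟩⟩
  rw [← Finset.sum_filter, h1, sum_moebius_divisors]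

lemma hasSum_of_dvd (M : ℕ) {v : ℝ} (hv : 1 < v) {d : ℕ} (hd : 0 < d) :
    HasSum (fun g : ℕ => if d ∣ g then copInd M g / (g : ℝ) ^ v else 0)
      (copInd M d / (d : ℝ) ^ v * zetaCop M v) := by
  have hinj : Function.Injective fun j : ℕ => d * j := fun a b h => Nat.eq_of_mul_eq_mul_left hd h
  rw [← hinj.hasSum_iff]
  · refine ((hasSum_zetaCop M hv).mul_left (copInd M d / (d : ℝ) ^ v)).of_eq (fun j => ?_) rfl
    simp only [Function.comp_apply, dvd_mul_right, if_true, copInd_mul_div_rpow]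
  · intro g hg
    rw [if_neg]
    rintro ⟨j, rfl⟩
    exact hg ⟨j, rfl⟩

lemma hasSum_coprime (M : ℕ) {q : ℕ} (hq : 0 < q) {v : ℝ} (hv : 1 < v) :
    HasSum (fun g : ℕ => if g.Coprime q then copInd M g / (g : ℝ) ^ v else 0)
      (zetaCop M v * mobSum M q v) := by
  have h1 := hasSum_sum (s := q.divisors) fun d hd =>
    (hasSum_of_dvd M hv (Nat.pos_of_mem_divisors hd)).mul_left (ArithmeticFunction.moebius d : ℝ)
  refine h1.of_eq (fun g => ?_) ?_
  · have := coprime_indicator (g := g) hq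
    calc (if g.Coprime q then copInd M g / (g : ℝ) ^ v else 0)
        = (if g.Coprime q then (1 : ℝ) else 0) * (copInd M g / (g : ℝ) ^ v) := by
          split_ifs <;> simp
      _ = _ := by
          rw [this, Finset.sum_mul]
          refine Finset.sum_congr rfl fun d _ => ?_
          split_ifs <;> simp
  · rw [mobSum, Finset.mul_sum]
    exact Finset.sum_congr rfl fun d _ => by ring

lemma hasSum_gcd_eq (M : ℕ) {e q : ℕ} (he : 0 < e) (hq : 0 < q) {v : ℝ} (hv : 1 < v) :
    HasSum (fun g : ℕ => if g.gcd (e * q) = e then copInd M g / (g : ℝ) ^ v else 0)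
      (copInd M e / (e : ℝ) ^ v * (zetaCop M v * mobSum M q v)) := by
  have hinj : Function.Injective fun j : ℕ => e * j := fun a b h => Nat.eq_of_mul_eq_mul_left he h
  rw [← hinj.hasSum_iff]
  · refine ((hasSum_coprime M hq hv).mul_left (copInd M e / (e : ℝ) ^ v)).of_eq (fun j => ?_) rfl
    simp only [Function.comp_apply]
    rw [Nat.gcd_mul_left, copInd_mul_div_rpow]
    have : e * j.gcd q = e ↔ j.Coprime q := by
      rw [Nat.Coprime]
      exact ⟨fun h => Nat.eq_of_mul_eq_mul_left he (by simpa using h), fun h => by rw [h, mul_one]⟩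
    simp only [this]
    split_ifs <;> simp
  · intro g hg
    rw [if_neg]
    intro h
    obtain ⟨j, hj⟩ := h ▸ Nat.gcd_dvd_left g (e * q)
    exact hg ⟨j, hj.symm⟩

lemma abs_moebius_cast_le_one (d : ℕ) : |(ArithmeticFunction.moebius d : ℝ)| ≤ 1 := by
  exact_mod_cast ArithmeticFunction.abs_moebius_le_one

lemma abs_mobSum_le (M q : ℕ) {v : ℝ} (hv : 1 < v) : |mobSum M q v| ≤ zetaCop M v := by
  refine (Finset.abs_sum_le_sum_abs _ _).trans ?_
  refine le_trans (Finset.sum_le_sum fun d _ => ?_)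
    ((summable_copInd_div_rpow M hv).sum_le_tsum q.divisors fun d _ => copInd_div_rpow_nonneg M v d)
  rw [abs_mul, abs_of_nonneg (copInd_div_rpow_nonneg M v d)]
  exact mul_le_of_le_one_left (copInd_div_rpow_nonneg M v d) (abs_moebius_cast_le_one d)

/-- The number of `y` prime to `h` in a fixed class prime to `h / gcd (2 l, h)`. -/
def fiberCard (l : ℤ) (h : ℕ) : ℕ := h.totient / (h / (2 * l).gcd h).totient

lemma fiberCard_le (l : ℤ) (h : ℕ) : fiberCard l h ≤ (2 * l).gcd h := by
  obtain ⟨q, hq⟩ : (2 * l).gcd h ∣ h := by exact_mod_cast Int.gcd_dvd_right (2 * l) h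
  rw [fiberCard]
  generalize (2 * l).gcd h = e at *
  subst hq
  rcases Nat.eq_zero_or_pos e with rfl | he
  · simp
  rw [Nat.mul_div_cancel_left _ he]
  exact Nat.div_le_of_le_mul (by simpa only [mul_comm] using totient_mul_le_mul_totient e q)

/-- The general term of the Dirichlet series counting the solutions of `x ^ 2 = l ^ 2` divided by
the zeta function. -/
def sqTerm (M : ℕ) (l : ℤ) (v : ℝ) (h : ℕ) : ℝ :=
  copInd M h / (h : ℝ) ^ v * (fiberCard l h / ((2 * l).gcd h : ℝ) ^ v * mobSum M (h / (2 * l).gcd h) v)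

lemma fiberCard_div_le_one (l : ℤ) {h : ℕ} (hh : 0 < h) {v : ℝ} (hv : 1 ≤ v) :
    (fiberCard l h : ℝ) / ((2 * l).gcd h : ℝ) ^ v ≤ 1 := by
  have he : 1 ≤ (2 * l).gcd h := Int.gcd_pos_of_ne_zero_right _ (by exact_mod_cast hh.ne')
  have he' : (1 : ℝ) ≤ ((2 * l).gcd h : ℝ) := by exact_mod_cast he
  rw [div_le_one (by positivity)]
  calc (fiberCard l h : ℝ) ≤ ((2 * l).gcd h : ℝ) := by exact_mod_cast fiberCard_le l h
    _ ≤ _ := Real.self_le_rpow_of_one_le he' hv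

lemma abs_sqTerm_le (M : ℕ) (l : ℤ) {v : ℝ} (hv : 1 < v) (h : ℕ) :
    |sqTerm M l v h| ≤ copInd M h / (h : ℝ) ^ v * zetaCop M v := by
  rcases Nat.eq_zero_or_pos h with rfl | hh
  · simp [sqTerm, Real.zero_rpow (by linarith : v ≠ 0)]
  rw [sqTerm, abs_mul, abs_of_nonneg (copInd_div_rpow_nonneg M v h), abs_mul,
    abs_of_nonneg (by positivity : 0 ≤ (fiberCard l h : ℝ) / ((2 * l).gcd h : ℝ) ^ v)]
  refine mul_le_mul_of_nonneg_left ?_ (copInd_div_rpow_nonneg M v h)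
  calc _ ≤ 1 * zetaCop M v := mul_le_mul (fiberCard_div_le_one l hh hv.le) (abs_mobSum_le M _ hv)
        (abs_nonneg _) zero_le_one
    _ = _ := one_mul _

lemma summable_sqTerm (M : ℕ) (l : ℤ) {v : ℝ} (hv : 1 < v) : Summable (sqTerm M l v) :=
  Summable.of_norm_bounded ((summable_copInd_div_rpow M hv).mul_right _) (abs_sqTerm_le M l hv)

lemma hasSum_sqSeries_neg_sq (M : ℕ) (l : ℤ) {v : ℝ} (hv : 1 < v) :
    HasSum (fun n : ℕ => copInd M n / (n : ℝ) ^ v * sqCount (-l ^ 2) n)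
      (zetaCop M v * ∑' h, sqTerm M l v h) := by
  set F : ℕ × ℕ → ℝ := fun p => copInd M p.1 / (p.1 : ℝ) ^ v * (fiberCard l p.1 *
    if p.2.gcd p.1 = (2 * l).gcd p.1 then copInd M p.2 / (p.2 : ℝ) ^ v else 0) with hF
  have hF0 : ∀ p, 0 ≤ F p := fun p => by
    refine mul_nonneg (copInd_div_rpow_nonneg M v _) (mul_nonneg (Nat.cast_nonneg _) ?_)
    split_ifs
    · exact copInd_div_rpow_nonneg M v _
    · exact le_rfl
  have hz := copInd_div_rpow_zero M (by linarith : (0 : ℝ) < v)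
  have hinner : ∀ h, HasSum (fun g => F (h, g)) (zetaCop M v * sqTerm M l v h) := by
    intro h
    rcases Nat.eq_zero_or_pos h with rfl | hh
    · simp only [hF, sqTerm, hz, zero_mul, mul_zero]
      exact hasSum_zero
    obtain ⟨q, hq⟩ : (2 * l).gcd h ∣ h := by exact_mod_cast Int.gcd_dvd_right (2 * l) h
    have he : 0 < (2 * l).gcd h := Int.gcd_pos_of_ne_zero_right _ (by exact_mod_cast hh.ne')
    have hq0 : 0 < q := Nat.pos_of_ne_zero fun h0 => by simp [h0] at hq; omega
    have h1 := ((hasSum_gcd_eq M he hq0 hv).mul_left (fiberCard l h : ℝ)).mul_left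
      (copInd M h / (h : ℝ) ^ v)
    rw [← hq] at h1
    refine h1.of_eq (fun g => rfl) ?_
    have h2 : h / (2 * l).gcd h = q := Nat.div_eq_of_eq_mul_right he hq
    have h3 : copInd M h = copInd M h * copInd M ((2 * l).gcd h) := by
      have h4 : copInd M h = copInd M ((2 * l).gcd h) * copInd M q :=
        (congrArg (copInd M) hq).trans (copInd_mul M _ _)
      rw [h4]
      generalize (2 * l).gcd h = e
      simp only [copInd]
      split_ifs <;> simp
    rw [sqTerm, h2]
    linear_combination (fiberCard l h / ((2 * l).gcd h : ℝ) ^ v * mobSum M q v * zetaCop M v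
      / (h : ℝ) ^ v) * h3
  have hFs : Summable F := by
    rw [summable_prod_of_nonneg hF0]
    refine ⟨fun h => (hinner h).summable, ?_⟩
    simp only [(hinner _).tsum_eq]
    exact (summable_sqTerm M l hv).mul_left _
  have h1 : HasSum F (zetaCop M v * ∑' h, sqTerm M l v h) := by
    have h2 := hFs.hasSum.prod_fiberwise hinner
    rw [← tsum_mul_left, h2.tsum_eq]
    exact hFs.hasSum
  have h3 := (Equiv.prodComm ℕ ℕ).hasSum_iff.mpr h1
  have h4 := h3.divisorsAntidiagonal (by
    rintro ⟨g, h⟩ hgh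
    simp only [Function.comp_apply, Equiv.prodComm_apply, Prod.swap_prod_mk, hF]
    rcases mul_eq_zero.mp hgh with h0 | h0
    · simp only at h0
      simp [h0, Real.zero_rpow (by linarith : v ≠ 0)]
    · simp only at h0
      simp [h0, Real.zero_rpow (by linarith : v ≠ 0)])
  refine h4.of_eq (fun n => ?_) rfl
  rw [sqCount_neg_sq, Nat.cast_sum, Finset.mul_sum]
  refine Finset.sum_congr rfl fun p hp => ?_
  change _ = copInd M p.2 / (p.2 : ℝ) ^ v * (fiberCard l p.2 *
    if p.1.gcd p.2 = (2 * l).gcd p.2 then copInd M p.1 / (p.1 : ℝ) ^ v else 0)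
  rw [← (Nat.mem_divisorsAntidiagonal.mp hp).1, copInd_mul_div_rpow]
  by_cases hc : p.1.gcd p.2 = (2 * l).gcd p.2
  · rw [if_pos hc, if_pos hc, fiberCard]
    ring
  · rw [if_neg hc, if_neg hc]
    simp

lemma tendsto_zetaCop (M : ℕ) {α : Type*} {F : Filter α} {g : α → ℝ} {a : ℝ} (ha : 1 < a)
    (hg : Tendsto g F (𝓝 a)) : Tendsto (fun x => zetaCop M (g x)) F (𝓝 (zetaCop M a)) := by
  have hb : 1 < (1 + a) / 2 := by linarith
  refine tendsto_tsum_of_dominated_convergence (summable_copInd_div_rpow M hb) (fun n => ?_) ?_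
  · rcases Nat.eq_zero_or_pos n with rfl | hn
    · have h1 : ∀ᶠ x in F, copInd M 0 / ((0 : ℕ) : ℝ) ^ a = copInd M 0 / ((0 : ℕ) : ℝ) ^ g x := by
        filter_upwards [hg.eventually (lt_mem_nhds (by linarith : 0 < a))] with x hx
        rw [copInd_div_rpow_zero M hx, copInd_div_rpow_zero M (by linarith)]
      exact tendsto_const_nhds.congr' h1
    · have hn' : (0 : ℝ) < n := by exact_mod_cast hn
      refine tendsto_const_nhds.div ?_ (by positivity)
      exact (continuousAt_const_rpow hn'.ne').tendsto.comp hg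
  · filter_upwards [hg.eventually (lt_mem_nhds (by linarith : (1 + a) / 2 < a))] with x hx n
    rw [Real.norm_of_nonneg (copInd_div_rpow_nonneg M _ n)]
    rcases Nat.eq_zero_or_pos n with rfl | hn
    · rw [copInd_div_rpow_zero M (by linarith), copInd_div_rpow_zero M (by linarith)]
    · have hn' : (1 : ℝ) ≤ n := by exact_mod_cast hn
      exact div_le_div_of_nonneg_left (copInd_nonneg M n) (by positivity)
        (Real.rpow_le_rpow_of_exponent_le hn' hx.le)

lemma tendsto_sub_mul_zetaCop_one :
    Tendsto (fun v : ℝ => (v - 1) * zetaCop 1 v) (𝓝[>] 1) (𝓝 1) := by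
  simpa only [zetaCop, copInd_one_left] using tendsto_sub_mul_tsum_nat_rpow

lemma zetaCop_two_left {v : ℝ} (hv : 1 < v) : zetaCop 2 v = (1 - 1 / 2 ^ v) * zetaCop 1 v := by
  have h1 := (hasSum_zetaCop 1 hv).sub (hasSum_of_dvd 1 hv (d := 2) two_pos)
  have h2 := h1.of_eq (g := fun n : ℕ => copInd 2 n / (n : ℝ) ^ v) (b := zetaCop 1 v -
    copInd 1 2 / ((2 : ℕ) : ℝ) ^ v * zetaCop 1 v) (fun n => ?_) rfl
  · rw [(hasSum_zetaCop 2 hv).unique h2, copInd_one_left]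
    push_cast
    ring
  · rw [copInd_one_left]
    simp only [copInd, Nat.coprime_comm (n := n), Nat.coprime_two_left,
      ← Nat.not_even_iff_odd, even_iff_two_dvd]
    split_ifs <;> simp

lemma tendsto_sub_mul_zetaCop_two :
    Tendsto (fun v : ℝ => (v - 1) * zetaCop 2 v) (𝓝[>] 1) (𝓝 (1 / 2)) := by
  have h1 : Tendsto (fun v : ℝ => 1 - 1 / (2 : ℝ) ^ v) (𝓝[>] 1) (𝓝 (1 - 1 / 2 ^ (1 : ℝ))) := by
    refine tendsto_const_nhds.sub (tendsto_const_nhds.div ?_ (by positivity))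
    exact (continuousAt_const_rpow two_ne_zero).tendsto.mono_left nhdsWithin_le_nhds
  have h2 := h1.mul tendsto_sub_mul_zetaCop_one
  rw [show (1 - 1 / 2 ^ (1 : ℝ)) * 1 = (1 / 2 : ℝ) by rw [Real.rpow_one]; norm_num] at h2
  refine h2.congr' ?_
  filter_upwards [self_mem_nhdsWithin] with v hv
  rw [zetaCop_two_left hv]
  ring

lemma zetaCop_one_two : zetaCop 1 2 = π ^ 2 / 6 := by
  refine (hasSum_zetaCop 1 one_lt_two).unique (hasSum_zeta_two.of_eq (fun n => ?_) rfl)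
  rw [copInd_one_left, Real.rpow_two]

lemma zetaCop_two_two : zetaCop 2 2 = π ^ 2 / 8 := by
  rw [zetaCop_two_left one_lt_two, zetaCop_one_two, Real.rpow_two]
  ring

lemma hasSum_totient (M : ℕ) {w : ℝ} (hw : 2 < w) :
    HasSum (fun n : ℕ => copInd M n / (n : ℝ) ^ w * n.totient)
      (zetaCop M (w - 1) / zetaCop M w) := by
  have h1 := hasSum_of_sum_divisors (a := fun n => (n : ℂ)) (h := fun n => (n.totient : ℂ)) M
    (by linarith : 1 < w) (fun n _ => by exact_mod_cast n.sum_totient) (A := (zetaCop M (w - 1) : ℂ))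
    ?_
  · rw [← Complex.hasSum_ofReal]
    push_cast at h1 ⊢
    exact h1
  · have h2 := Complex.hasSum_ofReal.mpr (hasSum_zetaCop M (by linarith : 1 < w - 1))
    convert h2 using 2 with n
    rcases Nat.eq_zero_or_pos n with rfl | hn
    · simp [Real.zero_rpow (by linarith : w - 1 ≠ 0)]
    · have hn' : (0 : ℝ) < n := by exact_mod_cast hn
      rw [Real.rpow_sub_one hn'.ne']
      push_cast
      have : ((((n : ℝ) ^ w : ℝ)) : ℂ) ≠ 0 := by
        exact_mod_cast (Real.rpow_pos_of_pos hn' w).ne'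
      field_simp

lemma sum_moebius_div {q : ℕ} (hq : 0 < q) :
    ∑ d ∈ q.divisors, (ArithmeticFunction.moebius d : ℝ) * (1 / (d : ℝ)) = q.totient / q := by
  have h := (ArithmeticFunction.sum_eq_iff_sum_mul_moebius_eq (f := fun n => (n.totient : ℝ))
    (g := fun n => (n : ℝ))).mp (fun n _ => by exact_mod_cast n.sum_totient) q hq
  have hq' : (q : ℝ) ≠ 0 := by exact_mod_cast hq.ne'
  rw [eq_div_iff hq', ← h, Finset.sum_mul,
    Nat.sum_divisorsAntidiagonal (fun x y => (ArithmeticFunction.moebius x : ℝ) * (y : ℝ))]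
  refine Finset.sum_congr rfl fun d hd => ?_
  have hd' : (d : ℝ) ≠ 0 := by exact_mod_cast (Nat.pos_of_mem_divisors hd).ne'
  rw [Nat.cast_div (Nat.dvd_of_mem_divisors hd) hd']
  ring

/-- `∑ (1 / d - 1 / d ^ v)` over the divisors `d` of `h`. -/
def divisorDefect (v : ℝ) (h : ℕ) : ℝ := ∑ d ∈ h.divisors, (1 / (d : ℝ) - 1 / (d : ℝ) ^ v)

lemma one_div_sub_nonneg {v : ℝ} (hv : 1 ≤ v) {d : ℕ} (hd : 0 < d) :
    0 ≤ 1 / (d : ℝ) - 1 / (d : ℝ) ^ v := by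
  have hd' : (1 : ℝ) ≤ d := by exact_mod_cast hd
  rw [sub_nonneg]
  exact one_div_le_one_div_of_le (by linarith) (Real.self_le_rpow_of_one_le hd' hv)

lemma divisorDefect_nonneg {v : ℝ} (hv : 1 ≤ v) (h : ℕ) : 0 ≤ divisorDefect v h :=
  Finset.sum_nonneg fun _ hd => one_div_sub_nonneg hv (Nat.pos_of_mem_divisors hd)

lemma hasSum_divisorDefect {v : ℝ} (hv : 1 < v) :
    HasSum (fun h : ℕ => 1 / (h : ℝ) ^ v * divisorDefect v h)
      ((zetaCop 1 (v + 1) - zetaCop 1 (2 * v)) * zetaCop 1 v) := by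
  have h1 := (hasSum_zetaCop 1 (by linarith : 1 < v + 1)).sub
    (hasSum_zetaCop 1 (by linarith : 1 < 2 * v))
  have h2 := h1.real_mul_divisorsAntidiagonal (hasSum_zetaCop 1 hv)
    (by rw [copInd_div_rpow_zero 1 (by linarith), copInd_div_rpow_zero 1 (by linarith), sub_zero])
    (copInd_div_rpow_zero 1 (by linarith))
  refine h2.of_eq (fun h => ?_) rfl
  rw [divisorDefect, Finset.mul_sum]
  rw [Nat.sum_divisorsAntidiagonal (fun x y => (copInd 1 x / (x : ℝ) ^ (v + 1)
    - copInd 1 x / (x : ℝ) ^ (2 * v)) * (copInd 1 y / (y : ℝ) ^ v))]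
  refine Finset.sum_congr rfl fun d hd => ?_
  have hd0 : (0 : ℝ) < d := by exact_mod_cast Nat.pos_of_mem_divisors hd
  obtain ⟨e, rfl⟩ := Nat.dvd_of_mem_divisors hd
  rw [Nat.mul_div_cancel_left _ (Nat.pos_of_mem_divisors hd), Nat.cast_mul,
    Real.mul_rpow hd0.le (Nat.cast_nonneg e), Real.rpow_add_one hd0.ne', two_mul,
    Real.rpow_add hd0]
  simp only [copInd_one_left]
  have : (0 : ℝ) < (d : ℝ) ^ v := by positivity
  field_simp

lemma fiberCard_mul (l : ℤ) (h : ℕ) :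
    fiberCard l h * (h / (2 * l).gcd h).totient = h.totient := by
  have hd : (2 * l).gcd h ∣ h := by exact_mod_cast Int.gcd_dvd_right (2 * l) h
  exact Nat.div_mul_cancel (Nat.totient_dvd_of_dvd (Nat.div_dvd_of_dvd hd))

lemma abs_sqTerm_sub_le (M : ℕ) {l : ℤ} (hl : l ≠ 0) {v : ℝ} (hv : 1 < v) (h : ℕ) :
    |sqTerm M l v h - copInd M h / (h : ℝ) ^ (v + 1) * h.totient| ≤
      (1 - 1 / ((2 * l).natAbs : ℝ) ^ (v - 1)) * (1 / (h : ℝ) ^ v)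
        + 1 / (h : ℝ) ^ v * divisorDefect v h := by
  rcases Nat.eq_zero_or_pos h with rfl | hh
  · simp [sqTerm, Real.zero_rpow (by linarith : v ≠ 0)]
  have hL : 1 ≤ ((2 * l).natAbs : ℝ) := by
    exact_mod_cast Int.natAbs_pos.mpr (mul_ne_zero two_ne_zero hl)
  have hL1 : 0 ≤ 1 - 1 / ((2 * l).natAbs : ℝ) ^ (v - 1) := by
    rw [sub_nonneg, div_le_one (by positivity)]
    exact Real.one_le_rpow hL (by linarith)
  have hh' : (0 : ℝ) < h := by exact_mod_cast hh
  have hw : 0 < 1 / (h : ℝ) ^ v := by positivity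
  by_cases hc : h.Coprime M
  swap
  · have h0 : copInd M h = 0 := by simp [copInd, hc]
    simp only [sqTerm, h0, zero_div, zero_mul, sub_zero, abs_zero]
    have := divisorDefect_nonneg hv.le h
    positivity
  have hcop : copInd M h = 1 := by simp [copInd, hc]
  have hfc := fiberCard_mul l h
  have hfle := fiberCard_le l h
  have he : 0 < (2 * l).gcd h := Int.gcd_pos_of_ne_zero_right _ (by exact_mod_cast hh.ne')
  have heL : (2 * l).gcd h ≤ (2 * l).natAbs := Nat.le_of_dvd
    (Int.natAbs_pos.mpr (mul_ne_zero two_ne_zero hl)) (Int.gcd_dvd_natAbs_left _ _)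
  obtain ⟨q, hq⟩ : (2 * l).gcd h ∣ h := by exact_mod_cast Int.gcd_dvd_right (2 * l) h
  have hq0 : 0 < q := Nat.pos_of_ne_zero fun h0 => by simp [h0] at hq; omega
  have hdiv : h / (2 * l).gcd h = q := Nat.div_eq_of_eq_mul_right he hq
  rw [sqTerm, hdiv, hcop]
  rw [hdiv] at hfc
  generalize (2 * l).gcd h = e at *
  generalize fiberCard l h = c at *
  have he' : (1 : ℝ) ≤ e := by exact_mod_cast he
  have hq' : (0 : ℝ) < q := by exact_mod_cast hq0
  have hc' : (c : ℝ) ≤ e := by exact_mod_cast hfle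
  have hcopd : ∀ d ∈ q.divisors, copInd M d = 1 := fun d hd => by
    have : d.Coprime M := Nat.Coprime.coprime_dvd_left
      ((Nat.dvd_of_mem_divisors hd).trans (hq ▸ dvd_mul_left q e)) hc
    simp [copInd, this]
  have hmob : mobSum M q v = ∑ d ∈ q.divisors,
      (ArithmeticFunction.moebius d : ℝ) * (1 / (d : ℝ) ^ v) :=
    Finset.sum_congr rfl fun d hd => by rw [hcopd d hd]
  have hdef : |q.totient / q - mobSum M q v| ≤ divisorDefect v h := by
    rw [hmob, ← sum_moebius_div hq0, ← Finset.sum_sub_distrib]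
    refine (Finset.abs_sum_le_sum_abs _ _).trans ?_
    refine (Finset.sum_le_sum (g := fun d : ℕ => 1 / (d : ℝ) - 1 / (d : ℝ) ^ v) fun d hd => ?_).trans
      (Finset.sum_le_sum_of_subset_of_nonneg
        (Nat.divisors_subset_of_dvd hh.ne' (hq ▸ dvd_mul_left q e)) fun d hd _ =>
          one_div_sub_nonneg hv.le (Nat.pos_of_mem_divisors hd))
    have h0 := one_div_sub_nonneg hv.le (Nat.pos_of_mem_divisors hd)
    rw [← mul_sub, abs_mul, abs_of_nonneg h0]
    exact mul_le_of_le_one_left h0 (abs_moebius_cast_le_one d)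
  have hphi : (h.totient : ℝ) / h = c / e * (q.totient / q) := by
    rw [← hfc, div_mul_div_comm]
    congr 1
    · push_cast; ring
    · rw [hq]; push_cast; ring
  have hev : (1 : ℝ) ≤ (e : ℝ) ^ (v - 1) := Real.one_le_rpow he' (by linarith)
  have hevv : (e : ℝ) ^ v = e * (e : ℝ) ^ (v - 1) := by
    rw [← Real.rpow_one_add' (by linarith) (by linarith)]
    congr 1; ring
  have hce : (c : ℝ) / e ≤ 1 := by rw [div_le_one (by linarith)]; exact hc'
  have hce0 : 0 ≤ (c : ℝ) / e := by positivity
  have hcev : (c : ℝ) / (e : ℝ) ^ v = c / e * (1 / (e : ℝ) ^ (v - 1)) := by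
    rw [hevv]; field_simp
  have hei : 1 / (e : ℝ) ^ (v - 1) ≤ 1 := by rw [div_le_one (by linarith)]; exact hev
  have hei0 : 0 ≤ 1 / (e : ℝ) ^ (v - 1) := by positivity
  have heiL : 1 / ((2 * l).natAbs : ℝ) ^ (v - 1) ≤ 1 / (e : ℝ) ^ (v - 1) := by
    refine one_div_le_one_div_of_le (by linarith) ?_
    exact Real.rpow_le_rpow (by linarith) (by exact_mod_cast heL) (by linarith)
  have hphq : (q.totient : ℝ) / q ≤ 1 := by
    rw [div_le_one hq']; exact_mod_cast q.totient_le
  have hphq0 : 0 ≤ (q.totient : ℝ) / q := by positivity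
  have key : 1 / (h : ℝ) ^ v * (c / (e : ℝ) ^ v * mobSum M q v)
      - 1 / (h : ℝ) ^ (v + 1) * h.totient
      = - (1 / (h : ℝ) ^ v * (c / e * ((1 / (e : ℝ) ^ (v - 1)) * (q.totient / q - mobSum M q v)
        + (1 - 1 / (e : ℝ) ^ (v - 1)) * (q.totient / q)))) := by
    have : 1 / (h : ℝ) ^ (v + 1) * h.totient = 1 / (h : ℝ) ^ v * ((h.totient : ℝ) / h) := by
      rw [Real.rpow_add_one hh'.ne']
      field_simp
    rw [this, hphi, hcev]
    ring
  rw [key, abs_neg, abs_mul, abs_of_pos hw, mul_comm _ (1 / (h : ℝ) ^ v), ← mul_add]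
  refine mul_le_mul_of_nonneg_left ?_ hw.le
  rw [abs_mul, abs_of_nonneg hce0]
  refine (mul_le_of_le_one_left (abs_nonneg _) hce).trans ((abs_add_le _ _).trans ?_)
  rw [add_comm]
  refine add_le_add ?_ ?_
  · rw [abs_of_nonneg (by apply mul_nonneg <;> linarith)]
    exact (mul_le_of_le_one_right (by linarith) hphq).trans (by linarith)
  · rw [abs_mul, abs_of_nonneg hei0]
    exact (mul_le_of_le_one_left (abs_nonneg _) hei).trans hdef

lemma tendsto_tsum_sqTerm {M : ℕ} {ρ : ℝ}
    (hρ : Tendsto (fun v : ℝ => (v - 1) * zetaCop M v) (𝓝[>] 1) (𝓝 ρ)) {l : ℤ} (hl : l ≠ 0) :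
    Tendsto (fun v : ℝ => (v - 1) * ∑' h, sqTerm M l v h) (𝓝[>] 1) (𝓝 (ρ / zetaCop M 2)) := by
  have hid : Tendsto (fun v : ℝ => v) (𝓝[>] 1) (𝓝 1) := nhdsWithin_le_nhds
  have hlin : ∀ a b : ℝ, Tendsto (fun v : ℝ => a * v + b) (𝓝[>] 1) (𝓝 (a * 1 + b)) :=
    fun a b => (hid.const_mul a).add_const b
  have hL : (0 : ℝ) < ((2 * l).natAbs : ℝ) := by
    exact_mod_cast Int.natAbs_pos.mpr (mul_ne_zero two_ne_zero hl)
  have hz1 : Tendsto (fun v : ℝ => zetaCop 1 (v + 1)) (𝓝[>] 1) (𝓝 (zetaCop 1 2)) :=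
    tendsto_zetaCop 1 one_lt_two (by convert hlin 1 1 using 2 <;> norm_num)
  have hz2 : Tendsto (fun v : ℝ => zetaCop 1 (2 * v)) (𝓝[>] 1) (𝓝 (zetaCop 1 2)) :=
    tendsto_zetaCop 1 one_lt_two (by convert hlin 2 0 using 2 <;> norm_num)
  have hz3 : Tendsto (fun v : ℝ => zetaCop M (v + 1)) (𝓝[>] 1) (𝓝 (zetaCop M 2)) :=
    tendsto_zetaCop M one_lt_two (by convert hlin 1 1 using 2 <;> norm_num)
  have hpow : Tendsto (fun v : ℝ => 1 - 1 / ((2 * l).natAbs : ℝ) ^ (v - 1)) (𝓝[>] 1) (𝓝 0) := by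
    have h1 : Tendsto (fun v : ℝ => ((2 * l).natAbs : ℝ) ^ (v - 1)) (𝓝[>] 1)
        (𝓝 (((2 * l).natAbs : ℝ) ^ (0 : ℝ))) :=
      (continuousAt_const_rpow hL.ne').tendsto.comp (by convert hlin 1 (-1) using 2 <;> ring)
    rw [Real.rpow_zero] at h1
    have h2 := (tendsto_const_nhds (x := (1 : ℝ))).sub ((tendsto_const_nhds (x := (1 : ℝ))).div h1 one_ne_zero)
    simpa using h2
  have herr : Tendsto (fun v : ℝ => (1 - 1 / ((2 * l).natAbs : ℝ) ^ (v - 1)) * ((v - 1) * zetaCop 1 v)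
      + (zetaCop 1 (v + 1) - zetaCop 1 (2 * v)) * ((v - 1) * zetaCop 1 v)) (𝓝[>] 1) (𝓝 0) := by
    have := (hpow.mul tendsto_sub_mul_zetaCop_one).add
      ((hz1.sub hz2).mul tendsto_sub_mul_zetaCop_one)
    simpa using this
  have hmain : Tendsto (fun v : ℝ => (v - 1) * zetaCop M v / zetaCop M (v + 1)) (𝓝[>] 1)
      (𝓝 (ρ / zetaCop M 2)) := hρ.div hz3 (zetaCop_pos M one_lt_two).ne'
  have hdiff : Tendsto (fun v : ℝ => (v - 1) * ∑' h, sqTerm M l v h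
      - (v - 1) * zetaCop M v / zetaCop M (v + 1)) (𝓝[>] 1) (𝓝 0) := by
    refine squeeze_zero_norm' ?_ herr
    filter_upwards [self_mem_nhdsWithin] with v hv
    have hv' : 1 < v := hv
    have h1 := hasSum_totient M (w := v + 1) (by linarith)
    rw [add_sub_cancel_right] at h1
    have h2 := (summable_sqTerm M l hv').hasSum.sub h1
    have h3 := ((hasSum_zetaCop 1 hv').mul_left (1 - 1 / ((2 * l).natAbs : ℝ) ^ (v - 1))).add
      (hasSum_divisorDefect hv')
    have h4 : ‖(∑' h, sqTerm M l v h) - zetaCop M v / zetaCop M (v + 1)‖ ≤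
        (1 - 1 / ((2 * l).natAbs : ℝ) ^ (v - 1)) * zetaCop 1 v
          + (zetaCop 1 (v + 1) - zetaCop 1 (2 * v)) * zetaCop 1 v := by
      rw [← h2.tsum_eq]
      refine tsum_of_norm_bounded h3 fun h => ?_
      rw [copInd_one_left]
      exact abs_sqTerm_sub_le M hl hv' h
    rw [mul_div_assoc, ← mul_sub, norm_mul, Real.norm_of_nonneg (by linarith : 0 ≤ v - 1)]
    refine (mul_le_mul_of_nonneg_left h4 (by linarith)).trans (le_of_eq ?_)
    ring
  simpa using hdiff.add hmain

lemma sqSeries_neg_sq (M : ℕ) (l : ℤ) {v : ℝ} (hv : 1 < v) :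
    sqSeries M (-l ^ 2) v = zetaCop M v * ∑' h, sqTerm M l v h :=
  (hasSum_sqSeries_neg_sq M l hv).tsum_eq

lemma tendsto_sqSeries_neg_sq {M : ℕ} {ρ : ℝ}
    (hρ : Tendsto (fun v : ℝ => (v - 1) * zetaCop M v) (𝓝[>] 1) (𝓝 ρ)) {l : ℤ} (hl : l ≠ 0) :
    Tendsto (fun v : ℝ => (v - 1) ^ 2 * sqSeries M (-l ^ 2) v) (𝓝[>] 1)
      (𝓝 (ρ ^ 2 / zetaCop M 2)) := by
  have h := hρ.mul (tendsto_tsum_sqTerm hρ hl)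
  rw [show ρ * (ρ / zetaCop M 2) = ρ ^ 2 / zetaCop M 2 by ring] at h
  refine h.congr' ?_
  filter_upwards [self_mem_nhdsWithin] with v hv
  rw [sqSeries_neg_sq M l hv]
  ring

lemma sqTerm_zero (M : ℕ) {v : ℝ} (hv : 1 < v) (h : ℕ) :
    sqTerm M 0 v h = copInd M h / (h : ℝ) ^ (2 * v) * h.totient := by
  rcases Nat.eq_zero_or_pos h with rfl | hh
  · simp [sqTerm, Real.zero_rpow (by linarith : v ≠ 0)]
  have hh' : (0 : ℝ) < h := by exact_mod_cast hh
  have hm : mobSum M 1 v = 1 := by simp [mobSum, copInd]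
  have hg : (2 * (0 : ℤ)).gcd h = h := by simp
  rw [sqTerm, fiberCard, hg, Nat.div_self hh, hm, Nat.totient_one, Nat.div_one, two_mul,
    Real.rpow_add hh']
  have : (0 : ℝ) < (h : ℝ) ^ v := by positivity
  field_simp

lemma tendsto_sqSeries_zero {M : ℕ} {ρ : ℝ}
    (hρ : Tendsto (fun v : ℝ => (v - 1) * zetaCop M v) (𝓝[>] 1) (𝓝 ρ)) :
    Tendsto (fun v : ℝ => (v - 1) ^ 2 * sqSeries M 0 v) (𝓝[>] 1)
      (𝓝 (ρ ^ 2 / (2 * zetaCop M 2))) := by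
  have hid : Tendsto (fun v : ℝ => v) (𝓝[>] 1) (𝓝 1) := nhdsWithin_le_nhds
  have hlin : Tendsto (fun v : ℝ => 2 * v - 1) (𝓝[>] 1) (𝓝[>] 1) := by
    refine tendsto_nhdsWithin_iff.mpr ⟨?_, ?_⟩
    · convert (hid.const_mul 2).sub_const 1 using 2; norm_num
    · filter_upwards [self_mem_nhdsWithin] with v hv
      have : 1 < v := hv
      rw [Set.mem_Ioi]
      linarith
  have h2v : Tendsto (fun v : ℝ => zetaCop M (2 * v)) (𝓝[>] 1) (𝓝 (zetaCop M 2)) :=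
    tendsto_zetaCop M one_lt_two (by convert hid.const_mul 2 using 2; norm_num)
  have h := hρ.mul (((hρ.comp hlin).div_const 2).div h2v (zetaCop_pos M one_lt_two).ne')
  rw [show ρ * (ρ / 2 / zetaCop M 2) = ρ ^ 2 / (2 * zetaCop M 2) by
    rw [div_div, mul_div_assoc', sq]] at h
  refine h.congr' ?_
  filter_upwards [self_mem_nhdsWithin] with v hv
  have hv' : 1 < v := hv
  have h1 := sqSeries_neg_sq M 0 hv'
  rw [show -(0 : ℤ) ^ 2 = 0 by norm_num] at h1
  rw [h1, tsum_congr (sqTerm_zero M hv'), (hasSum_totient M (by linarith : 2 < 2 * v)).tsum_eq]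
  simp only [Function.comp_apply, Pi.div_apply]
  ring

lemma jacobiSym_eq_of_mod_eq_one {u n : ℕ} (hn : n % (4 * u) = 1) :
    jacobiSym u n = 1 := by
  have hodd : Odd n := by
    rw [Nat.odd_iff, ← Nat.mod_mod_of_dvd n (show 2 ∣ 4 * u from ⟨2 * u, by ring⟩), hn]
  rw [jacobiSym.mod_right' u hodd, hn, jacobiSym.one_right]

lemma jacobiSym_sign {n : ℕ} (hn : n % 4 = 1) {e : ℤ} (he : e = 1 ∨ e = -1) :
    jacobiSym e n = 1 := by
  rcases he with rfl | rfl
  · exact jacobiSym.one_left n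
  · rw [jacobiSym.at_neg_one (Nat.odd_iff.mpr (Nat.odd_of_mod_four_eq_one hn))]
    exact ZMod.χ₄_nat_one_mod_four hn

lemma exists_jacobiSym_eq_neg_one_of_odd_prime {p u b : ℕ} (hp : p.Prime) (hp2 : p ≠ 2)
    (hpu : ¬ p ∣ u) (hb : 0 < b) {e : ℤ} (he : e = 1 ∨ e = -1) :
    ∃ n : ℕ, Odd n ∧ jacobiSym (e * (p * u) * b ^ 2) n = -1 := by
  have := Fact.mk hp
  obtain ⟨j, b₀, hb₀, rfl⟩ := Nat.exists_eq_pow_mul_and_not_dvd hb.ne' p hp.ne_one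
  obtain ⟨x, hx⟩ := FiniteField.exists_nonsquare (F := ZMod p) (by rwa [ZMod.ringChar_zmod_n])
  have hu : 0 < u := Nat.pos_of_ne_zero fun h => hpu (h ▸ dvd_zero p)
  have hb₀' : 0 < b₀ := Nat.pos_of_ne_zero fun h => hb₀ (h ▸ dvd_zero p)
  have hpodd : Odd p := hp.odd_of_ne_two hp2
  have hcop : p.Coprime (4 * u * b₀) := by
    rw [hp.coprime_iff_not_dvd, hp.dvd_mul, hp.dvd_mul]
    rintro ((h | h) | h)
    · have := (Nat.prime_dvd_prime_iff_eq hp Nat.prime_two).mp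
        (hp.dvd_of_dvd_pow (show p ∣ 2 ^ 2 by simpa using h))
      exact hp2 this
    · exact hpu h
    · exact hb₀ h
  obtain ⟨n, hn1, hn2⟩ := Nat.chineseRemainder hcop x.val 1
  have hn4u : n % (4 * u) = 1 := by
    have := (hn2.of_mul_right b₀)
    rw [Nat.ModEq, Nat.mod_eq_of_lt (show 1 < 4 * u by omega)] at this
    exact this
  have hn4 : n % 4 = 1 := by
    rw [← Nat.mod_mod_of_dvd n (show 4 ∣ 4 * u from ⟨u, rfl⟩), hn4u]
  have hnp : jacobiSym n p = -1 := by
    rw [← jacobiSym.legendreSym.to_jacobiSym, legendreSym.eq_neg_one_iff]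
    have h1 : ((n : ℤ) : ZMod p) = x := by
      rw [Int.cast_natCast, (ZMod.natCast_eq_natCast_iff _ _ _).mpr hn1, ZMod.natCast_zmod_val]
    rwa [h1]
  have hnpc : n.Coprime p := by
    have h0 : jacobiSym n p ≠ 0 := by rw [hnp]; norm_num
    by_contra hc
    exact h0 (jacobiSym.eq_zero_iff.mpr ⟨hp.ne_zero, by rwa [Int.gcd_natCast_natCast]⟩)
  have hnb : n.Coprime b₀ := by
    have h1 : n ≡ 1 [MOD b₀] := hn2.of_mul_left (4 * u)
    rw [Nat.Coprime, h1.gcd_eq, Nat.gcd_one_left]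
  refine ⟨n, (Nat.odd_iff.mpr (Nat.odd_of_mod_four_eq_one hn4)), ?_⟩
  rw [jacobiSym.mul_left, jacobiSym.mul_left, jacobiSym.mul_left, jacobiSym_sign hn4 he,
    jacobiSym_eq_of_mod_eq_one hn4u, jacobiSym.sq_one',
    jacobiSym.quadratic_reciprocity_one_mod_four' hpodd hn4, hnp]
  · norm_num
  · rw [Int.gcd_natCast_natCast]
    exact (Nat.Coprime.mul_right (hnpc.pow_right j) hnb).symm

lemma exists_jacobiSym_eq_neg_one_of_two {b : ℕ} (hb : 0 < b) {e : ℤ} (he : e = 1 ∨ e = -1) :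
    ∃ n : ℕ, Odd n ∧ jacobiSym (e * 2 * b ^ 2) n = -1 := by
  obtain ⟨j, b₀, hb₀, rfl⟩ := Nat.exists_eq_pow_mul_and_not_dvd hb.ne' 2 (by norm_num)
  have hcop : Nat.Coprime 8 b₀ :=
    Nat.Coprime.pow_left 3 ((Nat.prime_two.coprime_iff_not_dvd).mpr hb₀)
  obtain ⟨n, hn1, hn2⟩ := Nat.chineseRemainder hcop 5 1
  have hn8 : n % 8 = 5 := hn1
  have hn4 : n % 4 = 1 := by omega
  have hodd := (Nat.odd_iff.mpr (Nat.odd_of_mod_four_eq_one hn4))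
  refine ⟨n, hodd, ?_⟩
  rw [jacobiSym.mul_left, jacobiSym.mul_left, jacobiSym_sign hn4 he, jacobiSym.sq_one',
    jacobiSym.at_two hodd]
  · have : ((n : ℕ) : ZMod 8) = 5 := by
      rw [show (5 : ZMod 8) = ((5 : ℕ) : ZMod 8) by rfl, ZMod.natCast_eq_natCast_iff]
      exact hn1
    rw [this]
    decide
  · rw [Int.gcd_natCast_natCast]
    refine (Nat.Coprime.mul_right ((Nat.coprime_two_right.mpr hodd).pow_right j) ?_).symm
    rw [Nat.Coprime, hn2.gcd_eq, Nat.gcd_one_left]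

lemma exists_jacobiSym_eq_neg_one_of_neg_sq {b : ℕ} (hb : 0 < b) :
    ∃ n : ℕ, Odd n ∧ jacobiSym (-1 * b ^ 2) n = -1 := by
  have hb2 : 0 < b ^ 2 := by positivity
  obtain ⟨n, hn⟩ : ∃ n, 4 * b ^ 2 = n + 1 := ⟨4 * b ^ 2 - 1, by omega⟩
  have hn4 : n % 4 = 3 := by omega
  have hodd := Nat.odd_iff.mpr (Nat.odd_of_mod_four_eq_three hn4)
  refine ⟨n, hodd, ?_⟩
  rw [jacobiSym.mul_left, jacobiSym.at_neg_one hodd, ZMod.χ₄_nat_three_mod_four hn4,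
    jacobiSym.sq_one', mul_one]
  rw [Int.gcd_natCast_natCast]
  have h1 : b.gcd n ∣ 4 * b ^ 2 :=
    (Nat.gcd_dvd_left b n).trans ⟨4 * b, by ring⟩
  rw [hn] at h1
  exact Nat.dvd_one.mp ((Nat.dvd_add_right (Nat.gcd_dvd_right b n)).mp h1)

/-- A nonsquare is not a square in the sense of the Jacobi symbol for some modulus. -/
lemma exists_jacobiSym_eq_neg_one {D : ℤ} (hD : ¬ IsSquare D) :
    ∃ n : ℕ, Odd n ∧ jacobiSym D n = -1 := by
  have hD0 : D ≠ 0 := fun h => hD (h ▸ IsSquare.zero)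
  obtain ⟨a, b, hab, hsq⟩ := Nat.sq_mul_squarefree D.natAbs
  have hb : 0 < b := Nat.pos_of_ne_zero fun h => hD0 (by
    rw [h] at hab; exact Int.natAbs_eq_zero.mp (by rw [← hab]; ring))
  obtain ⟨e, he, hDe⟩ : ∃ e : ℤ, (e = 1 ∨ e = -1) ∧ D = e * a * b ^ 2 := by
    rcases Int.natAbs_eq D with h | h
    · exact ⟨1, Or.inl rfl, by rw [h, ← hab]; push_cast; ring⟩
    · exact ⟨-1, Or.inr rfl, by rw [h, ← hab]; push_cast; ring⟩
  rw [hDe]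
  by_cases hp : ∃ p, p.Prime ∧ p ≠ 2 ∧ p ∣ a
  · obtain ⟨p, hp, hp2, u, rfl⟩ := hp
    have hpu : ¬ p ∣ u := by
      rintro ⟨w, rfl⟩
      exact hp.one_lt.ne' (Nat.isUnit_iff.mp (hsq p ⟨w, by ring⟩))
    rw [Nat.cast_mul]
    exact exists_jacobiSym_eq_neg_one_of_odd_prime hp hp2 hpu hb he
  · push Not at hp
    have ha : a = 1 ∨ a = 2 := by
      by_cases h2 : 2 ∣ a
      · obtain ⟨w, rfl⟩ := h2
        right
        by_cases hw : w = 1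
        · rw [hw]
        · exfalso
          obtain ⟨p, hpp, w', rfl⟩ := Nat.exists_prime_and_dvd hw
          have hp2 : p = 2 := by
            by_contra h
            exact hp p hpp h ⟨2 * w', by ring⟩
          subst hp2
          exact Nat.prime_two.one_lt.ne' (Nat.isUnit_iff.mp (hsq 2 ⟨w', by ring⟩))
      · left
        by_contra h1
        obtain ⟨p, hpp, hpa⟩ := Nat.exists_prime_and_dvd h1
        by_cases h : p = 2
        · exact h2 (h ▸ hpa)
        · exact hp p hpp h hpa
    rcases ha with rfl | rfl
    · rcases he with rfl | rfl
      · exact absurd ⟨(b : ℤ), by rw [hDe]; push_cast; ring⟩ hD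
      · simpa using exists_jacobiSym_eq_neg_one_of_neg_sq hb
    · exact exists_jacobiSym_eq_neg_one_of_two hb he

/-- The values of the Jacobi symbol `(D / n)` at odd `n`, extended by zero. -/
def jacobiFun (D : ℤ) (n : ℕ) : ℤ := if Odd n then jacobiSym D n else 0

lemma jacobiFun_mul (D : ℤ) (a b : ℕ) : jacobiFun D (a * b) = jacobiFun D a * jacobiFun D b := by
  simp only [jacobiFun, Nat.odd_mul]
  by_cases ha : Odd a
  · by_cases hb : Odd b
    · rw [if_pos ⟨ha, hb⟩, if_pos ha, if_pos hb, jacobiSym.mul_right' D ha.pos.ne' hb.pos.ne']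
    · simp [hb]
  · simp [ha]

lemma jacobiFun_mod (D : ℤ) (n : ℕ) : jacobiFun D (n % (4 * D.natAbs)) = jacobiFun D n := by
  have h : Odd (n % (4 * D.natAbs)) ↔ Odd n := by
    rw [Nat.odd_iff, Nat.odd_iff, Nat.mod_mod_of_dvd n ⟨2 * D.natAbs, by ring⟩]
  simp only [jacobiFun, h]
  split_ifs with hn
  · rw [← jacobiSym.mod_right D hn]
  · rfl

lemma coprime_of_jacobiFun_ne_zero {D : ℤ} {n : ℕ} (h : jacobiFun D n ≠ 0) :
    n.Coprime (4 * D.natAbs) := by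
  have hodd : Odd n := by
    by_contra hc
    exact h (if_neg hc)
  rw [jacobiFun, if_pos hodd] at h
  have hc : D.gcd n = 1 := by
    by_contra hc
    exact h (jacobiSym.eq_zero_iff.mpr ⟨hodd.pos.ne', hc⟩)
  refine Nat.Coprime.mul_right ((Nat.coprime_two_right.mpr hodd).pow_right 2) ?_
  rw [Nat.Coprime, Nat.gcd_comm]
  rwa [Int.gcd, Int.natAbs_natCast] at hc

/-- The quadratic Dirichlet character `n ↦ (D / n)` modulo `4 |D|`. -/
def jacobiChar (D : ℤ) (hD : D ≠ 0) : DirichletCharacter ℂ (4 * D.natAbs) :=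
  have : NeZero (4 * D.natAbs) := ⟨by simpa using hD⟩
  { toFun := fun a => jacobiFun D a.val
    map_one' := by
      rw [ZMod.val_one_eq_one_mod, jacobiFun_mod]
      simp [jacobiFun]
    map_mul' := fun a b => by
      rw [ZMod.val_mul, jacobiFun_mod, jacobiFun_mul, Int.cast_mul]
    map_nonunit' := fun a ha => by
      by_contra h
      refine ha ?_
      rw [← ZMod.natCast_zmod_val a, ZMod.isUnit_iff_coprime]
      exact coprime_of_jacobiFun_ne_zero fun h0 => h (by simp only [h0, Int.cast_zero]) }

lemma jacobiChar_natCast {D : ℤ} (hD : D ≠ 0) (n : ℕ) : jacobiChar D hD n = jacobiFun D n := by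
  change ((jacobiFun D (n : ZMod (4 * D.natAbs)).val : ℤ) : ℂ) = _
  rw [ZMod.val_natCast, jacobiFun_mod]

lemma jacobiFun_trichotomy (D : ℤ) (n : ℕ) :
    jacobiFun D n = 0 ∨ jacobiFun D n = 1 ∨ jacobiFun D n = -1 := by
  unfold jacobiFun
  split_ifs
  · exact jacobiSym.trichotomy D n
  · exact Or.inl rfl

lemma jacobiChar_sq {D : ℤ} (hD : D ≠ 0) : jacobiChar D hD ^ 2 = 1 := by
  rw [← MulChar.isQuadratic_iff_sq_eq_one]
  intro a
  have : NeZero (4 * D.natAbs) := ⟨by simpa using hD⟩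
  rw [← ZMod.natCast_zmod_val a, jacobiChar_natCast]
  rcases jacobiFun_trichotomy D a.val with h | h | h <;> simp [h]

lemma jacobiChar_ne_one {D : ℤ} (hD : D ≠ 0) (hsq : ¬ IsSquare D) : jacobiChar D hD ≠ 1 := by
  intro h
  obtain ⟨n, hn, hJ⟩ := exists_jacobiSym_eq_neg_one hsq
  have h1 := jacobiChar_natCast hD n
  rw [jacobiFun, if_pos hn, hJ, h] at h1
  by_cases hu : IsUnit (n : ZMod (4 * D.natAbs))
  · rw [MulChar.one_apply hu] at h1
    norm_num at h1
  · rw [MulChar.map_nonunit _ hu] at h1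
    norm_num at h1

/-- The number of representations attached to the character `n ↦ (D / n)`. -/
def divisorCharSum (D : ℤ) (n : ℕ) : ℝ := ∑ d ∈ n.divisors, (jacobiFun D d : ℝ)

lemma divisorCharSum_nonneg {D : ℤ} (hD : D ≠ 0) (n : ℕ) : 0 ≤ divisorCharSum D n := by
  have h := DirichletCharacter.zetaMul_nonneg (jacobiChar_sq hD) n
  have h1 : DirichletCharacter.zetaMul (jacobiChar D hD) n = (divisorCharSum D n : ℂ) := by
    rw [DirichletCharacter.zetaMul, ArithmeticFunction.coe_zeta_mul_apply, divisorCharSum,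
      ofReal_sum]
    refine Finset.sum_congr rfl fun d hd => ?_
    rw [toArithmeticFunction, ArithmeticFunction.coe_mk,
      if_neg (Nat.pos_of_mem_divisors hd).ne', jacobiChar_natCast, ofReal_intCast]
  rw [h1] at h
  exact_mod_cast h

lemma hasSum_jacobiFun {D : ℤ} (hD : D ≠ 0) {v : ℝ} (hv : 1 < v) :
    HasSum (fun n : ℕ => 1 / (n : ℝ) ^ v * jacobiFun D n)
      (LSeries (jacobiChar D hD ·) v).re := by
  have hv' : 1 < (v : ℂ).re := by simpa using hv
  have h1 := (DirichletCharacter.LSeriesSummable_of_one_lt_re (jacobiChar D hD) hv').LSeriesHasSum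
  have h2 := Complex.hasSum_re h1
  refine h2.of_eq (fun n => ?_) rfl
  rcases Nat.eq_zero_or_pos n with rfl | hn
  · simp [Real.zero_rpow (by linarith : v ≠ 0)]
  · rw [LSeries.term_of_ne_zero hn.ne', jacobiChar_natCast]
    have h3 : ((jacobiFun D n : ℤ) : ℂ) / (n : ℂ) ^ (v : ℂ)
        = ((1 / (n : ℝ) ^ v * jacobiFun D n : ℝ) : ℂ) := by
      rw [← ofReal_natCast, ← ofReal_cpow (Nat.cast_nonneg n)]
      push_cast
      ring
    rw [h3, ofReal_re]

lemma hasSum_divisorCharSum {D : ℤ} (hD : D ≠ 0) {v : ℝ} (hv : 1 < v) :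
    HasSum (fun n : ℕ => 1 / (n : ℝ) ^ v * divisorCharSum D n)
      ((LSeries (jacobiChar D hD ·) v).re * zetaCop 1 v) := by
  have h := (hasSum_jacobiFun hD hv).real_mul_divisorsAntidiagonal (hasSum_zetaCop 1 hv)
    (by simp [Real.zero_rpow (by linarith : v ≠ 0)]) (copInd_div_rpow_zero 1 (by linarith))
  refine h.of_eq (fun n => ?_) rfl
  rw [divisorCharSum, Finset.mul_sum, Nat.sum_divisorsAntidiagonal
    (fun x y => 1 / (x : ℝ) ^ v * jacobiFun D x * (copInd 1 y / (y : ℝ) ^ v))]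
  refine Finset.sum_congr rfl fun d hd => ?_
  obtain ⟨e, rfl⟩ := Nat.dvd_of_mem_divisors hd
  rw [Nat.mul_div_cancel_left _ (Nat.pos_of_mem_divisors hd), Nat.cast_mul,
    Real.mul_rpow (Nat.cast_nonneg d) (Nat.cast_nonneg e), copInd_one_left]
  ring

/-- Indicator function of the numbers all of whose prime factors divide `k`. -/
def factoredInd (k n : ℕ) : ℝ :=
  (Nat.factoredNumbers k.primeFactors).indicator (fun _ => (1 : ℝ)) n

lemma factoredInd_nonneg (k n : ℕ) : 0 ≤ factoredInd k n :=
  Set.indicator_nonneg (fun _ _ => zero_le_one) n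

lemma factoredInd_of_mem {k n : ℕ} (h : n ∈ Nat.factoredNumbers k.primeFactors) :
    factoredInd k n = 1 :=
  Set.indicator_of_mem h _

lemma factoredInd_zero (k : ℕ) : factoredInd k 0 = 0 :=
  Set.indicator_of_notMem (fun h => Nat.ne_zero_of_mem_factoredNumbers h rfl) _

lemma summable_factoredInd_div (k : ℕ) : Summable fun n : ℕ => factoredInd k n / (n : ℝ) := by
  have h := (EulerProduct.summable_and_hasSum_factoredNumbers_prod_filter_prime_geometric
    (f := { toFun := fun n : ℕ => ((n : ℝ))⁻¹, map_one' := by simp,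
            map_mul' := fun a b => by push_cast; rw [mul_inv] : ℕ →* ℝ })
    (fun {p} hp => ?_) k.primeFactors).2.summable
  · have h2 := summable_subtype_iff_indicator.mp h
    refine h2.congr fun n => ?_
    by_cases hn : n ∈ Nat.factoredNumbers k.primeFactors
    · rw [Set.indicator_of_mem hn, factoredInd_of_mem hn, one_div]
      rfl
    · rw [Set.indicator_of_notMem hn, factoredInd, Set.indicator_of_notMem hn, zero_div]
  · have : (1 : ℝ) < p := by exact_mod_cast hp.one_lt
    change ‖((p : ℝ))⁻¹‖ < 1
    rw [norm_inv, Real.norm_natCast]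
    exact inv_lt_one_of_one_lt₀ this

lemma factoredInd_div_rpow_le (k : ℕ) {v : ℝ} (hv : 1 ≤ v) (n : ℕ) :
    factoredInd k n / (n : ℝ) ^ v ≤ factoredInd k n / (n : ℝ) := by
  rcases Nat.eq_zero_or_pos n with rfl | hn
  · simp [factoredInd_zero]
  · have hn' : (1 : ℝ) ≤ n := by exact_mod_cast hn
    exact div_le_div_of_nonneg_left (factoredInd_nonneg k n) (by linarith)
      (Real.self_le_rpow_of_one_le hn' hv)

lemma factoredInd_div_rpow_nonneg (k : ℕ) (v : ℝ) (n : ℕ) : 0 ≤ factoredInd k n / (n : ℝ) ^ v :=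
  div_nonneg (factoredInd_nonneg k n) (Real.rpow_nonneg (Nat.cast_nonneg n) v)

lemma summable_factoredInd_div_rpow (k : ℕ) {v : ℝ} (hv : 1 ≤ v) :
    Summable fun n : ℕ => factoredInd k n / (n : ℝ) ^ v :=
  Summable.of_nonneg_of_le (factoredInd_div_rpow_nonneg k v) (factoredInd_div_rpow_le k hv)
    (summable_factoredInd_div k)

lemma one_mem_factoredNumbers (s : Finset ℕ) : 1 ∈ Nat.factoredNumbers s :=
  Nat.mem_factoredNumbers_iff_primeFactors_subset.mpr ⟨one_ne_zero, by simp⟩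

lemma exists_coprime_mul_factored (k : ℕ) (hk : k ≠ 0) {n : ℕ} (hn : n ≠ 0) :
    ∃ a b, n = a * b ∧ a ≠ 0 ∧ a.Coprime k ∧ b ∈ Nat.factoredNumbers k.primeFactors := by
  induction n using Nat.recOnMul with
  | zero => exact absurd rfl hn
  | one => exact ⟨1, 1, rfl, one_ne_zero, Nat.coprime_one_left k, one_mem_factoredNumbers _⟩
  | prime p hp =>
    by_cases h : p ∣ k
    · refine ⟨1, p, (one_mul p).symm, one_ne_zero, Nat.coprime_one_left k, ?_⟩
      rw [Nat.mem_factoredNumbers_iff_primeFactors_subset]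
      exact ⟨hp.ne_zero, by simp [h, hk, hp]⟩
    · exact ⟨p, 1, (mul_one p).symm, hp.ne_zero, (hp.coprime_iff_not_dvd).mpr h,
        one_mem_factoredNumbers _⟩
  | mul x y ihx ihy =>
    obtain ⟨a, b, rfl, ha, hc, hb⟩ := ihx (left_ne_zero_of_mul hn)
    obtain ⟨a', b', rfl, ha', hc', hb'⟩ := ihy (right_ne_zero_of_mul hn)
    exact ⟨a * a', b * b', by ring, mul_ne_zero ha ha', hc.mul_left hc',
      Nat.mul_mem_factoredNumbers hb hb'⟩

lemma jacobiFun_eq_one_of_sqCount {m : ℤ} {n d : ℕ} (hn : sqCount m n ≠ 0) (hdn : d ∣ n)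
    (hd : d.Coprime (2 * m).natAbs) : jacobiFun (-m) d = 1 := by
  rw [Int.natAbs_mul] at hd
  have hodd : Odd d := Nat.coprime_two_right.mp (Nat.Coprime.coprime_mul_right_right hd)
  have hdm : d.Coprime m.natAbs := Nat.Coprime.coprime_mul_left_right hd
  rw [jacobiFun, if_pos hodd]
  obtain ⟨x, hx⟩ := Finset.card_ne_zero.mp hn
  have hx2 := (Finset.mem_filter.mp hx).2
  have hdx : (d : ℤ) ∣ (x : ℤ) ^ 2 + m := (Int.natCast_dvd_natCast.mpr hdn).trans hx2
  have hJ : jacobiSym (-m) d = jacobiSym x d ^ 2 := by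
    rw [← jacobiSym.pow_left]
    refine jacobiSym.mod_left' (Int.modEq_iff_dvd.mpr ?_)
    rw [sub_neg_eq_add]
    exact hdx
  have hne : jacobiSym (-m) d ≠ 0 := by
    rw [Ne, jacobiSym.eq_zero_iff]
    rintro ⟨-, h⟩
    apply h
    rw [Int.neg_gcd, Int.gcd, Int.natAbs_natCast, Nat.gcd_comm]
    exact hdm
  rcases jacobiSym.trichotomy x d with h | h | h
  · rw [hJ, h] at hne
    exact absurd rfl hne
  · rw [hJ, h]; norm_num
  · rw [hJ, h]; norm_num

/-- The Dirichlet convolution square of `factoredInd k n / n ^ v`. -/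
def factoredConv (k : ℕ) (v : ℝ) (n : ℕ) : ℝ := ∑ p ∈ n.divisorsAntidiagonal,
  factoredInd k p.1 / (p.1 : ℝ) ^ v * (factoredInd k p.2 / (p.2 : ℝ) ^ v)

lemma factoredConv_nonneg (k : ℕ) (v : ℝ) (n : ℕ) : 0 ≤ factoredConv k v n :=
  Finset.sum_nonneg fun p _ => mul_nonneg (factoredInd_div_rpow_nonneg k v p.1)
    (factoredInd_div_rpow_nonneg k v p.2)

lemma hasSum_factoredConv (k : ℕ) {v : ℝ} (hv : 1 ≤ v) :
    HasSum (factoredConv k v) ((∑' n : ℕ, factoredInd k n / (n : ℝ) ^ v)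
      * ∑' n : ℕ, factoredInd k n / (n : ℝ) ^ v) := by
  have h0 : factoredInd k 0 / ((0 : ℕ) : ℝ) ^ v = 0 := by rw [factoredInd_zero, zero_div]
  have hs := (summable_factoredInd_div_rpow k hv).hasSum
  exact HasSum.real_mul_divisorsAntidiagonal (a := fun n : ℕ => factoredInd k n / (n : ℝ) ^ v)
    (b := fun n : ℕ => factoredInd k n / (n : ℝ) ^ v) hs hs h0 h0

lemma factoredConv_of_mem {k b : ℕ} (v : ℝ) (hb : b ∈ Nat.factoredNumbers k.primeFactors) :
    factoredConv k v b = b.divisors.card / (b : ℝ) ^ v := by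
  rw [factoredConv, Nat.sum_divisorsAntidiagonal (fun x y =>
    factoredInd k x / (x : ℝ) ^ v * (factoredInd k y / (y : ℝ) ^ v)), Finset.card_eq_sum_ones,
    Nat.cast_sum, Finset.sum_div]
  refine Finset.sum_congr rfl fun d hd => ?_
  obtain ⟨e, rfl⟩ := Nat.dvd_of_mem_divisors hd
  have hd1 : d ∈ Nat.factoredNumbers k.primeFactors :=
    Nat.mem_factoredNumbers_of_dvd hb (dvd_mul_right d e)
  have he1 : e ∈ Nat.factoredNumbers k.primeFactors :=
    Nat.mem_factoredNumbers_of_dvd hb (dvd_mul_left e d)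
  rw [Nat.mul_div_cancel_left _ (Nat.pos_of_mem_divisors hd), factoredInd_of_mem hd1,
    factoredInd_of_mem he1, Nat.cast_mul, Real.mul_rpow (Nat.cast_nonneg d) (Nat.cast_nonneg e)]
  rw [div_mul_div_comm]
  simp

lemma divisorCharSum_eq_card {m : ℤ} {n a : ℕ} (hn : sqCount m n ≠ 0) (han : a ∣ n)
    (hac : a.Coprime (2 * m).natAbs) : divisorCharSum (-m) a = a.divisors.card := by
  rw [divisorCharSum, Finset.card_eq_sum_ones, Nat.cast_sum]
  refine Finset.sum_congr rfl fun d hd => ?_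
  have hda := Nat.dvd_of_mem_divisors hd
  rw [jacobiFun_eq_one_of_sqCount hn (hda.trans han) (Nat.Coprime.coprime_dvd_left hda hac)]
  simp

lemma sqCount_mul_div_rpow_le {m : ℤ} (hm : m ≠ 0) (v : ℝ) {a b : ℕ} (hab : a.Coprime b) :
    1 / ((a * b : ℕ) : ℝ) ^ v * sqCount m (a * b)
      ≤ sqDivSum m * (1 / (a : ℝ) ^ v * a.divisors.card * (b.divisors.card / (b : ℝ) ^ v)) := by
  have hc : (sqCount m (a * b) : ℝ) ≤ sqDivSum m * (a.divisors.card * b.divisors.card) := by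
    have := sqCount_le hm (a * b)
    rwa [hab.card_divisors_mul, Nat.cast_mul] at this
  have hp : 0 ≤ 1 / ((a : ℝ) ^ v * (b : ℝ) ^ v) := by positivity
  rw [Nat.cast_mul, Real.mul_rpow (Nat.cast_nonneg a) (Nat.cast_nonneg b)]
  calc _ ≤ _ := mul_le_mul_of_nonneg_left hc hp
    _ = _ := by
        rw [one_div, mul_inv, one_div, div_eq_mul_inv]
        ring

lemma sqCount_div_rpow_le {m : ℤ} (hm : m ≠ 0) (v : ℝ) (n : ℕ) :
    1 / (n : ℝ) ^ v * sqCount m n ≤ sqDivSum m * ∑ p ∈ n.divisorsAntidiagonal,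
      1 / (p.1 : ℝ) ^ v * divisorCharSum (-m) p.1 * factoredConv (2 * m).natAbs v p.2 := by
  have hterm : ∀ p ∈ n.divisorsAntidiagonal, 0 ≤ 1 / (p.1 : ℝ) ^ v * divisorCharSum (-m) p.1
      * factoredConv (2 * m).natAbs v p.2 := fun p _ =>
    mul_nonneg (mul_nonneg (one_div_nonneg.mpr (Real.rpow_nonneg (Nat.cast_nonneg _) v))
      (divisorCharSum_nonneg (neg_ne_zero.mpr hm) _)) (factoredConv_nonneg _ _ _)
  rcases eq_or_ne (sqCount m n) 0 with hn | hn
  · rw [hn, Nat.cast_zero, mul_zero]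
    exact mul_nonneg (sqDivSum_nonneg m) (Finset.sum_nonneg hterm)
  have hn0 : n ≠ 0 := by
    rintro rfl
    exact hn rfl
  obtain ⟨a, b, hnab, ha0, hac, hb⟩ := exists_coprime_mul_factored (2 * m).natAbs
    (Int.natAbs_ne_zero.mpr (mul_ne_zero two_ne_zero hm)) hn0
  have hb0 : b ≠ 0 := Nat.ne_zero_of_mem_factoredNumbers hb
  have hab : a.Coprime b := by
    refine Nat.coprime_of_dvd fun p hp hpa hpb => ?_
    have h1 := (Nat.mem_factoredNumbers_iff_primeFactors_subset.mp hb).2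
      (Nat.mem_primeFactors.mpr ⟨hp, hpb, hb0⟩)
    exact (Nat.Prime.coprime_iff_not_dvd hp).mp (Nat.Coprime.coprime_dvd_left hpa hac)
      (Nat.dvd_of_mem_primeFactors h1)
  have hmem : (a, b) ∈ n.divisorsAntidiagonal := Nat.mem_divisorsAntidiagonal.mpr ⟨hnab.symm, hn0⟩
  refine le_trans ?_ (mul_le_mul_of_nonneg_left (Finset.single_le_sum hterm hmem)
    (sqDivSum_nonneg m))
  rw [divisorCharSum_eq_card hn (hnab ▸ dvd_mul_right a b) hac, factoredConv_of_mem v hb, hnab]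
  exact sqCount_mul_div_rpow_le hm v hab

lemma tendsto_sqSeries_of_not_isSquare {m : ℤ} (hm : ¬ IsSquare (-m)) (M : ℕ) :
    Tendsto (fun v : ℝ => (v - 1) ^ 2 * sqSeries M m v) (𝓝[>] 1) (𝓝 0) := by
  have hm0 : m ≠ 0 := by
    rintro rfl
    exact hm ⟨0, by simp⟩
  have hD : -m ≠ 0 := neg_ne_zero.mpr hm0
  have : NeZero (4 * (-m).natAbs) := ⟨by simpa using hm0⟩
  set k := (2 * m).natAbs with hk
  set E : ℝ := ∑' n : ℕ, factoredInd k n / (n : ℝ) with hE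
  have hE0 : 0 ≤ E := tsum_nonneg fun n => div_nonneg (factoredInd_nonneg k n) (Nat.cast_nonneg n)
  set χ := jacobiChar (-m) hD with hχ
  have hid : Tendsto (fun v : ℝ => v) (𝓝[>] 1) (𝓝 1) := nhdsWithin_le_nhds
  have hL : Tendsto (fun v : ℝ => (χ.LFunction v).re) (𝓝[>] 1) (𝓝 (χ.LFunction 1).re) := by
    have hc : Continuous fun v : ℝ => (χ.LFunction v).re := Complex.continuous_re.comp
      ((DirichletCharacter.differentiable_LFunction
        (jacobiChar_ne_one hD hm)).continuous.comp Complex.continuous_ofReal)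
    have := (hc.tendsto 1).mono_left (nhdsWithin_le_nhds (s := Set.Ioi 1))
    simpa using this
  have hmain : Tendsto (fun v : ℝ => (v - 1) * ((v - 1) * zetaCop 1 v) * (χ.LFunction v).re
      * (sqDivSum m * E ^ 2)) (𝓝[>] 1) (𝓝 0) := by
    have h := (((hid.sub_const 1).mul tendsto_sub_mul_zetaCop_one).mul hL).mul_const
      (sqDivSum m * E ^ 2)
    simpa using h
  refine squeeze_zero' ?_ ?_ hmain
  · filter_upwards [self_mem_nhdsWithin] with v hv
    exact mul_nonneg (sq_nonneg _) (sqSeries_nonneg M m v)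
  · filter_upwards [self_mem_nhdsWithin] with v hv
    have hv' : 1 < v := hv
    have hconv := (hasSum_divisorCharSum hD hv').real_mul_divisorsAntidiagonal
      (hasSum_factoredConv k hv'.le) (by simp [divisorCharSum]) (by simp [factoredConv])
    rw [← hχ] at hconv
    rw [← DirichletCharacter.LFunction_eq_LSeries χ (by simpa using hv')] at hconv
    have hEv : ∑' n : ℕ, factoredInd k n / (n : ℝ) ^ v ≤ E :=
      (summable_factoredInd_div_rpow k hv'.le).tsum_le_tsum (factoredInd_div_rpow_le k hv'.le)
        (summable_factoredInd_div k)
    have hEv0 : 0 ≤ ∑' n : ℕ, factoredInd k n / (n : ℝ) ^ v :=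
      tsum_nonneg (factoredInd_div_rpow_nonneg k v)
    have hLz : 0 ≤ (χ.LFunction v).re * zetaCop 1 v := by
      have h := hasSum_divisorCharSum hD hv'
      rw [← hχ, ← DirichletCharacter.LFunction_eq_LSeries χ (by simpa using hv')] at h
      rw [← h.tsum_eq]
      exact tsum_nonneg fun n => mul_nonneg (by positivity) (divisorCharSum_nonneg hD n)
    have hle : sqSeries M m v ≤ sqDivSum m * ((χ.LFunction v).re * zetaCop 1 v * (E * E)) := by
      calc sqSeries M m v ≤ _ := (summable_sqSeries hm0 M hv').tsum_le_tsum (fun n => ?_)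
            (hconv.mul_left (sqDivSum m)).summable
        _ = sqDivSum m * ((χ.LFunction v).re * zetaCop 1 v * _) :=
            (hconv.mul_left (sqDivSum m)).tsum_eq
        _ ≤ _ := mul_le_mul_of_nonneg_left (mul_le_mul_of_nonneg_left
            (mul_le_mul hEv hEv hEv0 hE0) hLz) (sqDivSum_nonneg m)
      refine le_trans ?_ (sqCount_div_rpow_le hm0 v n)
      refine mul_le_mul_of_nonneg_right ?_ (Nat.cast_nonneg _)
      exact div_le_div_of_nonneg_right (copInd_le_one M n) (Real.rpow_nonneg (Nat.cast_nonneg n) v)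
    calc (v - 1) ^ 2 * sqSeries M m v ≤ (v - 1) ^ 2 * _ :=
          mul_le_mul_of_nonneg_left hle (sq_nonneg _)
      _ = _ := by ring

lemma hasSum_fourier_of_summable {F : ℝ → ℂ} (hF : Continuous F) (hper : F (-1 / 2) = F (1 / 2))
    {c : ℤ → ℂ} (hc : Summable c)
    (hcoeff : ∀ m : ℤ, ∫ u in (-1 / 2 : ℝ)..(1 / 2), ee (-(m * u)) * F u = c m)
    {u : ℝ} (hu : u ∈ Set.Ico (-1 / 2 : ℝ) (1 / 2)) :
    HasSum (fun m : ℤ => c m * ee ((m * u : ℝ) : ℂ)) (F u) := by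
  have : Fact ((0 : ℝ) < 1) := ⟨one_pos⟩
  have hend : (-1 / 2 : ℝ) + 1 = 1 / 2 := by norm_num
  have hcont : Continuous (AddCircle.liftIco (1 : ℝ) (-1 / 2) F) :=
    AddCircle.liftIco_continuous (by rw [hend]; exact hper) hF.continuousOn
  have hco : ∀ m : ℤ, fourierCoeff (AddCircle.liftIco (1 : ℝ) (-1 / 2) F) m = c m := by
    intro m
    rw [fourierCoeff_liftIco_eq, fourierCoeffOn_eq_integral, ← hcoeff m, hend]
    rw [show ((1 : ℝ) / (1 / 2 - -1 / 2)) = 1 by norm_num, one_smul]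
    refine intervalIntegral.integral_congr fun x _ => ?_
    simp only [fourier_apply, smul_eq_mul]
    rw [← fourier_apply, fourier_coe_apply, ee]
    congr 2
    push_cast
    ring
  have hs : Summable (fourierCoeff (⟨_, hcont⟩ : C(AddCircle (1 : ℝ), ℂ))) := by
    refine hc.congr fun m => ?_
    exact (hco m).symm
  have h := has_pointwise_sum_fourier_series_of_summable hs (u : AddCircle (1 : ℝ))
  have hval : (⟨_, hcont⟩ : C(AddCircle (1 : ℝ), ℂ)) (u : AddCircle (1 : ℝ)) = F u :=
    AddCircle.liftIco_coe_apply (by rw [hend]; exact hu)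
  rw [hval] at h
  have he : ∀ m : ℤ, c m * ee ((m * u : ℝ) : ℂ) = fourierCoeff
      (AddCircle.liftIco (1 : ℝ) (-1 / 2) F) m • fourier m (u : AddCircle (1 : ℝ)) := by
    intro m
    rw [fourier_coe_apply, smul_eq_mul, hco m, ee]
    congr 2
    push_cast
    ring
  simp_rw [he]
  exact h

lemma integral_ee_mul_exp (m : ℤ) (α : ℂ) (h : α ≠ 2 * π * I * m) :
    ∫ u in (-1 / 2 : ℝ)..(1 / 2), ee (-(m * u)) * Complex.exp (α * u)
      = (-1) ^ m * (Complex.exp (α / 2) - Complex.exp (-(α / 2))) / (α - 2 * π * I * m) := by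
  have h0 : α - 2 * π * I * m ≠ 0 := sub_ne_zero.mpr h
  have h1 : ∀ u : ℝ, ee (-(m * u)) * Complex.exp (α * u)
      = Complex.exp ((α - 2 * π * I * m) * u) := by
    intro u
    rw [ee, ← Complex.exp_add]
    congr 1
    ring
  simp_rw [h1]
  rw [integral_exp_mul_complex h0]
  congr 1
  have hpi : Complex.exp (π * I * m) = (-1) ^ m := by
    rw [mul_comm, Complex.exp_int_mul, Complex.exp_pi_mul_I]
  have hpi_neg : Complex.exp (-(π * I * m)) = (-1) ^ m := by
    rw [Complex.exp_neg, hpi, ← inv_zpow, inv_neg, inv_one]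
  rw [mul_sub, show (α - 2 * π * I * m) * ((1 / 2 : ℝ) : ℂ) = -(π * I * m) + α / 2 by push_cast; ring,
    show (α - 2 * π * I * m) * ((-1 / 2 : ℝ) : ℂ) = π * I * m + -(α / 2) by push_cast; ring,
    Complex.exp_add, Complex.exp_add, hpi, hpi_neg]

/-- The multiple of the exponential `exp (-2πT(u + 1/2))` with the same jump as `ee (t * u)`. -/
def jumpSize (t T : ℝ) : ℂ := -2 * I * Real.sin (π * t) / (1 - Real.exp (-(2 * π * T)))

/-- Fourier coefficients of `ee (t * u)` corrected by an exponential to be continuous. -/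
def jumpCoeff (t T : ℝ) (m : ℤ) : ℂ :=
  if (m : ℝ) = t then 1 else
    (-1) ^ m * (Real.sin (π * t) / π) * (t - I * T) / ((t - m) * (m - I * T))

lemma exp_pi_mul_I_eq (t : ℝ) : Complex.exp (π * I * t)
    = Real.cos (π * t) + Real.sin (π * t) * I := by
  rw [show (π * I * t : ℂ) = ((π * t : ℝ) : ℂ) * I by push_cast; ring, Complex.exp_mul_I]
  push_cast
  rfl

lemma integral_ee_mul_ee (t : ℝ) (m : ℤ) :
    ∫ u in (-1 / 2 : ℝ)..(1 / 2), ee (-(m * u)) * ee ((t * u : ℝ) : ℂ)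
      = if (m : ℝ) = t then 1 else (-1 : ℂ) ^ m * (Real.sin (π * t) / π) / (t - m) := by
  split_ifs with h
  · have : ∀ u : ℝ, ee (-(m * u)) * ee ((t * u : ℝ) : ℂ) = 1 := by
      intro u
      rw [← ee_add, ← h]
      push_cast
      rw [neg_add_cancel, ee_zero]
    simp_rw [this]
    norm_num
  · have hpi : (π : ℂ) ≠ 0 := by exact_mod_cast Real.pi_ne_zero
    have htm : (t : ℂ) - m ≠ 0 := by
      rw [sub_ne_zero]
      exact_mod_cast fun h' : t = (m : ℝ) => h h'.symm
    have hne : (2 * π * I * t : ℂ) ≠ 2 * π * I * m := by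
      intro h'
      apply htm
      rw [sub_eq_zero]
      exact mul_left_cancel₀ (by simp [hpi]) h'
    have h1 := integral_ee_mul_exp m (2 * π * I * t) hne
    have h2 : ∀ u : ℝ, ee ((t * u : ℝ) : ℂ) = Complex.exp (2 * π * I * t * u) := by
      intro u
      rw [ee]
      congr 1
      push_cast
      ring
    simp_rw [h2]
    rw [h1, show (2 * π * I * t / 2 : ℂ) = π * I * t by ring, Complex.exp_neg]
    have h3 : (Complex.exp (π * I * t))⁻¹ = Real.cos (π * t) - Real.sin (π * t) * I := by
      rw [← Complex.exp_neg, show -(π * I * t : ℂ) = π * I * ((-t : ℝ) : ℂ) by push_cast; ring,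
        exp_pi_mul_I_eq, mul_neg, Real.cos_neg, Real.sin_neg]
      push_cast
      ring
    rw [h3, exp_pi_mul_I_eq, ← mul_sub]
    have hI := I_ne_zero
    field_simp
    ring

lemma integral_ee_mul_decay {T : ℝ} (hT : 0 < T) (m : ℤ) :
    ∫ u in (-1 / 2 : ℝ)..(1 / 2), ee (-(m * u)) * (Real.exp (-(2 * π * T) * (u + 1 / 2)) : ℂ)
      = (-1) ^ m * (1 - Real.exp (-(2 * π * T))) / (2 * π * (T + I * m)) := by
  have hpi : (π : ℂ) ≠ 0 := by exact_mod_cast Real.pi_ne_zero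
  have hTm : (T : ℂ) + I * m ≠ 0 := by
    intro h
    have := congrArg Complex.re h
    simp at this
    exact hT.ne' this
  have hne : (-(2 * π * T) : ℂ) ≠ 2 * π * I * m := by
    intro h
    apply hTm
    have : (2 * π : ℂ) * (T + I * m) = 0 := by linear_combination -h
    simpa [hpi] using this
  have h2 : ∀ u : ℝ, ee (-(m * u)) * (Real.exp (-(2 * π * T) * (u + 1 / 2)) : ℂ)
      = Complex.exp (-(2 * π * T) / 2) * (ee (-(m * u)) * Complex.exp (-(2 * π * T) * u)) := by
    intro u
    rw [mul_left_comm, ← Complex.exp_add]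
    push_cast
    congr 2
    ring
  simp_rw [h2]
  rw [intervalIntegral.integral_const_mul, integral_ee_mul_exp m _ hne, ← mul_div_assoc,
    mul_left_comm, mul_sub, ← Complex.exp_add, ← Complex.exp_add, add_neg_cancel, Complex.exp_zero,
    add_halves]
  have h3 : (-(2 * π * T) - 2 * π * I * m : ℂ) ≠ 0 := sub_ne_zero.mpr hne
  push_cast
  rw [div_eq_div_iff h3 (by simp [hpi, hTm])]
  ring

lemma summable_of_eventually_le_div_sq {c : ℤ → ℂ} {C : ℝ}
    (h : ∀ᶠ m : ℤ in cofinite, ‖c m‖ ≤ C / (m : ℝ) ^ 2) :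
    Summable c ∧ Summable fun m : ℤ => ‖c m‖ * sqDivSum m := by
  constructor
  · have h1 : Summable fun m : ℤ => C * (1 / (m : ℝ) ^ 2) :=
      (Real.summable_one_div_int_pow.mpr one_lt_two).mul_left C
    refine Summable.of_norm_bounded_eventually h1 ?_
    filter_upwards [h] with m hm
    rwa [mul_one_div]
  · have h1 := (summable_sqDivSum one_lt_two).mul_left C
    refine Summable.of_norm_bounded_eventually h1 ?_
    filter_upwards [h] with m hm
    rw [Real.norm_of_nonneg (mul_nonneg (norm_nonneg _) (sqDivSum_nonneg m))]
    have h2 : |(m : ℝ)| ^ (2 : ℝ) = (m : ℝ) ^ 2 := by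
      rw [Real.rpow_two, sq_abs]
    rw [h2, mul_div_assoc', mul_comm C, mul_div_assoc, mul_comm]
    exact mul_le_mul_of_nonneg_left hm (sqDivSum_nonneg m)

lemma eventually_norm_jumpCoeff_le {t T : ℝ} (ht : 0 < t) (hT : 0 < T) :
    ∀ᶠ m : ℤ in cofinite, ‖jumpCoeff t T m‖ ≤ 2 * (t + T) / (m : ℝ) ^ 2 := by
  have hev : ∀ᶠ m : ℤ in cofinite, 2 * t < |(m : ℝ)| := by
    have h2 : Tendsto (fun m : ℤ => |(m : ℝ)|) cofinite atTop := by
      have := Int.isClosedEmbedding_coe_real.tendsto_cocompact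
      rw [cocompact_eq_cofinite] at this
      exact (tendsto_norm_cocompact_atTop (E := ℝ)).comp this
    exact h2.eventually_gt_atTop _
  filter_upwards [hev] with m hm
  have hm0 : 0 < |(m : ℝ)| := by linarith
  have hne : (m : ℝ) ≠ t := by
    intro h
    rw [h, abs_of_pos ht] at hm
    linarith
  rw [jumpCoeff, if_neg hne, norm_div, norm_mul, norm_mul, norm_mul, norm_zpow, norm_neg, norm_one,
    one_zpow, one_mul]
  have h1 : ‖(Real.sin (π * t) / π : ℂ)‖ ≤ 1 := by
    rw [norm_div, Complex.norm_real, Complex.norm_real, Real.norm_of_nonneg Real.pi_pos.le,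
      Real.norm_eq_abs]
    refine div_le_one_of_le₀ ((Real.abs_sin_le_one _).trans ?_) Real.pi_pos.le
    linarith [Real.pi_gt_three]
  have h2 : ‖(t - I * T : ℂ)‖ ≤ t + T := by
    refine (norm_sub_le _ _).trans ?_
    rw [norm_mul, norm_I, one_mul, Complex.norm_real, Complex.norm_real, Real.norm_of_nonneg ht.le,
      Real.norm_of_nonneg hT.le]
  have h3 : |(m : ℝ)| / 2 ≤ ‖(t - m : ℂ)‖ := by
    have : (t - m : ℂ) = ((t - m : ℝ) : ℂ) := by push_cast; rfl
    rw [this, Complex.norm_real, Real.norm_eq_abs]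
    have := abs_sub_abs_le_abs_sub (m : ℝ) t
    rw [abs_of_pos ht, abs_sub_comm] at this
    linarith
  have h4 : |(m : ℝ)| ≤ ‖(m - I * T : ℂ)‖ := by
    have := Complex.abs_re_le_norm (m - I * T : ℂ)
    simpa using this
  have h5 : (m : ℝ) ^ 2 / 2 ≤ ‖(t - m : ℂ)‖ * ‖(m - I * T : ℂ)‖ := by
    rw [← sq_abs]
    calc |(m : ℝ)| ^ 2 / 2 = |(m : ℝ)| / 2 * |(m : ℝ)| := by ring
      _ ≤ _ := mul_le_mul h3 h4 hm0.le (norm_nonneg _)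
  have h6 : (0 : ℝ) < (m : ℝ) ^ 2 := by rw [← sq_abs]; positivity
  calc _ ≤ 1 * (t + T) / ((m : ℝ) ^ 2 / 2) := by
        refine div_le_div₀ (by positivity) (mul_le_mul h1 h2 (norm_nonneg _) zero_le_one)
          (by positivity) h5
    _ = _ := by
        field_simp

lemma one_sub_exp_neg_ne_zero {T : ℝ} (hT : 0 < T) : (1 - Real.exp (-(2 * π * T)) : ℂ) ≠ 0 := by
  have : Real.exp (-(2 * π * T)) < 1 := Real.exp_lt_one_iff.mpr (by have := Real.pi_pos; nlinarith)
  rw [sub_ne_zero]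
  exact_mod_cast this.ne'

lemma integral_jump {t T : ℝ} (hT : 0 < T) (m : ℤ) :
    ∫ u in (-1 / 2 : ℝ)..(1 / 2), ee (-(m * u)) * (ee ((t * u : ℝ) : ℂ)
      - jumpSize t T * (Real.exp (-(2 * π * T) * (u + 1 / 2)) : ℂ)) = jumpCoeff t T m := by
  have hpi : (π : ℂ) ≠ 0 := by exact_mod_cast Real.pi_ne_zero
  have hE := one_sub_exp_neg_ne_zero hT
  have hee : ∀ a : ℂ, Continuous fun u : ℝ => ee (a * u) := by
    intro a
    unfold ee
    fun_prop
  have h1 : Continuous fun u : ℝ => ee (-(m * u)) * ee ((t * u : ℝ) : ℂ) := by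
    have ha := hee (-m)
    have hb := hee t
    simp only [neg_mul] at ha
    push_cast
    exact ha.mul hb
  have h2 : Continuous fun u : ℝ => jumpSize t T
      * (ee (-(m * u)) * (Real.exp (-(2 * π * T) * (u + 1 / 2)) : ℂ)) := by
    have ha := hee (-m)
    simp only [neg_mul] at ha
    refine continuous_const.mul (ha.mul ?_)
    fun_prop
  simp_rw [mul_sub, mul_left_comm _ (jumpSize t T)]
  rw [intervalIntegral.integral_sub (h1.intervalIntegrable _ _) (h2.intervalIntegrable _ _),
    intervalIntegral.integral_const_mul, integral_ee_mul_ee, integral_ee_mul_decay hT, jumpCoeff,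
    jumpSize]
  have hTm : (T : ℂ) + I * m ≠ 0 := by
    intro h
    have := congrArg Complex.re h
    simp at this
    exact hT.ne' this
  have hmT : (m : ℂ) - I * T ≠ 0 := by
    intro h
    apply hTm
    linear_combination I * h + T * I_sq
  split_ifs with h
  · have : Real.sin (π * t) = 0 := by
      rw [← h, mul_comm]
      exact Real.sin_int_mul_pi m
    rw [this]
    simp
  · have htm : (t : ℂ) - m ≠ 0 := by
      rw [sub_ne_zero]
      exact_mod_cast fun h' : t = (m : ℝ) => h h'.symm
    have hTm2 : (T : ℂ) + I * m = I * (m - I * T) := by linear_combination T * I_sq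
    rw [hTm2]
    have hI := I_ne_zero
    generalize (1 - Real.exp (-(2 * π * T)) : ℂ) = E at hE ⊢
    field_simp
    ring

lemma hasSum_jumpCoeff {t T : ℝ} (ht : 0 < t) (hT : 0 < T) {u : ℝ}
    (hu : u ∈ Set.Ico (-1 / 2 : ℝ) (1 / 2)) :
    HasSum (fun m : ℤ => jumpCoeff t T m * ee ((m * u : ℝ) : ℂ)) (ee ((t * u : ℝ) : ℂ)
      - jumpSize t T * (Real.exp (-(2 * π * T) * (u + 1 / 2)) : ℂ)) := by
  refine hasSum_fourier_of_summable (F := fun u : ℝ => ee ((t * u : ℝ) : ℂ)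
      - jumpSize t T * (Real.exp (-(2 * π * T) * (u + 1 / 2)) : ℂ)) ?_ ?_
    (summable_of_eventually_le_div_sq (eventually_norm_jumpCoeff_le ht hT)).1
    (integral_jump hT) hu
  · unfold ee
    fun_prop
  · have hE := one_sub_exp_neg_ne_zero hT
    have h1 : ee ((t * (1 / 2) : ℝ) : ℂ) = Real.cos (π * t) + Real.sin (π * t) * I := by
      rw [← exp_pi_mul_I_eq, ee]
      congr 1
      push_cast
      ring
    have h2 : ee ((t * (-1 / 2) : ℝ) : ℂ) = Real.cos (π * t) - Real.sin (π * t) * I := by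
      have h3 := exp_pi_mul_I_eq (-t)
      rw [mul_neg, Real.cos_neg, Real.sin_neg] at h3
      rw [sub_eq_add_neg, ← neg_mul, ← Complex.ofReal_neg, ← h3, ee]
      congr 1
      push_cast
      ring
    have key : jumpSize t T * (1 - Real.exp (-(2 * π * T))) = -2 * I * Real.sin (π * t) :=
      div_mul_cancel₀ _ hE
    rw [h1, h2, show (-(2 * π * T) * (-1 / 2 + 1 / 2) : ℝ) = 0 by ring,
      show (-(2 * π * T) * (1 / 2 + 1 / 2) : ℝ) = -(2 * π * T) by ring, Real.exp_zero]
    rw [Complex.ofReal_one]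
    linear_combination -key

lemma summable_one_div_sq_add_sq {r : ℝ} (hr : 0 < r) :
    Summable fun m : ℤ => 1 / (r ^ 2 + (m : ℝ) ^ 2) := by
  refine Summable.of_norm_bounded_eventually (Real.summable_one_div_int_pow.mpr one_lt_two) ?_
  filter_upwards [(Set.finite_singleton (0 : ℤ)).compl_mem_cofinite] with m hm
  have hm0 : (m : ℝ) ≠ 0 := by simpa using hm
  rw [Real.norm_of_nonneg (by positivity)]
  exact one_div_le_one_div_of_le (by positivity) (by linarith [sq_pos_of_pos hr])

lemma hasSum_neg_one_zpow_div {r : ℝ} (hr : 0 < r) :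
    HasSum (fun m : ℤ => (-1 : ℂ) ^ m / (r ^ 2 + (m : ℂ) ^ 2)) (π / (r * Real.sinh (π * r)) : ℝ) := by
  have hpi : (π : ℂ) ≠ 0 := by exact_mod_cast Real.pi_ne_zero
  have hrc : (r : ℂ) ≠ 0 := by exact_mod_cast hr.ne'
  have hsinh : Real.sinh (π * r) ≠ 0 := (Real.sinh_pos_iff.mpr (mul_pos Real.pi_pos hr)).ne'
  have hsinhc : (Real.sinh (π * r) : ℂ) ≠ 0 := by exact_mod_cast hsinh
  have hden : ∀ m : ℤ, (r ^ 2 + (m : ℂ) ^ 2) ≠ 0 := by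
    intro m
    have : (0 : ℝ) < r ^ 2 + (m : ℝ) ^ 2 := by positivity
    exact_mod_cast this.ne'
  set c : ℤ → ℂ := fun m => r * Real.sinh (π * r) / π * ((-1 : ℂ) ^ m / (r ^ 2 + (m : ℂ) ^ 2)) with hc
  have hcs : Summable c := by
    refine Summable.mul_left _ (Summable.of_norm ?_)
    refine (summable_one_div_sq_add_sq hr).congr fun m => ?_
    rw [norm_div, norm_zpow, norm_neg, norm_one, one_zpow]
    have h : (r ^ 2 + (m : ℂ) ^ 2) = ((r ^ 2 + (m : ℝ) ^ 2 : ℝ) : ℂ) := by push_cast; rfl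
    rw [h, Complex.norm_real, Real.norm_of_nonneg (by positivity)]
  have hs : Complex.exp (π * r) - Complex.exp (-(π * r)) = 2 * Real.sinh (π * r) := by
    push_cast
    rw [Complex.sinh]
    ring
  have hcoeff : ∀ m : ℤ, ∫ u in (-1 / 2 : ℝ)..(1 / 2), ee (-(m * u)) *
      ((Complex.exp (2 * π * r * u) + Complex.exp (-(2 * π * r) * u)) / 2) = c m := by
    intro m
    have h_int : ∀ α : ℂ, IntervalIntegrable (fun u : ℝ => ee (-(m * u)) * Complex.exp (α * u) / 2)
        volume (-1 / 2) (1 / 2) := by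
      intro α
      refine Continuous.intervalIntegrable ?_ _ _
      unfold ee
      fun_prop
    have hre : ∀ x : ℝ, x ≠ 0 → (2 * π * x : ℂ) ≠ 2 * π * I * m := by
      intro x hx h
      have := congrArg Complex.re h
      simp at this
      exact hx this
    have h1 := integral_ee_mul_exp m (2 * π * r) (hre r hr.ne')
    have h2 := integral_ee_mul_exp m (-(2 * π * r)) (by
      have := hre (-r) (neg_ne_zero.mpr hr.ne')
      push_cast at this
      rwa [mul_neg] at this)
    simp_rw [add_div, mul_add, ← mul_div_assoc]
    rw [intervalIntegral.integral_add (h_int _) (h_int _), intervalIntegral.integral_div,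
      intervalIntegral.integral_div, h1, h2, hc]
    have e1 : (2 * π * r / 2 : ℂ) = π * r := by ring
    have e2 : (-(2 * π * r) / 2 : ℂ) = -(π * r) := by ring
    rw [e1, e2, neg_neg, ← neg_sub (Complex.exp (π * r)), hs]
    have hp : (r : ℂ) - I * m ≠ 0 := by
      intro h
      have := congrArg Complex.re h
      simp at this
      exact hr.ne' this
    have hq : (r : ℂ) + I * m ≠ 0 := by
      intro h
      have := congrArg Complex.re h
      simp at this
      exact hr.ne' this
    have hd : (r ^ 2 + (m : ℂ) ^ 2) = (r - I * m) * (r + I * m) := by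
      linear_combination (m : ℂ) ^ 2 * I_sq
    have f1 : (2 * π * r - 2 * π * I * m : ℂ) = 2 * π * (r - I * m) := by ring
    have f2 : (-(2 * π * r) - 2 * π * I * m : ℂ) = -(2 * π * (r + I * m)) := by ring
    simp only
    rw [f1, f2, hd]
    field_simp
    ring
  have hmain := hasSum_fourier_of_summable (F := fun u : ℝ =>
    (Complex.exp (2 * π * r * u) + Complex.exp (-(2 * π * r) * u)) / 2) (by fun_prop) (by
      push_cast
      rw [show (2 * π * r * (-1 / 2) : ℂ) = -(2 * π * r) * (1 / 2) by ring,
        show (-(2 * π * r) * (-1 / 2) : ℂ) = 2 * π * r * (1 / 2) by ring, add_comm]) hcs hcoeff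
    (u := 0) (by norm_num)
  have h3 := hmain.mul_left ((π / (r * Real.sinh (π * r)) : ℝ) : ℂ)
  simp only [Complex.ofReal_zero, mul_zero, Complex.exp_zero, ee_zero, mul_one] at h3
  rw [show ((1 + 1) / 2 : ℂ) = 1 by norm_num, mul_one] at h3
  have he : ∀ m : ℤ, (-1 : ℂ) ^ m / (r ^ 2 + (m : ℂ) ^ 2)
      = ((π / (r * Real.sinh (π * r)) : ℝ) : ℂ) * c m := by
    intro m
    rw [hc, ← mul_assoc, Complex.ofReal_div, Complex.ofReal_mul,
      div_mul_div_cancel₀ (mul_ne_zero hrc hsinhc), div_self hpi, one_mul]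
  simp_rw [he]
  exact h3

lemma jumpCoeff_neg_sq {t : ℝ} (ht : 0 < t) (T : ℝ) (l : ℤ) :
    jumpCoeff t T (-l ^ 2) = (Real.sin (π * t) / π) * ((-1 : ℂ) ^ l / (t + (l : ℂ) ^ 2))
      * ((I * T - t) / (I * T + (l : ℂ) ^ 2)) := by
  have hne : ((-l ^ 2 : ℤ) : ℝ) ≠ t := by
    intro h
    push_cast at h
    have := sq_nonneg (l : ℝ)
    linarith
  have hpow : (-1 : ℂ) ^ (-l ^ 2 : ℤ) = (-1) ^ l := by
    rcases Int.even_or_odd l with h | h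
    · rw [h.neg_one_zpow, Even.neg_one_zpow]
      exact (h.pow_of_ne_zero two_ne_zero).neg
    · rw [h.neg_one_zpow, Odd.neg_one_zpow]
      exact h.pow.neg
  rw [jumpCoeff, if_neg hne, hpow]
  have e2 : (((-l ^ 2 : ℤ) : ℂ) - I * T) = -(I * T + (l : ℂ) ^ 2) := by push_cast; ring
  have e1 : ((t : ℂ) - ((-l ^ 2 : ℤ) : ℂ)) = t + (l : ℂ) ^ 2 := by push_cast; ring
  rw [e1, e2, ← neg_sub (I * (T : ℂ)) t, mul_neg, mul_neg, neg_div_neg_eq]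
  simp only [div_eq_mul_inv, mul_inv]
  ring

lemma norm_I_mul_sub_div_le {t T : ℝ} (ht : 0 < t) (hT : 1 ≤ T) (l : ℤ) :
    ‖(I * T - t) / (I * T + (l : ℂ) ^ 2)‖ ≤ 1 + t := by
  have h2 : ‖(I * T - t : ℂ)‖ ≤ T + t := by
    refine (norm_sub_le _ _).trans ?_
    rw [norm_mul, norm_I, one_mul, Complex.norm_real, Complex.norm_real, Real.norm_of_nonneg ht.le,
      Real.norm_of_nonneg (by linarith)]
  have h3 : T ≤ ‖(I * T + (l : ℂ) ^ 2 : ℂ)‖ := by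
    have h := Complex.abs_im_le_norm (I * T + (l : ℂ) ^ 2)
    have him : (I * T + (l : ℂ) ^ 2 : ℂ).im = T := by
      have : ((l : ℂ) ^ 2) = (((l : ℝ) ^ 2 : ℝ) : ℂ) := by push_cast; rfl
      rw [this]
      simp [-Complex.ofReal_pow]
    rw [him] at h
    exact (le_abs_self T).trans h
  rw [norm_div]
  calc _ ≤ (T + t) / T := div_le_div₀ (by linarith) h2 (by linarith) h3
    _ ≤ 1 + t := by
      rw [div_le_iff₀ (by linarith)]
      nlinarith

lemma tendsto_I_mul_sub_div (t : ℝ) (l : ℤ) :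
    Tendsto (fun T : ℝ => (I * T - t) / (I * T + (l : ℂ) ^ 2)) atTop (𝓝 1) := by
  have hinv : Tendsto (fun T : ℝ => ((T⁻¹ : ℝ) : ℂ)) atTop (𝓝 0) := by
    have := (Complex.continuous_ofReal.tendsto 0).comp (tendsto_inv_atTop_zero (𝕜 := ℝ))
    rwa [Complex.ofReal_zero] at this
  have h := ((tendsto_const_nhds (x := I)).sub (hinv.const_mul (t : ℂ))).div
    ((tendsto_const_nhds (x := I)).add (hinv.const_mul ((l : ℂ) ^ 2)))
    (by simp)
  rw [mul_zero, mul_zero, sub_zero, add_zero, div_self I_ne_zero] at h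
  refine h.congr' ?_
  filter_upwards [eventually_gt_atTop 0] with T hT
  have hTc : (T : ℂ) ≠ 0 := by exact_mod_cast hT.ne'
  change (I - t * ((T⁻¹ : ℝ) : ℂ)) / (I + (l : ℂ) ^ 2 * ((T⁻¹ : ℝ) : ℂ)) = _
  rw [← mul_div_mul_right _ _ hTc]
  push_cast
  congr 1
  · rw [sub_mul, mul_assoc, inv_mul_cancel₀ hTc, mul_one]
  · rw [add_mul, mul_assoc, inv_mul_cancel₀ hTc, mul_one]

lemma tendsto_tsum_jumpCoeff {r : ℝ} (hr : 0 < r) :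
    Tendsto (fun T : ℝ => ∑' l : ℤ, jumpCoeff (r ^ 2) T (-l ^ 2)) atTop
      (𝓝 ((Real.sin (π * r ^ 2) / (r * Real.sinh (π * r)) : ℝ) : ℂ)) := by
  have ht : 0 < r ^ 2 := by positivity
  have hval : ∑' l : ℤ, ((Real.sin (π * r ^ 2) / π : ℝ) : ℂ)
      * ((-1 : ℂ) ^ l / (r ^ 2 + (l : ℂ) ^ 2))
      = ((Real.sin (π * r ^ 2) / (r * Real.sinh (π * r)) : ℝ) : ℂ) := by
    rw [((hasSum_neg_one_zpow_div hr).mul_left _).tsum_eq, ← Complex.ofReal_mul]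
    congr 1
    have := Real.pi_ne_zero
    field_simp
  rw [← hval]
  refine tendsto_tsum_of_dominated_convergence (bound := fun l : ℤ =>
    |Real.sin (π * r ^ 2) / π| * (1 / (r ^ 2 + (l : ℝ) ^ 2)) * (1 + r ^ 2))
    (((summable_one_div_sq_add_sq hr).mul_left _).mul_right _) (fun l => ?_) ?_
  · simp_rw [jumpCoeff_neg_sq ht]
    have h := (tendsto_I_mul_sub_div (r ^ 2) l).const_mul
      ((Real.sin (π * r ^ 2) / π) * ((-1 : ℂ) ^ l / (((r ^ 2 : ℝ) : ℂ) + (l : ℂ) ^ 2)))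
    rw [mul_one] at h
    push_cast at h ⊢
    exact h
  · filter_upwards [eventually_ge_atTop 1] with T hT l
    rw [jumpCoeff_neg_sq ht, norm_mul, norm_mul]
    refine mul_le_mul (le_of_eq ?_) (norm_I_mul_sub_div_le ht hT l) (norm_nonneg _) (by positivity)
    congr 1
    · rw [← Complex.ofReal_div, Complex.norm_real, Real.norm_eq_abs]
    · have h : (((r ^ 2 : ℝ) : ℂ) + (l : ℂ) ^ 2) = ((r ^ 2 + (l : ℝ) ^ 2 : ℝ) : ℂ) := by
        push_cast; rfl
      rw [norm_div, norm_zpow, norm_neg, norm_one, one_zpow, h, Complex.norm_real,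
        Real.norm_of_nonneg (by positivity)]

lemma norm_sq_mul_norm_tsum_mul_pow_le {ψ : ℕ → ℝ} {z : ℂ} (hψ : Summable ψ) (hz : ‖z‖ = 1)
    {b : ℕ → ℝ} (hb : Summable b) (hψb : ∀ p, |ψ (p + 2) - 2 * ψ (p + 1) + ψ p| ≤ b p) :
    ‖1 - z‖ ^ 2 * ‖∑' p, (ψ p : ℂ) * z ^ p‖ ≤ 3 * |ψ 0| + |ψ 1| + ∑' p, b p := by
  have hsum : ∀ k, Summable fun p => (ψ (p + k) : ℂ) * z ^ p := fun k => by
    refine Summable.of_norm ?_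
    simpa [hz] using ((summable_nat_add_iff k).mpr hψ).abs
  have hsum0 : Summable fun p => (ψ p : ℂ) * z ^ p := hsum 0
  have e0 : ∑' p, (ψ p : ℂ) * z ^ p = ψ 0 + ψ 1 * z + z ^ 2 * ∑' p, (ψ (p + 2) : ℂ) * z ^ p := by
    rw [← hsum0.sum_add_tsum_nat_add 2, Finset.sum_range_succ, Finset.sum_range_one,
      ← tsum_mul_left]
    simp only [pow_zero, mul_one, pow_one, pow_add]
    congr 1
    exact tsum_congr fun p => by ring
  have e1 : ∑' p, (ψ p : ℂ) * z ^ p = ψ 0 + z * ∑' p, (ψ (p + 1) : ℂ) * z ^ p := by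
    rw [← hsum0.sum_add_tsum_nat_add 1, Finset.sum_range_one, ← tsum_mul_left]
    simp only [pow_zero, mul_one, pow_add]
    congr 1
    exact tsum_congr fun p => by ring
  have key : (1 - z) ^ 2 * ∑' p, (ψ p : ℂ) * z ^ p = ψ 0 + (ψ 1 - 2 * ψ 0) * z
      + z ^ 2 * ∑' p, ((ψ (p + 2) - 2 * ψ (p + 1) + ψ p : ℝ) : ℂ) * z ^ p := by
    have e2 : ∑' p, ((ψ (p + 2) - 2 * ψ (p + 1) + ψ p : ℝ) : ℂ) * z ^ p
        = ∑' p, (ψ (p + 2) : ℂ) * z ^ p - 2 * ∑' p, (ψ (p + 1) : ℂ) * z ^ p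
          + ∑' p, (ψ p : ℂ) * z ^ p := by
      rw [← tsum_mul_left, ← (hsum 2).tsum_sub ((hsum 1).mul_left 2),
        ← ((hsum 2).sub ((hsum 1).mul_left 2)).tsum_add hsum0]
      refine tsum_congr fun p => ?_
      push_cast
      ring
    rw [e2]
    linear_combination e0 - 2 * z * e1
  have hbound : ‖∑' p, ((ψ (p + 2) - 2 * ψ (p + 1) + ψ p : ℝ) : ℂ) * z ^ p‖ ≤ ∑' p, b p :=
    tsum_of_norm_bounded hb.hasSum fun p => by
      rw [norm_mul, norm_pow, hz, one_pow, mul_one, Complex.norm_real]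
      exact hψb p
  calc ‖1 - z‖ ^ 2 * ‖∑' p, (ψ p : ℂ) * z ^ p‖
      = ‖(1 - z) ^ 2 * ∑' p, (ψ p : ℂ) * z ^ p‖ := by rw [norm_mul, norm_pow]
    _ ≤ ‖(ψ 0 : ℂ)‖ + (‖(ψ 1 : ℂ)‖ + 2 * ‖(ψ 0 : ℂ)‖) + ∑' p, b p := by
        rw [key]
        refine (norm_add_le _ _).trans (add_le_add ((norm_add_le _ _).trans
          (add_le_add le_rfl ?_)) ?_)
        · rw [norm_mul, hz, mul_one]
          exact (norm_sub_le _ _).trans (by simp)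
        · rwa [norm_mul, norm_pow, hz, one_pow, one_mul]
    _ = _ := by simp only [Complex.norm_real, Real.norm_eq_abs]; ring

def expWeight (μ B x : ℝ) : ℝ := x ^ (-μ) * Real.exp (-(B / x))

lemma expWeight_nonneg (μ B : ℝ) {x : ℝ} (hx : 0 ≤ x) : 0 ≤ expWeight μ B x :=
  mul_nonneg (Real.rpow_nonneg hx _) (Real.exp_pos _).le

lemma rpow_neg_mul_exp_le {μ B x : ℝ} (hμ0 : 0 ≤ μ) (hμ : μ ≤ 2) (hB : 0 < B) (hx : 0 < x) :
    (1 + B / x) ^ 4 * expWeight μ B x ≤ 1960 * B ^ (-μ) := by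
  have hy : 0 < B / x := div_pos hB hx
  have h1 : x ^ (-μ) = B ^ (-μ) * (B / x) ^ μ := by
    rw [Real.div_rpow hB.le hx.le, Real.rpow_neg hB.le, Real.rpow_neg hx.le]
    have := (Real.rpow_pos_of_pos hB μ).ne'
    field_simp
  have h2 : (B / x) ^ μ ≤ (1 + B / x) ^ 2 := by
    calc (B / x) ^ μ ≤ (1 + B / x) ^ μ := Real.rpow_le_rpow hy.le (by linarith) hμ0
      _ ≤ (1 + B / x) ^ (2 : ℝ) := Real.rpow_le_rpow_of_exponent_le (by linarith) hμ
      _ = _ := by norm_cast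
  have h3 : (1 + B / x) ^ 6 * Real.exp (-(B / x)) ≤ 1960 := by
    have h := Real.pow_div_factorial_le_exp (1 + B / x) (by linarith) 6
    rw [show ((Nat.factorial 6 : ℕ) : ℝ) = 720 by norm_num [Nat.factorial], div_le_iff₀ (by norm_num)] at h
    calc (1 + B / x) ^ 6 * Real.exp (-(B / x))
        ≤ Real.exp (1 + B / x) * 720 * Real.exp (-(B / x)) :=
          mul_le_mul_of_nonneg_right h (Real.exp_pos _).le
      _ = Real.exp 1 * 720 := by
          rw [mul_right_comm, ← Real.exp_add]; congr 2; ring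
      _ ≤ 1960 := by linarith [Real.exp_one_lt_d9]
  rw [expWeight, h1]
  calc (1 + B / x) ^ 4 * (B ^ (-μ) * (B / x) ^ μ * Real.exp (-(B / x)))
      = B ^ (-μ) * ((1 + B / x) ^ 4 * Real.exp (-(B / x))) * (B / x) ^ μ := by ring
    _ ≤ B ^ (-μ) * ((1 + B / x) ^ 4 * Real.exp (-(B / x))) * (1 + B / x) ^ 2 :=
        mul_le_mul_of_nonneg_left h2 (by positivity)
    _ = B ^ (-μ) * ((1 + B / x) ^ 6 * Real.exp (-(B / x))) := by ring
    _ ≤ B ^ (-μ) * 1960 := mul_le_mul_of_nonneg_left h3 (by positivity)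
    _ = _ := mul_comm _ _

lemma expWeight_le {μ B x : ℝ} (hμ0 : 0 ≤ μ) (hμ : μ ≤ 2) (hB : 0 < B) (hx : 0 < x) :
    expWeight μ B x ≤ 1960 * B ^ (-μ) * (x ^ 2 / B ^ 2) := by
  have h := rpow_neg_mul_exp_le hμ0 hμ hB hx
  have hw := expWeight_nonneg μ B hx.le
  have hy : 0 < B / x := div_pos hB hx
  have h4 : (B / x) ^ 2 ≤ (1 + B / x) ^ 4 := by
    calc (B / x) ^ 2 ≤ (1 + B / x) ^ 2 := by gcongr; linarith
      _ ≤ _ := pow_le_pow_right₀ (by linarith) (by norm_num)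
  have h5 := (mul_le_mul_of_nonneg_right h4 hw).trans h
  calc expWeight μ B x = (B / x) ^ 2 * expWeight μ B x * (x ^ 2 / B ^ 2) := by field_simp
    _ ≤ _ := mul_le_mul_of_nonneg_right h5 (by positivity)

def expWeightDeriv (μ B x : ℝ) : ℝ := (B / x ^ 2 - μ / x) * expWeight μ B x

def expWeightDerivTwo (μ B x : ℝ) : ℝ :=
  (B ^ 2 / x ^ 4 - 2 * (μ + 1) * B / x ^ 3 + μ * (μ + 1) / x ^ 2) * expWeight μ B x

lemma hasDerivAt_expWeight (μ B : ℝ) {x : ℝ} (hx : 0 < x) :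
    HasDerivAt (expWeight μ B) (expWeightDeriv μ B x) x := by
  have h1 : HasDerivAt (fun x : ℝ => x ^ (-μ)) (-μ * x ^ (-μ - 1)) x :=
    Real.hasDerivAt_rpow_const (Or.inl hx.ne')
  have h2 : HasDerivAt (fun x : ℝ => -(B / x)) (B / x ^ 2) x := by
    have := ((hasDerivAt_inv hx.ne').const_mul B).neg
    simp only [div_eq_mul_inv]
    refine this.congr_deriv ?_
    field_simp
  refine (h1.mul h2.exp).congr_deriv ?_
  rw [expWeightDeriv, expWeight, Real.rpow_sub_one hx.ne']
  field_simp
  ring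

lemma hasDerivAt_expWeightDeriv (μ B : ℝ) {x : ℝ} (hx : 0 < x) :
    HasDerivAt (expWeightDeriv μ B) (expWeightDerivTwo μ B x) x := by
  have h1 : HasDerivAt (fun x : ℝ => B / x ^ 2 - μ / x) (-2 * B / x ^ 3 + μ / x ^ 2) x := by
    have ha := ((hasDerivAt_pow 2 x).inv (pow_ne_zero 2 hx.ne')).const_mul B
    have hb := (hasDerivAt_inv hx.ne').const_mul μ
    have := ha.sub hb
    simp only [div_eq_mul_inv]
    refine this.congr_deriv ?_
    field_simp
    ring
  refine (h1.mul (hasDerivAt_expWeight μ B hx)).congr_deriv ?_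
  rw [expWeightDeriv, expWeightDerivTwo]
  field_simp
  ring

lemma abs_expWeightDerivTwo_le {μ B x : ℝ} (hμ0 : 0 ≤ μ) (hμ : μ ≤ 2) (hB : 0 < B) (hx : 0 < x) :
    |expWeightDerivTwo μ B x| ≤ 11760 * B ^ (-μ) / (x + B) ^ 2 := by
  have h := rpow_neg_mul_exp_le hμ0 hμ hB hx
  have hw := expWeight_nonneg μ B hx.le
  have hfac : |B ^ 2 / x ^ 4 - 2 * (μ + 1) * B / x ^ 3 + μ * (μ + 1) / x ^ 2|
      ≤ 6 * (1 + B / x) ^ 4 / (x + B) ^ 2 := by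
    set y := B / x with hy
    have hy0 : 0 < y := div_pos hB hx
    have e1 : B ^ 2 / x ^ 4 - 2 * (μ + 1) * B / x ^ 3 + μ * (μ + 1) / x ^ 2
        = (y ^ 2 - 2 * (μ + 1) * y + μ * (μ + 1)) / x ^ 2 := by
      rw [hy]; field_simp
    have e2 : 6 * (1 + y) ^ 4 / (x + B) ^ 2 = 6 * (1 + y) ^ 2 / x ^ 2 := by
      have : x + B = x * (1 + y) := by rw [hy]; field_simp
      rw [this]
      field_simp
    rw [e1, e2, abs_div, abs_of_nonneg (sq_nonneg x)]
    refine div_le_div_of_nonneg_right (abs_le.mpr ⟨?_, ?_⟩) (sq_nonneg x)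
    · nlinarith [mul_nonneg hμ0 hy0.le, mul_nonneg (sub_nonneg.mpr hμ) hy0.le, mul_nonneg hμ0 hμ0]
    · nlinarith [mul_nonneg hμ0 hy0.le, mul_nonneg hμ0 (sub_nonneg.mpr hμ)]
  rw [expWeightDerivTwo, abs_mul, abs_of_nonneg hw]
  calc _ ≤ 6 * (1 + B / x) ^ 4 / (x + B) ^ 2 * expWeight μ B x :=
        mul_le_mul_of_nonneg_right hfac hw
    _ = 6 * ((1 + B / x) ^ 4 * expWeight μ B x) / (x + B) ^ 2 := by ring
    _ ≤ 6 * (1960 * B ^ (-μ)) / (x + B) ^ 2 := by gcongr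
    _ = _ := by ring

lemma abs_second_difference_expWeight_le {μ B x : ℝ} (hμ0 : 0 ≤ μ) (hμ : μ ≤ 2) (hB : 0 < B)
    (hx : 0 < x) :
    |expWeight μ B (x + 4) - 2 * expWeight μ B (x + 2) + expWeight μ B x|
      ≤ 47040 * B ^ (-μ) / (x + B) ^ 2 := by
  set K := 11760 * B ^ (-μ) / (x + B) ^ 2 with hK
  have hb : ∀ y ∈ Set.Ici x, ‖expWeightDerivTwo μ B y‖ ≤ K := fun y hy => by
    have hxy : x ≤ y := hy
    refine (abs_expWeightDerivTwo_le hμ0 hμ hB (hx.trans_le hxy)).trans ?_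
    rw [hK]
    gcongr
  have h1 : ∀ y ∈ Set.Ici x, ‖expWeightDeriv μ B (y + 2) - expWeightDeriv μ B y‖ ≤ K * 2 :=
    fun y hy => by
      have hxy : x ≤ y := hy
      have := (convex_Ici x).norm_image_sub_le_of_norm_hasDerivWithin_le
        (fun u hu => (hasDerivAt_expWeightDeriv μ B (hx.trans_le hu)).hasDerivWithinAt) hb hy
        (show y + 2 ∈ Set.Ici x from hxy.trans (by linarith))
      simpa using this
  have h2 := (convex_Ici x).norm_image_sub_le_of_norm_hasDerivWithin_le
    (f := fun y => expWeight μ B (y + 2) - expWeight μ B y)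
    (fun u (hu : x ≤ u) => (((hasDerivAt_expWeight μ B (x := u + 2)
      (by linarith)).comp_add_const u 2).sub
      (hasDerivAt_expWeight μ B (hx.trans_le hu))).hasDerivWithinAt) h1
    (Set.self_mem_Ici) (show x + 2 ∈ Set.Ici x from by simp)
  rw [Real.norm_eq_abs] at h2
  have e : expWeight μ B (x + 4) - 2 * expWeight μ B (x + 2) + expWeight μ B x
      = expWeight μ B (x + 2 + 2) - expWeight μ B (x + 2)
        - (expWeight μ B (x + 2) - expWeight μ B x) := by
    rw [show x + 2 + 2 = x + 4 by ring]; ring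
  rw [e]
  refine h2.trans (le_of_eq ?_)
  simp only [add_sub_cancel_left, Real.norm_ofNat]
  rw [hK]
  ring

lemma hasSum_telescope_inv {B : ℝ} (hB : 0 < B) :
    HasSum (fun p : ℕ => 1 / ((p : ℝ) + B) - 1 / ((p : ℝ) + 1 + B)) (1 / B) := by
  have hnn : ∀ p : ℕ, 0 ≤ 1 / ((p : ℝ) + B) - 1 / ((p : ℝ) + 1 + B) := fun p => by
    rw [sub_nonneg]
    exact one_div_le_one_div_of_le (by positivity) (by linarith)
  rw [hasSum_iff_tendsto_nat_of_nonneg hnn]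
  have e : ∀ n : ℕ, ∑ p ∈ Finset.range n, (1 / ((p : ℝ) + B) - 1 / ((p : ℝ) + 1 + B))
      = 1 / B - 1 / ((n : ℝ) + B) := fun n => by
    have := Finset.sum_range_sub' (fun p : ℕ => 1 / ((p : ℝ) + B)) n
    simpa using this
  simp only [e]
  have : Tendsto (fun n : ℕ => 1 / ((n : ℝ) + B)) atTop (𝓝 0) := by
    simp only [one_div]
    exact tendsto_inv_atTop_zero.comp
      (tendsto_atTop_add_const_right _ B tendsto_natCast_atTop_atTop)
  simpa using this.const_sub (1 / B)

lemma summable_expWeight {μ B : ℝ} (hμ : 1 < μ) (hB : 0 ≤ B) {k : ℕ} (hk : 0 < k) :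
    Summable fun p : ℕ => expWeight μ B (k + 2 * p) := by
  have h := (summable_nat_add_iff 1).mpr (Real.summable_nat_rpow_inv.mpr hμ)
  refine Summable.of_nonneg_of_le (fun p => expWeight_nonneg μ B (by positivity)) (fun p => ?_) h
  have h1 : (1 : ℝ) ≤ k := by exact_mod_cast hk
  have hexp : Real.exp (-(B / (k + 2 * p))) ≤ 1 := Real.exp_le_one_iff.mpr (by
    have : 0 ≤ B / (k + 2 * (p : ℝ)) := by positivity
    linarith)
  calc expWeight μ B (k + 2 * p) ≤ ((k : ℝ) + 2 * p) ^ (-μ) * 1 :=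
        mul_le_mul_of_nonneg_left hexp (by positivity)
    _ ≤ ((p + 1 : ℕ) : ℝ) ^ (-μ) := by
        rw [mul_one]
        refine Real.rpow_le_rpow_of_nonpos (by positivity) ?_ (by linarith)
        push_cast
        linarith [(Nat.cast_nonneg p : (0 : ℝ) ≤ p)]
    _ = _ := Real.rpow_neg (by positivity) _

lemma norm_sq_mul_norm_tsum_expWeight_le {μ B : ℝ} (hμ1 : 1 < μ) (hμ : μ ≤ 2) (hB : 1 ≤ B)
    {k : ℕ} (hk : 0 < k) (hk2 : k ≤ 2) {z : ℂ} (hz : ‖z‖ = 1) :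
    ‖1 - z‖ ^ 2 * ‖∑' p : ℕ, (expWeight μ B (k + 2 * p) : ℂ) * z ^ p‖
      ≤ 200000 * (B ^ (-μ) / B) := by
  have hB0 : 0 < B := by linarith
  have hk1 : (1 : ℝ) ≤ k := by exact_mod_cast hk
  have hk2r : (k : ℝ) ≤ 2 := by exact_mod_cast hk2
  have hμ0 : 0 ≤ μ := by linarith
  have hBμ : 0 < B ^ (-μ) := Real.rpow_pos_of_pos hB0 _
  have htel := (hasSum_telescope_inv hB0).mul_left (47040 * B ^ (-μ))
  have hval : ∀ x : ℝ, 0 < x → x ≤ 4 → |expWeight μ B x| ≤ 31360 * (B ^ (-μ) / B) := fun x hx hx4 => by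
    rw [abs_of_nonneg (expWeight_nonneg μ B hx.le)]
    refine (expWeight_le hμ0 hμ hB0 hx).trans ?_
    have : x ^ 2 / B ^ 2 ≤ 16 / B := by
      rw [div_le_div_iff₀ (by positivity) hB0]
      nlinarith [mul_nonneg hB0.le (sub_nonneg.mpr hB), mul_self_le_mul_self hx.le hx4]
    calc _ ≤ 1960 * B ^ (-μ) * (16 / B) := by gcongr
      _ = _ := by ring
  have h := norm_sq_mul_norm_tsum_mul_pow_le (ψ := fun p : ℕ => expWeight μ B (k + 2 * p))
    (summable_expWeight hμ1 hB0.le hk) hz htel.summable (fun p => ?_)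
  · rw [htel.tsum_eq] at h
    refine h.trans ?_
    have h0 := hval (k + 2 * (0 : ℕ)) (by positivity) (by push_cast; linarith)
    have h1 := hval (k + 2 * (1 : ℕ)) (by positivity) (by push_cast; linarith)
    calc _ ≤ 3 * (31360 * (B ^ (-μ) / B)) + 31360 * (B ^ (-μ) / B)
          + 47040 * B ^ (-μ) * (1 / B) := by gcongr
      _ ≤ _ := by
        have : 0 < B ^ (-μ) / B := by positivity
        have e : 47040 * B ^ (-μ) * (1 / B) = 47040 * (B ^ (-μ) / B) := by ring
        rw [e]
        linarith
  · have hx : 0 < (k : ℝ) + 2 * p := by positivity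
    have h2 := abs_second_difference_expWeight_le hμ0 hμ hB0 hx
    have e1 : (k : ℝ) + 2 * ((p + 2 : ℕ) : ℝ) = k + 2 * p + 4 := by push_cast; ring
    have e2 : (k : ℝ) + 2 * ((p + 1 : ℕ) : ℝ) = k + 2 * p + 2 := by push_cast; ring
    simp only [e1, e2]
    refine h2.trans ?_
    rw [div_eq_mul_one_div]
    refine mul_le_mul_of_nonneg_left ?_ (by positivity)
    have hp : (0 : ℝ) ≤ p := Nat.cast_nonneg p
    rw [div_sub_div _ _ (by positivity) (by positivity)]
    rw [div_le_div_iff₀ (by positivity) (by positivity)]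
    nlinarith [mul_nonneg hp hB0.le]

lemma four_mul_abs_le_norm_one_sub_ee {θ : ℝ} (hθ : |θ| ≤ 1 / 2) : 4 * |θ| ≤ ‖1 - ee θ‖ := by
  have hpi := Real.pi_pos
  have e : ‖1 - ee θ‖ = 2 * |Real.sin (π * θ)| := by
    have := Complex.norm_exp_I_mul_ofReal_sub_one (2 * π * θ)
    rw [norm_sub_rev, ee, show 2 * (π : ℂ) * I * θ = I * ((2 * π * θ : ℝ) : ℂ) by push_cast; ring,
      this, Real.norm_eq_abs, abs_mul, abs_two]
    congr 3
    ring
  have h1 : |Real.sin (π * θ)| = Real.sin (π * |θ|) := by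
    rcases abs_cases θ with ⟨h, h0⟩ | ⟨h, h0⟩
    · rw [h, abs_of_nonneg (Real.sin_nonneg_of_nonneg_of_le_pi (by positivity)
        (by nlinarith [(abs_le.mp hθ).2]))]
    · rw [h, mul_neg, Real.sin_neg, abs_of_nonpos]
      exact Real.sin_nonpos_of_nonpos_of_neg_pi_le (by nlinarith) (by nlinarith [(abs_le.mp hθ).1])
  have h2 := Real.mul_le_sin (x := π * |θ|) (by positivity) (by nlinarith)
  rw [e, h1]
  have h3 : 2 / π * (π * |θ|) = 2 * |θ| := by field_simp
  linarith

lemma dvd_sq_add_bmod (k x : ℕ) : (k : ℤ) ∣ (x : ℤ) ^ 2 + Int.bmod (-(x : ℤ) ^ 2) k := by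
  have : (k : ℤ) ∣ _ := Int.dvd_bmod_sub_self (x := -(x : ℤ) ^ 2) (m := k)
  simpa [add_comm] using this

lemma two_mul_abs_bmod_le {k : ℕ} (hk : 0 < k) (a : ℤ) : 2 * |Int.bmod a k| ≤ k := by
  have h1 := Int.le_bmod (x := a) hk
  have h2 := Int.bmod_le (x := a) hk
  rcases abs_cases (Int.bmod a k) with ⟨h, _⟩ | ⟨h, _⟩ <;> omega

lemma abs_bmod_div_le_norm_one_sub_ee {k : ℕ} (hk : 0 < k) (x : ℕ) :
    |((Int.bmod (-(x : ℤ) ^ 2) k : ℤ) : ℝ)| / k ≤ ‖1 - ee ((x : ℂ) ^ 2 / k)‖ := by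
  set m := Int.bmod (-(x : ℤ) ^ 2) k with hm
  have hkr : (0 : ℝ) < k := by exact_mod_cast hk
  have hkc : (k : ℂ) ≠ 0 := by exact_mod_cast hk.ne'
  obtain ⟨n, hn⟩ := dvd_sq_add_bmod k x
  rw [← hm] at hn
  have hnc : (x : ℂ) ^ 2 + m = k * n := by exact_mod_cast hn
  have h1 : ee ((x : ℂ) ^ 2 / k) = ee ((-(m / k) : ℝ) : ℂ) := by
    refine ee_eq_of_sub_intCast n ?_
    push_cast
    field_simp
    linear_combination hnc
  have h2 : 2 * |(m : ℝ)| ≤ k := by exact_mod_cast two_mul_abs_bmod_le hk _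
  have h3 : |-((m : ℝ) / k)| = |(m : ℝ)| / k := by rw [abs_neg, abs_div, abs_of_pos hkr]
  have h4 : |-((m : ℝ) / k)| ≤ 1 / 2 := by
    rw [h3, div_le_div_iff₀ hkr two_pos]
    linarith
  have h5 := four_mul_abs_le_norm_one_sub_ee h4
  rw [h1]
  rw [h3] at h5
  have : 0 ≤ |(m : ℝ)| / k := by positivity
  linarith

def sqDivSeries (σ : ℝ) : ℝ := ∑' m : ℤ, sqDivSum m / |(m : ℝ)| ^ σ

lemma sqDivSeries_nonneg (σ : ℝ) : 0 ≤ sqDivSeries σ :=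
  tsum_nonneg fun m => div_nonneg (sqDivSum_nonneg m) (by positivity)

lemma sum_one_div_abs_bmod_le {σ : ℝ} (hσ : 1 < σ) (k : ℕ) :
    ∑ x ∈ Finset.range k, 1 / |((Int.bmod (-(x : ℤ) ^ 2) k : ℤ) : ℝ)| ^ σ
      ≤ k.divisors.card * sqDivSeries σ := by
  have hσ0 : σ ≠ 0 := by linarith
  rw [Finset.sum_comp (fun m : ℤ => 1 / |(m : ℝ)| ^ σ) (fun x : ℕ => Int.bmod (-(x : ℤ) ^ 2) k)]
  calc _ ≤ ∑ m ∈ (Finset.range k).image fun x : ℕ => Int.bmod (-(x : ℤ) ^ 2) k,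
        k.divisors.card * (sqDivSum m / |(m : ℝ)| ^ σ) := by
        refine Finset.sum_le_sum fun m _ => ?_
        rcases eq_or_ne m 0 with rfl | hm
        · simp [Real.zero_rpow hσ0]
        have hcard : ((Finset.range k).filter fun x : ℕ => Int.bmod (-(x : ℤ) ^ 2) k = m).card
            ≤ sqCount m k := by
          refine Finset.card_le_card fun x hx => ?_
          rw [Finset.mem_filter] at hx ⊢
          exact ⟨hx.1, hx.2 ▸ dvd_sq_add_bmod k x⟩
        have h := (Nat.cast_le (α := ℝ).mpr hcard).trans (sqCount_le hm k)
        rw [nsmul_eq_mul]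
        calc _ ≤ sqDivSum m * k.divisors.card * (1 / |(m : ℝ)| ^ σ) :=
              mul_le_mul_of_nonneg_right h (by positivity)
          _ = _ := by ring
    _ ≤ _ := by
        rw [← Finset.mul_sum]
        refine mul_le_mul_of_nonneg_left ?_ (Nat.cast_nonneg _)
        exact (summable_sqDivSum hσ).sum_le_tsum _
          fun m _ => div_nonneg (sqDivSum_nonneg m) (by positivity)

lemma ee_sq_div_eq_one_iff {k : ℕ} (hk : 0 < k) (x : ℕ) :
    ee ((x : ℂ) ^ 2 / k) = 1 ↔ (k : ℤ) ∣ (x : ℤ) ^ 2 := by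
  have hkc : (k : ℂ) ≠ 0 := by exact_mod_cast hk.ne'
  rw [ee_eq_one_iff]
  constructor
  · rintro ⟨n, hn⟩
    refine ⟨n, ?_⟩
    rw [div_eq_iff hkc] at hn
    have : (x : ℂ) ^ 2 = k * n := by rw [hn, mul_comm]
    exact_mod_cast this
  · rintro ⟨n, hn⟩
    refine ⟨n, ?_⟩
    rw [div_eq_iff hkc, mul_comm]
    exact_mod_cast hn

lemma one_div_norm_one_sub_ee_rpow_le {σ : ℝ} (hσ : 0 < σ) {k : ℕ} (hk : 0 < k) (x : ℕ) :
    1 / ‖1 - ee ((x : ℂ) ^ 2 / k)‖ ^ σ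
      ≤ (k : ℝ) ^ σ * (1 / |((Int.bmod (-(x : ℤ) ^ 2) k : ℤ) : ℝ)| ^ σ) := by
  have hkr : (0 : ℝ) < k := by exact_mod_cast hk
  by_cases h : (k : ℤ) ∣ (x : ℤ) ^ 2
  · rw [(ee_sq_div_eq_one_iff hk x).mpr h, sub_self, norm_zero, Real.zero_rpow hσ.ne', div_zero]
    positivity
  · have hm : Int.bmod (-(x : ℤ) ^ 2) k ≠ 0 := by
      intro h0
      have := dvd_sq_add_bmod k x
      rw [h0, add_zero] at this
      exact h this
    have hm' : 0 < |((Int.bmod (-(x : ℤ) ^ 2) k : ℤ) : ℝ)| := abs_pos.mpr (by exact_mod_cast hm)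
    have h1 := abs_bmod_div_le_norm_one_sub_ee hk x
    have h2 := Real.rpow_le_rpow (by positivity) h1 hσ.le
    rw [Real.div_rpow hm'.le hkr.le] at h2
    calc _ ≤ 1 / (|((Int.bmod (-(x : ℤ) ^ 2) k : ℤ) : ℝ)| ^ σ / (k : ℝ) ^ σ) :=
          one_div_le_one_div_of_le (by positivity) h2
      _ = _ := by
        have := Real.rpow_pos_of_pos hkr σ
        have := Real.rpow_pos_of_pos hm' σ
        field_simp

lemma sum_one_div_norm_one_sub_ee_rpow_le {σ : ℝ} (hσ : 1 < σ) {k : ℕ} (hk : 0 < k) :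
    ∑ x ∈ Finset.range k, 1 / ‖1 - ee ((x : ℂ) ^ 2 / k)‖ ^ σ
      ≤ (k : ℝ) ^ σ * (k.divisors.card * sqDivSeries σ) := by
  refine (Finset.sum_le_sum fun x _ => one_div_norm_one_sub_ee_rpow_le (by linarith) hk x).trans ?_
  rw [← Finset.mul_sum]
  exact mul_le_mul_of_nonneg_left (sum_one_div_abs_bmod_le hσ k) (by positivity)

lemma sum_one_div_norm_one_sub_ee_odd_le {j : ℕ} (hj : 0 < j) :
    ∑ n ∈ Finset.range j, 1 / ‖1 - ee (-((2 * n + 1 : ℂ) ^ 2 / (4 * j)))‖ ^ 2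
      ≤ 16 * (j : ℝ) ^ 2 * ((4 * j).divisors.card * sqDivSeries 2) := by
  have h := sum_one_div_norm_one_sub_ee_rpow_le (σ := 2) one_lt_two (k := 4 * j) (by omega)
  have e : ((4 * j : ℕ) : ℝ) ^ (2 : ℝ) = 16 * (j : ℝ) ^ 2 := by
    rw [Real.rpow_two]; push_cast; ring
  rw [e] at h
  refine le_trans ?_ h
  have hinj : Set.InjOn (fun n : ℕ => 2 * n + 1) (Finset.range j) := fun a _ b _ hab => by
    simpa using hab
  calc _ = ∑ n ∈ Finset.range j,
        1 / ‖1 - ee (((2 * n + 1 : ℕ) : ℂ) ^ 2 / ((4 * j : ℕ) : ℂ))‖ ^ (2 : ℝ) := by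
        refine Finset.sum_congr rfl fun n _ => ?_
        rw [Real.rpow_two]
        congr 2
        rw [← Complex.norm_conj, map_sub, map_one, conj_ee]
        congr 3
        simp [Complex.conj_ofNat]
    _ = ∑ x ∈ (Finset.range j).image fun n : ℕ => 2 * n + 1,
        1 / ‖1 - ee ((x : ℂ) ^ 2 / ((4 * j : ℕ) : ℂ))‖ ^ (2 : ℝ) :=
        (Finset.sum_image (f := fun x : ℕ => 1 / ‖1 - ee ((x : ℂ) ^ 2 / ((4 * j : ℕ) : ℂ))‖ ^ (2 : ℝ))
          hinj).symm
    _ ≤ _ := by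
        refine Finset.sum_le_sum_of_subset_of_nonneg ?_ fun x _ _ => by positivity
        intro x hx
        rw [Finset.mem_image] at hx
        obtain ⟨n, hn, rfl⟩ := hx
        rw [Finset.mem_range] at hn ⊢
        omega

def altTerm (T : ℝ) (j k : ℕ) : ℂ := (Real.exp (-(π * T * j / k)) : ℂ) * altGauss j k

def altPartial (T : ℝ) (J k : ℕ) : ℂ := ∑ i ∈ Finset.range J, altTerm T (2 * i + k % 2) k

lemma altPartial_self (T : ℝ) {k : ℕ} (hk : 0 < k) :
    altPartial T k k
      = gaussTransform (fun u => (Real.exp (-(2 * π * T) * (u + 1 / 2)) : ℂ)) k := by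
  rw [altPartial, gaussTransform, sum_centered _ k]
  refine Finset.sum_congr rfl fun i _ => ?_
  have h : ((2 * i + k % 2 : ℕ) : ℤ) = 2 * ((i : ℤ) - (k / 2 : ℕ)) + k := by omega
  generalize (i : ℤ) - ((k / 2 : ℕ) : ℤ) = a at h ⊢
  rw [altTerm, altGauss_eq_gsum _ k _ hk h]
  congr 3
  have hr : ((2 * i + k % 2 : ℕ) : ℝ) = 2 * (a : ℝ) + k := by
    generalize 2 * i + k % 2 = j at h
    exact_mod_cast h
  have hkr : (k : ℝ) ≠ 0 := by exact_mod_cast hk.ne'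
  rw [hr]
  field_simp

def geomRatio (T : ℝ) (k x : ℕ) : ℂ := (Real.exp (-(π * T / k)) : ℂ) * ee ((x : ℂ) ^ 2 / (2 * k))

lemma altTerm_eq (T : ℝ) (j k : ℕ) :
    altTerm T j k = ∑ x ∈ Finset.range k, (-1) ^ x * geomRatio T k x ^ j := by
  rw [altTerm, altGauss, Finset.mul_sum]
  refine Finset.sum_congr rfl fun x _ => ?_
  rw [geomRatio, mul_pow, ← ee_natCast_mul, ← Complex.ofReal_pow, ← Real.exp_nat_mul]
  rw [show (j : ℝ) * -(π * T / k) = -(π * T * j / k) by ring,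
    show (j : ℂ) * ((x : ℂ) ^ 2 / (2 * k)) = j * x ^ 2 / (2 * k) by ring]
  ring

lemma geomRatio_sq (T : ℝ) (k x : ℕ) :
    geomRatio T k x ^ 2 = (Real.exp (-(2 * π * T / k)) : ℂ) * ee ((x : ℂ) ^ 2 / k) := by
  rw [geomRatio, mul_pow, ← ee_natCast_mul, ← Complex.ofReal_pow, ← Real.exp_nat_mul]
  congr 2
  · push_cast; ring_nf
  · push_cast
    rcases eq_or_ne (k : ℂ) 0 with h | h
    · simp [h]
    · field_simp

lemma norm_ee_sq_div (x k : ℕ) : ‖ee ((x : ℂ) ^ 2 / k)‖ = 1 := by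
  have := norm_ee_ofReal ((x : ℝ) ^ 2 / k)
  push_cast at this
  exact this

lemma norm_geomRatio_sq (T : ℝ) (k x : ℕ) :
    ‖geomRatio T k x ^ 2‖ = Real.exp (-(2 * π * T / k)) := by
  rw [geomRatio_sq, norm_mul, norm_ee_sq_div, mul_one, Complex.norm_real,
    Real.norm_of_nonneg (Real.exp_pos _).le]

lemma norm_geomRatio_sq_lt_one {T : ℝ} (hT : 0 < T) {k : ℕ} (hk : 0 < k) (x : ℕ) :
    ‖geomRatio T k x ^ 2‖ < 1 := by
  rw [norm_geomRatio_sq, Real.exp_lt_one_iff]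
  have : 0 < 2 * π * T / k := by
    have : (0 : ℝ) < k := by exact_mod_cast hk
    have := Real.pi_pos
    positivity
  linarith

lemma norm_geomRatio_le_one {T : ℝ} (hT : 0 < T) {k : ℕ} (hk : 0 < k) (x : ℕ) :
    ‖geomRatio T k x‖ ≤ 1 := by
  have := (norm_geomRatio_sq_lt_one hT hk x).le
  rw [norm_pow] at this
  exact (pow_le_one_iff_of_nonneg (norm_nonneg _) two_ne_zero).mp this

lemma geomRatio_sq_ne_one {T : ℝ} (hT : 0 < T) {k : ℕ} (hk : 0 < k) (x : ℕ) :
    geomRatio T k x ^ 2 ≠ 1 := fun h => by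
  have := norm_geomRatio_sq_lt_one hT hk x
  rw [h, norm_one] at this
  exact lt_irrefl _ this

lemma altPartial_eq {T : ℝ} (hT : 0 < T) (J : ℕ) {k : ℕ} (hk : 0 < k) :
    altPartial T J k = ∑ x ∈ Finset.range k, (-1) ^ x * geomRatio T k x ^ (k % 2)
      * ((1 - (geomRatio T k x ^ 2) ^ J) / (1 - geomRatio T k x ^ 2)) := by
  simp only [altPartial, altTerm_eq]
  rw [Finset.sum_comm]
  refine Finset.sum_congr rfl fun x _ => ?_
  have h := geom_sum_eq (geomRatio_sq_ne_one hT hk x) J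
  rw [← neg_sub, ← neg_sub 1 (geomRatio T k x ^ 2), neg_div_neg_eq] at h
  rw [← h, Finset.mul_sum]
  refine Finset.sum_congr rfl fun i _ => ?_
  rw [pow_add, pow_mul]
  ring

lemma geomRatio_sq_pow_self (T : ℝ) {k : ℕ} (hk : 0 < k) (x : ℕ) :
    (geomRatio T k x ^ 2) ^ k = (Real.exp (-(2 * π * T)) : ℂ) := by
  have hkr : (k : ℝ) ≠ 0 := by exact_mod_cast hk.ne'
  have hkc : (k : ℂ) ≠ 0 := by exact_mod_cast hk.ne'
  rw [geomRatio_sq, mul_pow, ← ee_natCast_mul, ← Complex.ofReal_pow, ← Real.exp_nat_mul]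
  rw [show (k : ℂ) * ((x : ℂ) ^ 2 / k) = ((x ^ 2 : ℕ) : ℂ) by push_cast; field_simp, ee_natCast,
    mul_one]
  congr 2
  field_simp

lemma tendsto_altPartial {T : ℝ} (hT : 0 < T) {k : ℕ} (hk : 0 < k) :
    Tendsto (fun J => altPartial T J k) atTop
      (𝓝 (gaussTransform (fun u => (Real.exp (-(2 * π * T) * (u + 1 / 2)) : ℂ)) k
        / (1 - Real.exp (-(2 * π * T))))) := by
  have e : gaussTransform (fun u => (Real.exp (-(2 * π * T) * (u + 1 / 2)) : ℂ)) k
        / (1 - Real.exp (-(2 * π * T)))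
      = ∑ x ∈ Finset.range k, (-1) ^ x * geomRatio T k x ^ (k % 2)
        * ((1 - 0) / (1 - geomRatio T k x ^ 2)) := by
    rw [div_eq_iff (one_sub_exp_neg_ne_zero hT), ← altPartial_self T hk, altPartial_eq hT k hk,
      Finset.sum_mul]
    refine Finset.sum_congr rfl fun x _ => ?_
    rw [geomRatio_sq_pow_self T hk]
    ring
  rw [e]
  simp only [altPartial_eq hT _ hk]
  refine tendsto_finsetSum _ fun x _ => ?_
  exact (((tendsto_pow_atTop_nhds_zero_of_norm_lt_one
    (norm_geomRatio_sq_lt_one hT hk x)).const_sub 1).div_const _).const_mul _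

lemma half_norm_one_sub_le {z : ℂ} (hz : ‖z‖ = 1) {r : ℝ} (hr0 : 0 ≤ r) (hr1 : r ≤ 1) :
    ‖1 - z‖ / 2 ≤ ‖1 - r * z‖ := by
  have h1 : 1 - r ≤ ‖1 - r * z‖ := by
    have := norm_sub_norm_le 1 (r * z)
    rwa [norm_mul, hz, mul_one, norm_one, Complex.norm_real, Real.norm_of_nonneg hr0] at this
  have h2 : ‖1 - z‖ ≤ ‖1 - r * z‖ + (1 - r) := by
    have e : 1 - z = (1 - r * z) - ((1 - r : ℝ) : ℂ) * z := by push_cast; ring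
    have := norm_sub_le (1 - r * z) (((1 - r : ℝ) : ℂ) * z)
    rwa [← e, norm_mul, hz, mul_one, Complex.norm_real, Real.norm_of_nonneg (by linarith)] at this
  linarith

lemma one_div_norm_one_sub_geomRatio_sq_le {T : ℝ} (hT : 1 ≤ T) {k : ℕ} (hk : 0 < k) (x : ℕ)
    {σ : ℝ} (hσ1 : 1 < σ) (hσ2 : σ ≤ 2) :
    1 / ‖1 - geomRatio T k x ^ 2‖ ≤ (if (k : ℤ) ∣ (x : ℤ) ^ 2 + 0 then 2 * (k : ℝ) else 0)
      + 4 * (1 / ‖1 - ee ((x : ℂ) ^ 2 / k)‖ ^ σ) := by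
  have hpi := Real.pi_gt_three
  have hkr : (1 : ℝ) ≤ k := by exact_mod_cast hk
  have hy : 0 < 2 * π * T / k := by positivity
  rw [add_zero]
  split_ifs with h
  · have hz := (ee_sq_div_eq_one_iff hk x).mpr h
    have hlt : Real.exp (-(2 * π * T / k)) < 1 := Real.exp_lt_one_iff.mpr (by linarith)
    have e : ‖1 - geomRatio T k x ^ 2‖ = 1 - Real.exp (-(2 * π * T / k)) := by
      rw [geomRatio_sq, hz, mul_one, ← Complex.ofReal_one, ← Complex.ofReal_sub, Complex.norm_real,
        Real.norm_of_nonneg (by linarith)]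
    have h1 : 1 / (2 * (k : ℝ)) ≤ 1 - Real.exp (-(2 * π * T / k)) := by
      have h2 : Real.exp (-(2 * π * T / k)) ≤ 1 / (1 + 2 * π * T / k) := by
        rw [Real.exp_neg, ← one_div]
        exact one_div_le_one_div_of_le (by positivity)
          (by linarith [Real.add_one_le_exp (2 * π * T / k)])
      have h3 : 1 - 1 / (1 + 2 * π * T / k) = 2 * π * T / (k + 2 * π * T) := by
        field_simp
        ring
      have h4 : 1 / (2 * (k : ℝ)) ≤ 2 * π * T / (k + 2 * π * T) := by
        rw [div_le_div_iff₀ (by positivity) (by positivity)]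
        have : 1 ≤ 2 * π * T := by nlinarith
        nlinarith [mul_nonneg (sub_nonneg.mpr this) (sub_nonneg.mpr hkr)]
      linarith
    have h5 : 0 ≤ 4 * (1 / ‖1 - ee ((x : ℂ) ^ 2 / k)‖ ^ σ) := by positivity
    have h6 := one_div_le_one_div_of_le (by positivity) h1
    rw [one_div_one_div] at h6
    rw [e]
    linarith
  · have hz : ee ((x : ℂ) ^ 2 / k) ≠ 1 := fun hz => h ((ee_sq_div_eq_one_iff hk x).mp hz)
    set t := ‖1 - ee ((x : ℂ) ^ 2 / k)‖ with ht
    have ht0 : 0 < t := norm_pos_iff.mpr (sub_ne_zero.mpr hz.symm)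
    have ht2 : t ≤ 2 := by
      have := norm_sub_le (1 : ℂ) (ee ((x : ℂ) ^ 2 / k))
      rw [norm_ee_sq_div, norm_one] at this
      linarith
    have h1 : t / 2 ≤ ‖1 - geomRatio T k x ^ 2‖ := by
      rw [geomRatio_sq]
      exact half_norm_one_sub_le (norm_ee_sq_div x k) (Real.exp_pos _).le
        (Real.exp_le_one_iff.mpr (by linarith))
    have h2 : t ^ σ ≤ 2 * t := by
      rw [show σ = 1 + (σ - 1) by ring, Real.rpow_add ht0, Real.rpow_one, mul_comm]
      refine mul_le_mul_of_nonneg_right ?_ ht0.le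
      calc t ^ (σ - 1) ≤ 2 ^ (σ - 1) := Real.rpow_le_rpow ht0.le ht2 (by linarith)
        _ ≤ (2 : ℝ) ^ (1 : ℝ) := Real.rpow_le_rpow_of_exponent_le one_le_two (by linarith)
        _ = 2 := Real.rpow_one 2
    rw [zero_add]
    calc 1 / ‖1 - geomRatio T k x ^ 2‖ ≤ 1 / (t / 2) := one_div_le_one_div_of_le (by positivity) h1
      _ = 4 * (1 / (2 * t)) := by field_simp; norm_num
      _ ≤ _ := by gcongr

lemma norm_altPartial_le {T : ℝ} (hT : 1 ≤ T) (J : ℕ) {k : ℕ} (hk : 0 < k) {σ : ℝ} (hσ1 : 1 < σ)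
    (hσ2 : σ ≤ 2) :
    ‖altPartial T J k‖ ≤ 4 * k * sqCount 0 k
      + 8 * ((k : ℝ) ^ σ * (k.divisors.card * sqDivSeries σ)) := by
  have hT0 : 0 < T := by linarith
  rw [altPartial_eq hT0 J hk]
  have hterm : ∀ x ∈ Finset.range k, ‖(-1) ^ x * geomRatio T k x ^ (k % 2)
      * ((1 - (geomRatio T k x ^ 2) ^ J) / (1 - geomRatio T k x ^ 2))‖
      ≤ 2 * ((if (k : ℤ) ∣ (x : ℤ) ^ 2 + 0 then 2 * (k : ℝ) else 0)
      + 4 * (1 / ‖1 - ee ((x : ℂ) ^ 2 / k)‖ ^ σ)) := fun x _ => by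
    rw [norm_mul, norm_mul, norm_pow, norm_neg, norm_one, one_pow, one_mul, norm_pow, norm_div]
    have h1 := pow_le_one₀ (n := k % 2) (norm_nonneg _) (norm_geomRatio_le_one hT0 hk x)
    have h2 : ‖1 - (geomRatio T k x ^ 2) ^ J‖ ≤ 2 := by
      refine (norm_sub_le _ _).trans ?_
      rw [norm_one, norm_pow]
      linarith [pow_le_one₀ (n := J) (norm_nonneg _) (norm_geomRatio_sq_lt_one hT0 hk x).le]
    calc _ ≤ 1 * (2 / ‖1 - geomRatio T k x ^ 2‖) := by gcongr
      _ = 2 * (1 / ‖1 - geomRatio T k x ^ 2‖) := by ring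
      _ ≤ _ := mul_le_mul_of_nonneg_left
        (one_div_norm_one_sub_geomRatio_sq_le hT hk x hσ1 hσ2) zero_le_two
  refine (norm_sum_le _ _).trans ((Finset.sum_le_sum hterm).trans ?_)
  rw [← Finset.mul_sum, Finset.sum_add_distrib, ← Finset.mul_sum, ← Finset.sum_filter,
    Finset.sum_const, nsmul_eq_mul]
  have h := sum_one_div_norm_one_sub_ee_rpow_le hσ1 hk
  have e : (((Finset.range k).filter fun x : ℕ => (k : ℤ) ∣ (x : ℤ) ^ 2 + 0).card : ℝ)
      = sqCount 0 k := rfl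
  rw [e]
  linarith

def classTerm (M : ℕ) (v T : ℝ) (j k : ℕ) : ℂ :=
  if k % 2 = j % 2 then ((copInd M k / (k : ℝ) ^ v : ℝ) : ℂ) * (altTerm T j k / k) else 0

lemma ee_neg_odd_sq_div_ne_one {j : ℕ} (hj : 0 < j) (n : ℕ) :
    ee (-((2 * n + 1 : ℂ) ^ 2 / (4 * j))) ≠ 1 := by
  rw [Ne, ee_eq_one_iff]
  rintro ⟨m, hm⟩
  have hjc : (j : ℂ) ≠ 0 := by exact_mod_cast hj.ne'
  field_simp at hm
  have h : -(2 * (n : ℤ) + 1) ^ 2 = j * m * 4 := by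
    have : (-(2 * (n : ℂ) + 1) ^ 2) = j * m * 4 := by linear_combination hm
    exact_mod_cast this
  have h2 : (2 * (n : ℤ) + 1) ^ 2 = 2 * (2 * ((n : ℤ) ^ 2 + n)) + 1 := by ring
  generalize (j : ℤ) * m = y at h
  omega

lemma norm_ee_neg_odd_sq_div (j n : ℕ) : ‖ee (-((2 * n + 1 : ℂ) ^ 2 / (4 * j)))‖ = 1 := by
  have := norm_ee_ofReal (-((2 * n + 1 : ℝ) ^ 2 / (4 * j)))
  push_cast at this
  exact this

lemma classTerm_eq {M : ℕ} (hM : ∀ a b, a % 2 = b % 2 → copInd M a = copInd M b) (v T : ℝ) {j k : ℕ}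
    (hj : 0 < j) (hk : 0 < k) (hjk : j % 2 = k % 2) (p : ℕ) :
    classTerm M v T j (k + 2 * p) = copInd M j * (ee (1 / 8) / (√(j : ℝ) : ℂ))
      * ∑ n ∈ Finset.range j, ee (-(k * (2 * n + 1 : ℂ) ^ 2 / (8 * j)))
        * ((expWeight (v + 1 / 2) (π * T * j) (k + 2 * p) : ℂ)
          * ee (-((2 * n + 1 : ℂ) ^ 2 / (4 * j))) ^ p) := by
  have hpar : j % 2 = (k + 2 * p) % 2 := by omega
  rw [classTerm, if_pos hpar.symm, altTerm, altGauss_reciprocity j (k + 2 * p) hj (by omega) hpar,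
    hM _ _ hpar.symm, Finset.mul_sum, Finset.mul_sum, Finset.mul_sum, Finset.sum_div,
    Finset.mul_sum]
  refine Finset.sum_congr rfl fun n _ => ?_
  have hjr : (0 : ℝ) < j := by exact_mod_cast hj
  have hjc : (j : ℂ) ≠ 0 := by exact_mod_cast hj.ne'
  have e1 : ee (-(((k + 2 * p : ℕ) : ℂ) * (2 * n + 1) ^ 2 / (8 * j)))
      = ee (-(k * (2 * n + 1 : ℂ) ^ 2 / (8 * j))) * ee (-((2 * n + 1 : ℂ) ^ 2 / (4 * j))) ^ p := by
    rw [← ee_natCast_mul, ← ee_add]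
    congr 1
    push_cast
    field_simp
    ring
  have hK : (0 : ℝ) < ((k + 2 * p : ℕ) : ℝ) := by exact_mod_cast (by omega : 0 < k + 2 * p)
  have hKe : (k : ℝ) + 2 * p = ((k + 2 * p : ℕ) : ℝ) := by push_cast; ring
  rw [e1, hKe]
  generalize k + 2 * p = K at hK ⊢
  have e2 : expWeight (v + 1 / 2) (π * T * j) K
      = √((K : ℝ) / j) * √(j : ℝ) / K / (K : ℝ) ^ v * Real.exp (-(π * T * j / K)) := by
    rw [expWeight, Real.rpow_neg hK.le, Real.rpow_add hK, ← Real.sqrt_eq_rpow,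
      ← Real.sqrt_mul' _ hjr.le, div_mul_cancel₀ _ hjr.ne']
    have h1 := Real.rpow_pos_of_pos hK v
    have h2 := Real.sqrt_pos.mpr hK
    have h3 := Real.mul_self_sqrt hK.le
    congr 1
    rw [div_div, inv_eq_one_div, div_eq_div_iff (by positivity) (by positivity)]
    linear_combination -(K : ℝ) ^ v * h3
  have hsq : (√(j : ℝ) : ℂ) ≠ 0 := by exact_mod_cast (Real.sqrt_pos.mpr hjr).ne'
  rw [e2]
  push_cast
  field_simp

lemma hasSum_classTerm {M : ℕ} (hM : ∀ a b, a % 2 = b % 2 → copInd M a = copInd M b) {v T : ℝ}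
    (hv1 : 1 < v) (hv2 : v ≤ 3 / 2) (hT : 1 ≤ T) {j : ℕ} (hj : 0 < j) :
    ∃ S, HasSum (classTerm M v T j) S ∧
      ‖S‖ ≤ 3200000 * sqDivSeries 2 / T * ((4 * j).divisors.card / (j : ℝ) ^ v) := by
  have hjr : (1 : ℝ) ≤ j := by exact_mod_cast hj
  have hpi := Real.pi_gt_three
  set k := 2 - j % 2 with hkdef
  have hk : 0 < k := by omega
  have hk2 : k ≤ 2 := by omega
  have hpar : j % 2 = k % 2 := by omega
  set B := π * T * j with hB
  have hTj : T * j ≤ B := by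
    rw [hB]
    nlinarith [mul_nonneg (by linarith : (0 : ℝ) ≤ T) (by linarith : (0 : ℝ) ≤ j)]
  have hjB : (j : ℝ) ≤ B := by nlinarith
  have hB1 : 1 ≤ B := by linarith
  set z : ℕ → ℂ := fun n => ee (-((2 * n + 1 : ℂ) ^ 2 / (4 * j))) with hz
  have hz1 : ∀ n, ‖z n‖ = 1 := norm_ee_neg_odd_sq_div j
  have hw := summable_expWeight (μ := v + 1 / 2) (B := B) (by linarith) (by linarith) hk
  have hs : ∀ n, Summable fun p : ℕ => (expWeight (v + 1 / 2) B (k + 2 * p) : ℂ) * z n ^ p :=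
    fun n => by
      refine Summable.of_norm ?_
      simpa [hz1] using hw.abs
  have hsum := (hasSum_sum fun n (_ : n ∈ Finset.range j) =>
    (hs n).hasSum.mul_left (ee (-(k * (2 * n + 1 : ℂ) ^ 2 / (8 * j))))).mul_left
      (copInd M j * (ee (1 / 8) / (√(j : ℝ) : ℂ)))
  have hinj : Function.Injective fun p : ℕ => k + 2 * p := fun a b hab => by
    have : k + 2 * a = k + 2 * b := hab
    omega
  have hsupp : ∀ x ∉ Set.range (fun p : ℕ => k + 2 * p), classTerm M v T j x = 0 := fun x hx => by
    rw [classTerm]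
    split_ifs with h
    · rcases Nat.eq_zero_or_pos x with rfl | hx0
      · rw [copInd_div_rpow_zero M (by linarith)]
        simp
      · exact absurd ⟨(x - k) / 2, by simp only; omega⟩ hx
    · rfl
  have he : (classTerm M v T j ∘ fun p : ℕ => k + 2 * p) = fun p : ℕ =>
      copInd M j * (ee (1 / 8) / (√(j : ℝ) : ℂ))
      * ∑ n ∈ Finset.range j, ee (-(k * (2 * n + 1 : ℂ) ^ 2 / (8 * j)))
        * ((expWeight (v + 1 / 2) B (k + 2 * p) : ℂ) * z n ^ p) :=
    funext fun p => classTerm_eq hM v T hj hk hpar p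
  rw [← he, hinj.hasSum_iff hsupp] at hsum
  refine ⟨_, hsum, ?_⟩
  · have hsqrt : 0 < √(j : ℝ) := Real.sqrt_pos.mpr (by linarith)
    have hn1 : ‖(copInd M j : ℂ) * (ee (1 / 8) / (√(j : ℝ) : ℂ))‖ ≤ 1 / √(j : ℝ) := by
      have h8 : ‖ee (1 / 8)‖ = 1 := by
        have := norm_ee_ofReal (1 / 8)
        push_cast at this
        exact this
      rw [norm_mul, norm_div, h8, Complex.norm_real, Complex.norm_real,
        Real.norm_of_nonneg hsqrt.le, Real.norm_of_nonneg (copInd_nonneg M j)]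
      exact mul_le_of_le_one_left (by positivity) (copInd_le_one M j)
    have hn2 : ∀ n ∈ Finset.range j, ‖ee (-(k * (2 * n + 1 : ℂ) ^ 2 / (8 * j)))
        * ∑' p : ℕ, (expWeight (v + 1 / 2) B (k + 2 * p) : ℂ) * z n ^ p‖
        ≤ 200000 * (B ^ (-(v + 1 / 2)) / B) * (1 / ‖1 - z n‖ ^ 2) := fun n _ => by
      have hnorm : ‖ee (-(k * (2 * n + 1 : ℂ) ^ 2 / (8 * j)))‖ = 1 := by
        have := norm_ee_ofReal (-(k * (2 * n + 1 : ℝ) ^ 2 / (8 * j)))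
        push_cast at this
        exact this
      have hpos : 0 < ‖1 - z n‖ :=
        norm_pos_iff.mpr (sub_ne_zero.mpr (ee_neg_odd_sq_div_ne_one hj n).symm)
      rw [norm_mul, hnorm, one_mul, mul_one_div, le_div_iff₀ (by positivity), mul_comm]
      exact norm_sq_mul_norm_tsum_expWeight_le (by linarith) (by linarith) hB1 hk hk2 (hz1 n)
    have hBle : B ^ (-(v + 1 / 2)) / B ≤ (j : ℝ) ^ (-(v + 1 / 2)) / (T * j) := by
      have : 0 < T * j := by positivity
      refine div_le_div₀ (by positivity) ?_ this hTj
      exact Real.rpow_le_rpow_of_nonpos (by linarith) hjB (by linarith)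
    have hodd := sum_one_div_norm_one_sub_ee_odd_le hj
    rw [norm_mul]
    calc _ ≤ 1 / √(j : ℝ) * (200000 * ((j : ℝ) ^ (-(v + 1 / 2)) / (T * j))
          * (16 * (j : ℝ) ^ 2 * ((4 * j).divisors.card * sqDivSeries 2))) := by
          refine mul_le_mul hn1 ((norm_sum_le _ _).trans ((Finset.sum_le_sum hn2).trans ?_))
            (norm_nonneg _) (by positivity)
          rw [← Finset.mul_sum]
          exact mul_le_mul (mul_le_mul_of_nonneg_left hBle (by norm_num)) hodd
            (Finset.sum_nonneg fun n _ => by positivity) (by positivity)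
      _ = _ := by
          have hj0 : (0 : ℝ) < j := by linarith
          rw [Real.rpow_neg hj0.le, Real.rpow_add hj0, ← Real.sqrt_eq_rpow]
          have h1 : (j : ℝ) / (√(j : ℝ) * √(j : ℝ)) = 1 := by
            rw [Real.mul_self_sqrt hj0.le, div_self hj0.ne']
          have h2 : (j : ℝ) / j = 1 := div_self hj0.ne'
          generalize sqDivSeries 2 = S
          generalize ((4 * j).divisors.card : ℝ) = D
          generalize (j : ℝ) ^ v = w
          calc _ = 3200000 * S / T * (D / w) * ((j : ℝ) / (√(j : ℝ) * √(j : ℝ))) * ((j : ℝ) / j) := by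
                ring
            _ = _ := by rw [h1, h2, mul_one, mul_one]

def expRamp (T : ℝ) (u : ℝ) : ℂ := (Real.exp (-(2 * π * T) * (u + 1 / 2)) : ℂ)

lemma hasSum_card_divisors_four_mul {v : ℝ} (hv : 1 < v) :
    ∃ S ≤ (4 : ℝ) ^ v * zetaCop 1 v ^ 2,
      HasSum (fun j : ℕ => ((4 * j).divisors.card : ℝ) / (j : ℝ) ^ v) S := by
  have h := hasSum_card_divisors hv
  have hinj : Function.Injective fun j : ℕ => 4 * j := fun a b hab => by simpa using hab
  have h2 := (h.summable.comp_injective hinj).hasSum.mul_left ((4 : ℝ) ^ v)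
  have he : (fun j : ℕ => (4 : ℝ) ^ v * ((fun n : ℕ => (n.divisors.card : ℝ) / (n : ℝ) ^ v) ∘
      fun j : ℕ => 4 * j) j) = fun j : ℕ => ((4 * j).divisors.card : ℝ) / (j : ℝ) ^ v := by
    funext j
    simp only [Function.comp]
    rw [Nat.cast_mul, Real.mul_rpow (by norm_num) (Nat.cast_nonneg j), Nat.cast_ofNat]
    have := Real.rpow_pos_of_pos (four_pos (α := ℝ)) v
    field_simp
  rw [he] at h2
  refine ⟨_, mul_le_mul_of_nonneg_left ?_ (by positivity), h2⟩
  rw [← h.tsum_eq]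
  exact tsum_comp_le_tsum_of_inj h.summable (fun n => by positivity) hinj

lemma altTerm_zero_of_even (T : ℝ) {k : ℕ} (hk : k % 2 = 0) : altTerm T 0 k = 0 := by
  obtain ⟨l, rfl⟩ : ∃ l, k = 2 * l := ⟨k / 2, by omega⟩
  have : altGauss 0 (2 * l) = 0 := by
    rw [altGauss, sum_range_two_mul]
    refine Finset.sum_eq_zero fun x _ => ?_
    simp [ee_zero, pow_add, pow_mul]
  rw [altTerm, this, mul_zero]

lemma exists_hasSum_classTerm {M : ℕ} (hM : ∀ a b, a % 2 = b % 2 → copInd M a = copInd M b) {v T : ℝ}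
    (hv1 : 1 < v) (hv2 : v ≤ 3 / 2) (hT : 1 ≤ T) (j : ℕ) :
    ∃ S, HasSum (classTerm M v T j) S ∧
      ‖S‖ ≤ 3200000 * sqDivSeries 2 / T * ((4 * j).divisors.card / (j : ℝ) ^ v) := by
  rcases Nat.eq_zero_or_pos j with rfl | hj
  · refine ⟨0, ?_, by simp⟩
    have : classTerm M v T 0 = fun _ => 0 := by
      funext k
      rw [classTerm]
      split_ifs with h
      · rw [altTerm_zero_of_even T h, zero_div, mul_zero]
      · rfl
    rw [this]
    exact hasSum_zero
  · exact hasSum_classTerm hM hv1 hv2 hT hj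

lemma mul_altPartial_eq (M : ℕ) (v T : ℝ) (J k : ℕ) :
    ((copInd M k / (k : ℝ) ^ v : ℝ) : ℂ) * (altPartial T J k / k)
      = ∑ j ∈ Finset.range (2 * J), classTerm M v T j k := by
  rw [sum_range_two_mul, altPartial, Finset.sum_div, Finset.mul_sum]
  refine Finset.sum_congr rfl fun i _ => ?_
  rw [classTerm, classTerm]
  rcases Nat.mod_two_eq_zero_or_one k with h | h
  · rw [if_pos (by omega), if_neg (by omega), h, add_zero, add_zero]
  · rw [if_neg (by omega), if_pos (by omega), h, zero_add]

lemma exists_summable_bound_altPartial (M : ℕ) {v : ℝ} (hv : 1 < v) :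
    ∃ b : ℕ → ℝ, Summable b ∧ ∀ T, 1 ≤ T → ∀ J k,
      ‖((copInd M k / (k : ℝ) ^ v : ℝ) : ℂ) * (altPartial T J k / k)‖ ≤ b k := by
  set η := min ((v - 1) / 2) 1 with hη
  have hη0 : 0 < η := lt_min (by linarith) one_pos
  have hη1 : η ≤ 1 := min_le_right _ _
  have hηv : η ≤ (v - 1) / 2 := min_le_left _ _
  have hs0 := (hasSum_sqSeries_neg_sq M 0 hv).summable
  rw [show (-0 ^ 2 : ℤ) = 0 by norm_num] at hs0
  have hs1 := (hasSum_card_divisors (v := v - η) (by linarith)).summable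
  refine ⟨fun k => 4 * (copInd M k / (k : ℝ) ^ v * sqCount 0 k)
    + 8 * sqDivSeries (1 + η) * (k.divisors.card / (k : ℝ) ^ (v - η)),
    (hs0.mul_left 4).add (hs1.mul_left _), fun T hT J k => ?_⟩
  have hnn := copInd_div_rpow_nonneg M v k
  have hS := sqDivSeries_nonneg (1 + η)
  rcases Nat.eq_zero_or_pos k with rfl | hk
  · simpa using mul_nonneg hnn (Nat.cast_nonneg (sqCount 0 0))
  have hkr : (0 : ℝ) < k := by exact_mod_cast hk
  have h := norm_altPartial_le hT J hk (σ := 1 + η) (by linarith) (by linarith)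
  rw [norm_mul, norm_div, Complex.norm_real, Real.norm_of_nonneg hnn, Complex.norm_natCast]
  have hp := Real.rpow_pos_of_pos hkr v
  have hq := Real.rpow_pos_of_pos hkr η
  have hle : copInd M k / (k : ℝ) ^ v ≤ 1 / (k : ℝ) ^ v :=
    div_le_div_of_nonneg_right (copInd_le_one M k) hp.le
  calc _ ≤ copInd M k / (k : ℝ) ^ v * ((4 * k * sqCount 0 k
        + 8 * ((k : ℝ) ^ (1 + η) * (k.divisors.card * sqDivSeries (1 + η)))) / k) := by gcongr
    _ = 4 * (copInd M k / (k : ℝ) ^ v * sqCount 0 k) + copInd M k / (k : ℝ) ^ v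
        * (8 * (k : ℝ) ^ η * (k.divisors.card * sqDivSeries (1 + η))) := by
        rw [Real.rpow_add hkr, Real.rpow_one]
        field_simp
    _ ≤ 4 * (copInd M k / (k : ℝ) ^ v * sqCount 0 k) + 1 / (k : ℝ) ^ v
        * (8 * (k : ℝ) ^ η * (k.divisors.card * sqDivSeries (1 + η))) := by gcongr
    _ = _ := by
        simp only [Real.rpow_sub hkr]
        field_simp

lemma summable_norm_gaussTransform_expRamp (M : ℕ) {v T : ℝ} (hv : 1 < v) (hT : 1 ≤ T) :
    Summable fun k : ℕ => ‖((copInd M k / (k : ℝ) ^ v : ℝ) : ℂ)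
      * (gaussTransform (expRamp T) k / k)‖ := by
  obtain ⟨b, hb, hle⟩ := exists_summable_bound_altPartial M hv
  refine hb.of_nonneg_of_le (fun _ => norm_nonneg _) fun k => ?_
  rcases Nat.eq_zero_or_pos k with rfl | hk
  · rw [copInd_div_rpow_zero M (by linarith)]
    simpa using (norm_nonneg _).trans (hle T hT 0 0)
  · have := hle T hT k k
    rwa [altPartial_self T hk] at this

lemma norm_tsum_gaussTransform_expRamp_le {M : ℕ}
    (hM : ∀ a b, a % 2 = b % 2 → copInd M a = copInd M b) {v T : ℝ}
    (hv1 : 1 < v) (hv2 : v ≤ 3 / 2) (hT : 1 ≤ T) :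
    ‖∑' k : ℕ, ((copInd M k / (k : ℝ) ^ v : ℝ) : ℂ)
      * (gaussTransform (expRamp T) k / (1 - Real.exp (-(2 * π * T))) / k)‖
      ≤ 51200000 * sqDivSeries 2 / T * zetaCop 1 v ^ 2 := by
  obtain ⟨b, hb, hle⟩ := exists_summable_bound_altPartial M hv1
  choose Q hQ hQle using exists_hasSum_classTerm hM hv1 hv2 hT
  obtain ⟨S, hS, hSsum⟩ := hasSum_card_divisors_four_mul hv1
  have hC : 0 ≤ 3200000 * sqDivSeries 2 / T := by
    have := sqDivSeries_nonneg 2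
    positivity
  have hlim : Tendsto (fun J => ∑' k : ℕ, ((copInd M k / (k : ℝ) ^ v : ℝ) : ℂ)
      * (altPartial T J k / k)) atTop (𝓝 (∑' k : ℕ, ((copInd M k / (k : ℝ) ^ v : ℝ) : ℂ)
      * (gaussTransform (expRamp T) k / (1 - Real.exp (-(2 * π * T))) / k))) := by
    refine tendsto_tsum_of_dominated_convergence hb (fun k => ?_)
      (Eventually.of_forall fun J k => hle T hT J k)
    rcases Nat.eq_zero_or_pos k with rfl | hk
    · rw [copInd_div_rpow_zero M (by linarith)]
      simp
    · exact ((tendsto_altPartial (by linarith) hk).div_const _).const_mul _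
  refine le_of_tendsto hlim.norm (Eventually.of_forall fun J => ?_)
  have e : ∑' k : ℕ, ((copInd M k / (k : ℝ) ^ v : ℝ) : ℂ) * (altPartial T J k / k)
      = ∑ j ∈ Finset.range (2 * J), Q j := by
    simp only [mul_altPartial_eq]
    exact (hasSum_sum fun j _ => hQ j).tsum_eq
  rw [e]
  calc _ ≤ ∑ j ∈ Finset.range (2 * J),
        3200000 * sqDivSeries 2 / T * ((4 * j).divisors.card / (j : ℝ) ^ v) :=
        (norm_sum_le _ _).trans (Finset.sum_le_sum fun j _ => hQle j)
    _ ≤ 3200000 * sqDivSeries 2 / T * S := by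
        rw [← Finset.mul_sum]
        exact mul_le_mul_of_nonneg_left
          (sum_le_hasSum _ (fun j _ => by positivity) hSsum) hC
    _ ≤ 3200000 * sqDivSeries 2 / T * (16 * zetaCop 1 v ^ 2) := by
        refine mul_le_mul_of_nonneg_left (hS.trans ?_) hC
        refine mul_le_mul_of_nonneg_right ?_ (sq_nonneg _)
        calc (4 : ℝ) ^ v ≤ 4 ^ (2 : ℝ) :=
              Real.rpow_le_rpow_of_exponent_le (by norm_num) (by linarith)
          _ = 16 := by rw [Real.rpow_two]; norm_num
    _ = _ := by ring

lemma hasSum_jumpCoeff_mul_sqCount {t T : ℝ} (ht : 0 < t) (hT : 0 < T) {k : ℕ} (hk : 0 < k) :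
    HasSum (fun m : ℤ => jumpCoeff t T m * sqCount m k)
      (gaussTransform (fun u => ee ((t * u : ℝ) : ℂ)) k / k
        - jumpSize t T * (gaussTransform (expRamp T) k / k)) := by
  have hk0 : (k : ℂ) ≠ 0 := by exact_mod_cast hk.ne'
  have hkr : (0 : ℝ) < k := by exact_mod_cast hk
  have h := (hasSum_sum (s := centered k) fun a ha =>
    (hasSum_jumpCoeff ht hT (u := (a : ℝ) / k) (by
      rw [mem_centered] at ha
      have h1 : -(k : ℝ) ≤ 2 * a := by exact_mod_cast ha.1
      have h2 : (2 : ℝ) * a < k := by exact_mod_cast ha.2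
      constructor
      · rw [le_div_iff₀ hkr]; linarith
      · rw [div_lt_iff₀ hkr]; linarith)).mul_right (gsum a k)).div_const (k : ℂ)
  have he : (fun m : ℤ => jumpCoeff t T m * sqCount m k)
      = fun m : ℤ => (∑ a ∈ centered k,
        jumpCoeff t T m * ee ((m * ((a : ℝ) / k) : ℝ) : ℂ) * gsum a k) / k := by
    funext m
    have h3 := gaussTransform_ee m hk
    rw [gaussTransform] at h3
    simp_rw [mul_assoc]
    rw [← Finset.mul_sum, h3]
    field_simp
  have hval : (∑ a ∈ centered k, (ee ((t * ((a : ℝ) / k) : ℝ) : ℂ)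
      - jumpSize t T * (Real.exp (-(2 * π * T) * ((a : ℝ) / k + 1 / 2)) : ℂ)) * gsum a k) / k
      = gaussTransform (fun u => ee ((t * u : ℝ) : ℂ)) k / k
        - jumpSize t T * (gaussTransform (expRamp T) k / k) := by
    simp_rw [sub_mul]
    rw [Finset.sum_sub_distrib, sub_div]
    congr 1
    rw [gaussTransform, Finset.sum_div, Finset.sum_div, Finset.mul_sum]
    refine Finset.sum_congr rfl fun a _ => ?_
    simp only [expRamp]
    ring
  rw [he, ← hval]
  exact h

lemma summable_sqSeries_all (m : ℤ) (M : ℕ) {v : ℝ} (hv : 1 < v) :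
    Summable fun n : ℕ => copInd M n / (n : ℝ) ^ v * sqCount m n := by
  rcases eq_or_ne m 0 with rfl | hm
  · have h := (hasSum_sqSeries_neg_sq M 0 hv).summable
    simpa using h
  · exact summable_sqSeries hm M hv

lemma norm_mul_sqSeries_le (c : ℤ → ℂ) (M : ℕ) {v : ℝ} (hv : 1 < v) (m : ℤ) :
    ‖c m‖ * sqSeries M m v ≤ ‖c m‖ * sqDivSum m * zetaCop 1 v ^ 2
      + if m = 0 then ‖c 0‖ * sqSeries M 0 v else 0 := by
  split_ifs with hm
  · subst hm
    have := mul_nonneg (mul_nonneg (norm_nonneg (c 0)) (sqDivSum_nonneg 0)) (sq_nonneg (zetaCop 1 v))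
    linarith
  · rw [add_zero, mul_assoc]
    exact mul_le_mul_of_nonneg_left (sqSeries_le hm M hv) (norm_nonneg _)

lemma summable_mul_sqCount {c : ℤ → ℂ} (hc : Summable fun m => ‖c m‖ * sqDivSum m) (M : ℕ) {v : ℝ}
    (hv : 1 < v) :
    Summable fun p : ℤ × ℕ => c p.1 * ((copInd M p.2 / (p.2 : ℝ) ^ v * sqCount p.1 p.2 : ℝ) : ℂ) := by
  have hn : ∀ (m : ℤ) (k : ℕ), ‖c m * ((copInd M k / (k : ℝ) ^ v * sqCount m k : ℝ) : ℂ)‖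
      = ‖c m‖ * (copInd M k / (k : ℝ) ^ v * sqCount m k) := by
    intro m k
    rw [norm_mul, Complex.norm_real, Real.norm_of_nonneg
      (mul_nonneg (copInd_div_rpow_nonneg M v k) (Nat.cast_nonneg _))]
  refine Summable.of_norm ((summable_prod_of_nonneg fun p => norm_nonneg _).mpr ⟨fun m => ?_, ?_⟩)
  · simp only [hn]
    exact (summable_sqSeries_all m M hv).mul_left _
  · simp only [hn, tsum_mul_left]
    refine Summable.of_nonneg_of_le
      (fun m => mul_nonneg (norm_nonneg _) (sqSeries_nonneg M m v))
      (norm_mul_sqSeries_le c M hv) ((hc.mul_right _).add ?_)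
    exact (hasSum_ite_eq 0 _).summable

lemma hasSum_tsum_mul_sqSeries {c : ℤ → ℂ} (hc : Summable fun m => ‖c m‖ * sqDivSum m) (M : ℕ) {v : ℝ}
    (hv : 1 < v) {a : ℕ → ℂ} (ha : ∀ k : ℕ, 0 < k → HasSum (fun m => c m * sqCount m k) (a k)) :
    HasSum (fun k : ℕ => ((copInd M k / (k : ℝ) ^ v : ℝ) : ℂ) * a k)
      (∑' m : ℤ, c m * sqSeries M m v) := by
  have hs := summable_mul_sqCount hc M hv
  have h1 : HasSum (fun m : ℤ => c m * sqSeries M m v) _ := hs.hasSum.prod_fiberwise fun m =>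
    (Complex.hasSum_ofReal.mpr (summable_sqSeries_all m M hv).hasSum).mul_left (c m)
  rw [h1.tsum_eq]
  refine ((Equiv.prodComm ℕ ℤ).hasSum_iff.mpr hs.hasSum).prod_fiberwise fun k => ?_
  rcases Nat.eq_zero_or_pos k with rfl | hk
  · have h0 := copInd_div_rpow_zero M (v := v) (by linarith)
    simp only [Function.comp_def, Equiv.prodComm_apply, Prod.swap, h0]
    simp
  · have he : (fun m : ℤ => ((fun p : ℤ × ℕ => c p.1
        * ((copInd M p.2 / (p.2 : ℝ) ^ v * sqCount p.1 p.2 : ℝ) : ℂ)) ∘ Equiv.prodComm ℕ ℤ) (k, m))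
        = fun m => ((copInd M k / (k : ℝ) ^ v : ℝ) : ℂ) * (c m * sqCount m k) := by
      funext m
      simp only [Function.comp_def, Equiv.prodComm_apply, Prod.swap]
      push_cast
      ring
    rw [he]
    exact (ha k hk).mul_left _

lemma summable_gaussTransform_ee {t : ℝ} (ht : 0 < t) (M : ℕ) {v : ℝ} (hv : 1 < v) :
    Summable fun k : ℕ => ((copInd M k / (k : ℝ) ^ v : ℝ) : ℂ)
      * (gaussTransform (fun u => ee ((t * u : ℝ) : ℂ)) k / k) := by
  have hc := (summable_of_eventually_le_div_sq (eventually_norm_jumpCoeff_le ht one_pos)).2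
  have h1 := (hasSum_tsum_mul_sqSeries hc M hv
    fun k hk => hasSum_jumpCoeff_mul_sqCount ht one_pos hk).summable
  have h2 := (summable_norm_gaussTransform_expRamp M hv le_rfl).of_norm.mul_left (jumpSize t 1)
  refine (h1.add h2).congr fun k => ?_
  ring

lemma norm_tsum_gaussTransform_sub_le {t T : ℝ} (ht : 0 < t) (hT : 1 ≤ T) {M : ℕ}
    (hM : ∀ a b, a % 2 = b % 2 → copInd M a = copInd M b) {v : ℝ} (hv1 : 1 < v) (hv2 : v ≤ 3 / 2) :
    ‖(∑' k : ℕ, ((copInd M k / (k : ℝ) ^ v : ℝ) : ℂ)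
      * (gaussTransform (fun u => ee ((t * u : ℝ) : ℂ)) k / k))
      - ∑' m : ℤ, jumpCoeff t T m * sqSeries M m v‖
      ≤ 2 * (51200000 * sqDivSeries 2 / T * zetaCop 1 v ^ 2) := by
  have hT0 : 0 < T := by linarith
  have hc := (summable_of_eventually_le_div_sq (eventually_norm_jumpCoeff_le ht hT0)).2
  have h1 := hasSum_tsum_mul_sqSeries hc M hv1
    fun k hk => hasSum_jumpCoeff_mul_sqCount ht hT0 hk
  have h2 := (summable_gaussTransform_ee ht M hv1).hasSum
  have h3 := (h2.sub h1).tsum_eq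
  rw [← h3]
  have h4 : ∀ k : ℕ, ((copInd M k / (k : ℝ) ^ v : ℝ) : ℂ)
      * (gaussTransform (fun u => ee ((t * u : ℝ) : ℂ)) k / k)
      - ((copInd M k / (k : ℝ) ^ v : ℝ) : ℂ) * (gaussTransform (fun u => ee ((t * u : ℝ) : ℂ)) k / k
        - jumpSize t T * (gaussTransform (expRamp T) k / k))
      = (-2 * I * Real.sin (π * t)) * (((copInd M k / (k : ℝ) ^ v : ℝ) : ℂ)
      * (gaussTransform (expRamp T) k / (1 - Real.exp (-(2 * π * T))) / k)) := by
    intro k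
    rw [jumpSize]
    ring
  simp_rw [h4]
  rw [tsum_mul_left, norm_mul]
  refine mul_le_mul ?_ (norm_tsum_gaussTransform_expRamp_le hM hv1 hv2 hT) (norm_nonneg _) two_pos.le
  have := Real.abs_sin_le_one (π * t)
  simp only [norm_mul, norm_neg, Complex.norm_I, Complex.norm_real, Real.norm_eq_abs]
  norm_num
  exact this

lemma card_neg_sq_fiber_of_ne_zero {l : ℤ} (hl : l ≠ 0) :
    Nat.card ((fun j : ℤ => -j ^ 2) ⁻¹' {-l ^ 2}) = 2 := by
  have : (fun j : ℤ => -j ^ 2) ⁻¹' {-l ^ 2} = {l, -l} := by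
    ext j
    simp [sq_eq_sq_iff_eq_or_eq_neg]
  rw [this, Nat.card_coe_set_eq, Set.ncard_pair (by omega)]

lemma card_neg_sq_fiber_zero : Nat.card ((fun j : ℤ => -j ^ 2) ⁻¹' {0}) = 1 := by
  have : (fun j : ℤ => -j ^ 2) ⁻¹' {0} = {0} := by
    ext j
    simp
  rw [this, Nat.card_coe_set_eq, Set.ncard_singleton]

lemma card_neg_sq_fiber_of_not_isSquare {m : ℤ} (hm : ¬IsSquare (-m)) :
    Nat.card ((fun j : ℤ => -j ^ 2) ⁻¹' {m}) = 0 := by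
  have : (fun j : ℤ => -j ^ 2) ⁻¹' {m} = ∅ := by
    ext j
    simp only [Set.mem_preimage, Set.mem_singleton_iff, Set.mem_empty_iff_false, iff_false]
    rintro rfl
    exact hm ⟨j, by ring⟩
  rw [this, Nat.card_coe_set_eq, Set.ncard_empty]

lemma tendsto_sqSeries (m : ℤ) (M : ℕ) {ρ : ℝ}
    (hρ : Tendsto (fun v : ℝ => (v - 1) * zetaCop M v) (𝓝[>] 1) (𝓝 ρ)) :
    Tendsto (fun v : ℝ => (v - 1) ^ 2 * sqSeries M m v) (𝓝[>] 1)
      (𝓝 (ρ ^ 2 / (2 * zetaCop M 2) * Nat.card ((fun j : ℤ => -j ^ 2) ⁻¹' {m}))) := by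
  by_cases hm : IsSquare (-m)
  · obtain ⟨l, hl⟩ := hm
    obtain rfl : m = -l ^ 2 := by rw [sq, ← hl, neg_neg]
    rcases eq_or_ne l 0 with rfl | hl0
    · have h0 : (-0 ^ 2 : ℤ) = 0 := by norm_num
      rw [h0, card_neg_sq_fiber_zero, Nat.cast_one, mul_one]
      exact tendsto_sqSeries_zero hρ
    · rw [card_neg_sq_fiber_of_ne_zero hl0]
      have hz := (zetaCop_pos M one_lt_two).ne'
      have he : ρ ^ 2 / (2 * zetaCop M 2) * (2 : ℕ) = ρ ^ 2 / zetaCop M 2 := by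
        push_cast
        field_simp
      rw [he]
      exact tendsto_sqSeries_neg_sq hρ hl0
  · rw [card_neg_sq_fiber_of_not_isSquare hm]
    simpa using tendsto_sqSeries_of_not_isSquare hm M

lemma summable_comp_neg_sq {c : ℤ → ℂ} (hc : Summable c) : Summable fun l : ℤ => c (-l ^ 2) := by
  have hN : Summable fun n : ℕ => c (-(n : ℤ) ^ 2) := by
    refine hc.comp_injective (i := fun n : ℕ => -(n : ℤ) ^ 2) fun a b hab => ?_
    have h1 : (a : ℤ) ^ 2 = (b : ℤ) ^ 2 := neg_injective hab
    have h2 : a ^ 2 = b ^ 2 := by exact_mod_cast h1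
    exact Nat.pow_left_injective two_ne_zero h2
  refine Summable.of_nat_of_neg hN ?_
  simpa using hN

lemma tendsto_tsum_mul_sqSeries {c : ℤ → ℂ} {C : ℝ} (hcC : ∀ᶠ m in cofinite, ‖c m‖ ≤ C / (m : ℝ) ^ 2)
    (M : ℕ) {ρ : ℝ} (hρ : Tendsto (fun v : ℝ => (v - 1) * zetaCop M v) (𝓝[>] 1) (𝓝 ρ)) :
    Tendsto (fun v : ℝ => (((v - 1) ^ 2 : ℝ) : ℂ) * ∑' m : ℤ, c m * sqSeries M m v) (𝓝[>] 1)
      (𝓝 (((ρ ^ 2 / (2 * zetaCop M 2) : ℝ) : ℂ) * ∑' l : ℤ, c (-l ^ 2))) := by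
  obtain ⟨hc, hcd⟩ := summable_of_eventually_le_div_sq hcC
  set A := ρ ^ 2 / (2 * zetaCop M 2) with hA
  have hlim : ((A : ℝ) : ℂ) * ∑' l : ℤ, c (-l ^ 2)
      = ∑' m : ℤ, c m * ((A * Nat.card ((fun j : ℤ => -j ^ 2) ⁻¹' {m}) : ℝ) : ℂ) := by
    have h1 := (summable_comp_neg_sq hc).hasSum.tsum_fiberwise fun l : ℤ => -l ^ 2
    rw [← h1.tsum_eq, ← tsum_mul_left]
    refine tsum_congr fun m => ?_
    have h2 : ∀ b : ((fun j : ℤ => -j ^ 2) ⁻¹' {m}), c (-(b : ℤ) ^ 2) = c m := fun b => by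
      rw [show -(b : ℤ) ^ 2 = m from b.2]
    rw [tsum_congr h2, tsum_const, nsmul_eq_mul]
    push_cast
    ring
  rw [hlim]
  simp_rw [← tsum_mul_left]
  have hv1 : ∀ᶠ v : ℝ in 𝓝[>] 1, 1 < v := self_mem_nhdsWithin
  have hz : ∀ᶠ v : ℝ in 𝓝[>] 1, (v - 1) * zetaCop 1 v ≤ 2 :=
    tendsto_sub_mul_zetaCop_one.eventually_le_const (by norm_num)
  have h0 : ∀ᶠ v : ℝ in 𝓝[>] 1, (v - 1) ^ 2 * sqSeries M 0 v ≤ A + 1 :=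
    (tendsto_sqSeries_zero hρ).eventually_le_const (by linarith)
  refine tendsto_tsum_of_dominated_convergence
    (bound := fun m : ℤ => ‖c m‖ * sqDivSum m * 4 + if m = 0 then ‖c 0‖ * (A + 1) else 0)
    ((hcd.mul_right _).add (hasSum_ite_eq 0 _).summable) (fun m => ?_) ?_
  · have h := (Complex.continuous_ofReal.tendsto _).comp (tendsto_sqSeries m M hρ)
    refine (h.const_mul (c m)).congr fun v => ?_
    simp only [Function.comp_apply]
    push_cast
    ring
  · filter_upwards [hv1, hz, h0] with v hv hz h0 m
    have hsq : 0 ≤ (v - 1) ^ 2 := sq_nonneg _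
    have hn : ‖(((v - 1) ^ 2 : ℝ) : ℂ) * (c m * sqSeries M m v)‖
        = (v - 1) ^ 2 * (‖c m‖ * sqSeries M m v) := by
      rw [norm_mul, norm_mul, Complex.norm_real, Complex.norm_real, Real.norm_of_nonneg hsq,
        Real.norm_of_nonneg (sqSeries_nonneg M m v)]
    rw [hn]
    have h4 : ((v - 1) * zetaCop 1 v) ^ 2 ≤ 4 := by
      have : 0 ≤ (v - 1) * zetaCop 1 v := mul_nonneg (by linarith) (zetaCop_pos 1 hv).le
      nlinarith
    calc (v - 1) ^ 2 * (‖c m‖ * sqSeries M m v)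
        ≤ (v - 1) ^ 2 * (‖c m‖ * sqDivSum m * zetaCop 1 v ^ 2
          + if m = 0 then ‖c 0‖ * sqSeries M 0 v else 0) :=
          mul_le_mul_of_nonneg_left (norm_mul_sqSeries_le c M hv m) hsq
      _ = ‖c m‖ * sqDivSum m * ((v - 1) * zetaCop 1 v) ^ 2
          + if m = 0 then ‖c 0‖ * ((v - 1) ^ 2 * sqSeries M 0 v) else 0 := by
          split_ifs <;> ring
      _ ≤ _ := by
          refine add_le_add (mul_le_mul_of_nonneg_left h4
            (mul_nonneg (norm_nonneg _) (sqDivSum_nonneg m))) ?_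
          split_ifs
          · exact mul_le_mul_of_nonneg_left h0 (norm_nonneg _)
          · exact le_rfl

lemma tendsto_tsum_gaussTransform {r : ℝ} (hr : 0 < r) {M : ℕ}
    (hM : ∀ a b, a % 2 = b % 2 → copInd M a = copInd M b) {ρ : ℝ}
    (hρ : Tendsto (fun v : ℝ => (v - 1) * zetaCop M v) (𝓝[>] 1) (𝓝 ρ)) :
    Tendsto (fun v : ℝ => (((v - 1) ^ 2 : ℝ) : ℂ) * ∑' k : ℕ, ((copInd M k / (k : ℝ) ^ v : ℝ) : ℂ)
      * (gaussTransform (fun u => ee ((r ^ 2 * u : ℝ) : ℂ)) k / k)) (𝓝[>] 1)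
      (𝓝 (((ρ ^ 2 / (2 * zetaCop M 2) : ℝ) : ℂ)
        * ((Real.sin (π * r ^ 2) / (r * Real.sinh (π * r)) : ℝ) : ℂ))) := by
  have ht : 0 < r ^ 2 := by positivity
  have hB : 0 ≤ 2 * (51200000 * sqDivSeries 2) * 4 := by
    have := sqDivSeries_nonneg 2
    positivity
  generalize hBdef : 2 * (51200000 * sqDivSeries 2) * 4 = B at hB
  rw [Metric.tendsto_nhds]
  intro ε hε
  have hJ := (tendsto_tsum_jumpCoeff hr).const_mul ((ρ ^ 2 / (2 * zetaCop M 2) : ℝ) : ℂ)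
  have hBT : Tendsto (fun T : ℝ => B / T) atTop (𝓝 0) := tendsto_const_nhds.div_atTop tendsto_id
  obtain ⟨T, hT1, hT2, hT3⟩ := ((eventually_ge_atTop (1 : ℝ)).and
    ((hBT.eventually_lt_const (show (0 : ℝ) < ε / 3 by linarith)).and
      (Metric.tendsto_nhds.mp hJ (ε / 3) (by linarith)))).exists
  have hT0 : 0 < T := by linarith
  have hreg := Metric.tendsto_nhds.mp
    (tendsto_tsum_mul_sqSeries (eventually_norm_jumpCoeff_le ht hT0) M hρ) (ε / 3) (by linarith)
  have hv1 : ∀ᶠ v : ℝ in 𝓝[>] 1, 1 < v := self_mem_nhdsWithin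
  have hv2 : ∀ᶠ v : ℝ in 𝓝[>] 1, v ≤ 3 / 2 :=
    nhdsWithin_le_nhds (eventually_le_nhds (by norm_num))
  have hz : ∀ᶠ v : ℝ in 𝓝[>] 1, (v - 1) * zetaCop 1 v ≤ 2 :=
    tendsto_sub_mul_zetaCop_one.eventually_le_const (by norm_num)
  filter_upwards [hreg, hv1, hv2, hz] with v hreg hv1 hv2 hz
  have h4 : ((v - 1) * zetaCop 1 v) ^ 2 ≤ 4 := by
    have : 0 ≤ (v - 1) * zetaCop 1 v := mul_nonneg (by linarith) (zetaCop_pos 1 hv1).le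
    nlinarith
  have hd := norm_tsum_gaussTransform_sub_le ht hT1 hM hv1 hv2
  have hd2 : dist ((((v - 1) ^ 2 : ℝ) : ℂ) * ∑' k : ℕ, ((copInd M k / (k : ℝ) ^ v : ℝ) : ℂ)
      * (gaussTransform (fun u => ee ((r ^ 2 * u : ℝ) : ℂ)) k / k))
      ((((v - 1) ^ 2 : ℝ) : ℂ) * ∑' m : ℤ, jumpCoeff (r ^ 2) T m * sqSeries M m v) ≤ B / T := by
    rw [dist_eq_norm, ← mul_sub, norm_mul, Complex.norm_real, Real.norm_of_nonneg (sq_nonneg _)]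
    have hS : 0 ≤ 2 * (51200000 * sqDivSeries 2) / T :=
      div_nonneg (by have := sqDivSeries_nonneg 2; positivity) hT0.le
    calc _ ≤ (v - 1) ^ 2 * (2 * (51200000 * sqDivSeries 2 / T * zetaCop 1 v ^ 2)) :=
          mul_le_mul_of_nonneg_left hd (sq_nonneg _)
      _ = 2 * (51200000 * sqDivSeries 2) / T * ((v - 1) * zetaCop 1 v) ^ 2 := by ring
      _ ≤ 2 * (51200000 * sqDivSeries 2) / T * 4 := mul_le_mul_of_nonneg_left h4 hS
      _ = B / T := by rw [← hBdef]; ring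
  calc _ ≤ _ := dist_triangle4 _ _ _ _
    _ < ε / 3 + ε / 3 + ε / 3 := add_lt_add (add_lt_add (hd2.trans_lt hT2) hreg) hT3
    _ = ε := by ring

/-- The Dirichlet series of the primitive sums, over the moduli prime to `M` . -/
def primSeries (f : ℝ → ℂ) (M : ℕ) (v : ℝ) : ℂ :=
  ∑' n : ℕ, ((copInd M n / (n : ℝ) ^ v : ℝ) : ℂ) * (primGaussTransform f n / n)

lemma hasSum_primGaussTransform {t : ℝ} (ht : 0 < t) (M : ℕ) {v : ℝ} (hv : 1 < v) :
    HasSum (fun n : ℕ => ((copInd M n / (n : ℝ) ^ v : ℝ) : ℂ)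
      * (primGaussTransform (fun u => ee ((t * u : ℝ) : ℂ)) n / n))
      ((∑' k : ℕ, ((copInd M k / (k : ℝ) ^ v : ℝ) : ℂ)
      * (gaussTransform (fun u => ee ((t * u : ℝ) : ℂ)) k / k)) / zetaCop M v) :=
  hasSum_of_sum_divisors M hv
    (fun _ hn => (gaussTransform_div_eq_sum_divisors _ hn).symm)
    (summable_gaussTransform_ee ht M hv).hasSum

lemma tendsto_primSeries {r : ℝ} (hr : 0 < r) {M : ℕ}
    (hM : ∀ a b, a % 2 = b % 2 → copInd M a = copInd M b) {ρ : ℝ} (hρ0 : ρ ≠ 0)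
    (hρ : Tendsto (fun v : ℝ => (v - 1) * zetaCop M v) (𝓝[>] 1) (𝓝 ρ)) :
    Tendsto (fun v : ℝ => ((v - 1 : ℝ) : ℂ)
      * primSeries (fun u => ee ((r ^ 2 * u : ℝ) : ℂ)) M v) (𝓝[>] 1)
      (𝓝 (((ρ / (2 * zetaCop M 2) : ℝ) : ℂ)
        * ((Real.sin (π * r ^ 2) / (r * Real.sinh (π * r)) : ℝ) : ℂ))) := by
  have hρc : (ρ : ℂ) ≠ 0 := by exact_mod_cast hρ0
  have h := (tendsto_tsum_gaussTransform hr hM hρ).div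
    ((Complex.continuous_ofReal.tendsto _).comp hρ) hρc
  have hlim : ((ρ / (2 * zetaCop M 2) : ℝ) : ℂ)
        * ((Real.sin (π * r ^ 2) / (r * Real.sinh (π * r)) : ℝ) : ℂ)
      = ((ρ ^ 2 / (2 * zetaCop M 2) : ℝ) : ℂ)
        * ((Real.sin (π * r ^ 2) / (r * Real.sinh (π * r)) : ℝ) : ℂ) / ρ := by
    rw [eq_div_iff hρc]
    push_cast
    ring
  rw [hlim]
  refine h.congr' ?_
  filter_upwards [self_mem_nhdsWithin] with v (hv : 1 < v)
  rw [primSeries, (hasSum_primGaussTransform (by positivity) M hv).tsum_eq]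
  have hz : (zetaCop M v : ℂ) ≠ 0 := by exact_mod_cast (zetaCop_pos M hv).ne'
  have h1 : ((v : ℂ) - 1) ≠ 0 := by
    rw [sub_ne_zero]
    exact_mod_cast hv.ne'
  simp only [Pi.div_apply, Function.comp_apply]
  push_cast
  generalize (∑' k : ℕ, (copInd M k : ℂ) / ((((k : ℝ) ^ v : ℝ)) : ℂ) *
    (gaussTransform (fun u => ee ((r : ℂ) ^ 2 * u)) k / k)) = Z
  field_simp

lemma copInd_two_left (n : ℕ) : copInd 2 n = if n % 2 = 1 then 1 else 0 := by
  simp only [copInd, Nat.coprime_two_right, Nat.odd_iff]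

lemma primGaussTransform_two_mul_of_odd (f : ℝ → ℂ) {c : ℕ} (hc : Odd c) :
    primGaussTransform f (2 * c) = 0 := by
  refine Finset.sum_eq_zero fun a _ => ?_
  split_ifs with h
  · have ha : Odd a := by
      by_contra h2
      rw [Int.not_odd_iff_even, even_iff_two_dvd] at h2
      have h3 := Int.dvd_coe_gcd h2 (show (2 : ℤ) ∣ ((2 * c : ℕ) : ℤ) from ⟨c, by push_cast; ring⟩)
      rw [h] at h3
      norm_num at h3
    rw [gsum_odd_two_mod_four a c ha hc, mul_zero]
  · rfl

lemma inv_sqrt_mul_rpow {x : ℝ} (hx : 0 < x) (s : ℝ) :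
    (√x)⁻¹ * x ^ (-2 * s) = 1 / x ^ (2 * s - 1 / 2) / x := by
  have h : x ^ (2 * s - 1 / 2) * x = √x * x ^ (2 * s) := by
    rw [Real.sqrt_eq_rpow, ← Real.rpow_add hx, ← Real.rpow_add_one hx.ne']
    congr 1
    ring
  rw [div_div, h, neg_mul, Real.rpow_neg hx.le, one_div, mul_inv]

lemma hasSum_RKo {t : ℝ} (ht : 0 < t) {s : ℝ} (hs : 3 / 4 < s) :
    HasSum (fun c : ℕ => if Odd c then RKo t 0 c 3 * (((c : ℝ) ^ (-2 * s) : ℝ) : ℂ) else 0)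
      (ee (3 / 8) * primSeries (fun u => ee ((t * u : ℝ) : ℂ)) 2 (2 * s - 1 / 2)) := by
  have h := ((hasSum_primGaussTransform ht 2
    (show 1 < 2 * s - 1 / 2 by linarith)).summable.hasSum).mul_left (ee (3 / 8))
  have he : (fun c : ℕ => if Odd c then RKo t 0 c 3 * (((c : ℝ) ^ (-2 * s) : ℝ) : ℂ) else 0)
      = fun n : ℕ => ee (3 / 8) * (((copInd 2 n / (n : ℝ) ^ (2 * s - 1 / 2) : ℝ) : ℂ)
      * (primGaussTransform (fun u => ee ((t * u : ℝ) : ℂ)) n / n)) := by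
    funext c
    simp only [copInd_two_left, ← Nat.odd_iff]
    split_ifs with hc
    · have hx : (0 : ℝ) < c := by exact_mod_cast hc.pos
      have h1 : ((√(c : ℝ) : ℂ))⁻¹ * (((c : ℝ) ^ (-2 * s) : ℝ) : ℂ)
          = ((1 / (c : ℝ) ^ (2 * s - 1 / 2) : ℝ) : ℂ) / c := by
        have := congrArg (Complex.ofReal) (inv_sqrt_mul_rpow hx s)
        simpa only [Complex.ofReal_mul, Complex.ofReal_inv, Complex.ofReal_div,
          Complex.ofReal_natCast] using this
      rw [RKo_eq t c hc]
      linear_combination (ee (3 / 8) * primGaussTransform (fun u => ee ((t * u : ℝ) : ℂ)) c) * h1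
    · simp
  rw [he]
  exact h

lemma hasSum_RKe {t : ℝ} (ht : 0 < t) {s : ℝ} (hs : 3 / 4 < s) :
    HasSum (fun c : ℕ => if Even c ∧ 0 < c then
      RKe t 0 c 3 * (((c : ℝ) ^ (-2 * s) : ℝ) : ℂ) else 0)
      (ee (-1 / 8) * (((2 : ℝ) ^ (2 * s) / √2 : ℝ) : ℂ)
        * (primSeries (fun u => ee ((t * u : ℝ) : ℂ)) 1 (2 * s - 1 / 2)
          - primSeries (fun u => ee ((t * u : ℝ) : ℂ)) 2 (2 * s - 1 / 2))) := by
  have hv : 1 < 2 * s - 1 / 2 := by linarith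
  set E : ℕ → ℂ := fun n => ((copInd 1 n / (n : ℝ) ^ (2 * s - 1 / 2) : ℝ) : ℂ)
      * (primGaussTransform (fun u => ee ((t * u : ℝ) : ℂ)) n / n)
      - ((copInd 2 n / (n : ℝ) ^ (2 * s - 1 / 2) : ℝ) : ℂ)
      * (primGaussTransform (fun u => ee ((t * u : ℝ) : ℂ)) n / n) with hE
  have h : HasSum E (primSeries (fun u => ee ((t * u : ℝ) : ℂ)) 1 (2 * s - 1 / 2)
          - primSeries (fun u => ee ((t * u : ℝ) : ℂ)) 2 (2 * s - 1 / 2)) :=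
    (hasSum_primGaussTransform ht 1 hv).summable.hasSum.sub
      (hasSum_primGaussTransform ht 2 hv).summable.hasSum
  have hinj : Function.Injective fun c : ℕ => 2 * c := fun a b hab => by
    simpa using hab
  have h2 := ((hinj.hasSum_iff (f := E) fun n hn => by
    have hodd : n % 2 = 1 := by
      by_contra h0
      exact hn ⟨n / 2, by simp only; omega⟩
    rw [hE]
    simp [copInd_two_left, copInd_one_left, hodd]).mpr h).mul_left
    (ee (-1 / 8) * (((2 : ℝ) ^ (2 * s) / √2 : ℝ) : ℂ))
  have he : (fun c : ℕ => if Even c ∧ 0 < c then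
      RKe t 0 c 3 * (((c : ℝ) ^ (-2 * s) : ℝ) : ℂ) else 0)
      = fun c : ℕ => ee (-1 / 8) * (((2 : ℝ) ^ (2 * s) / √2 : ℝ) : ℂ)
        * (E ∘ fun c : ℕ => 2 * c) c := by
    funext c
    have hc2 : copInd 2 (2 * c) = 0 := by simp [copInd_two_left]
    simp only [hE, Function.comp_apply, hc2, copInd_one_left]
    rw [zero_div, Complex.ofReal_zero, zero_mul, sub_zero]
    split_ifs with hc
    · have hx : (0 : ℝ) < ((2 * c : ℕ) : ℝ) := by exact_mod_cast (by omega : 0 < 2 * c)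
      have hc0 : (0 : ℝ) < c := by exact_mod_cast hc.2
      have h1 : (√((2 * c : ℕ) : ℝ))⁻¹ * (c : ℝ) ^ (-2 * s)
          = 2 ^ (2 * s) * (1 / ((2 * c : ℕ) : ℝ) ^ (2 * s - 1 / 2) / ((2 * c : ℕ) : ℝ)) := by
        rw [← inv_sqrt_mul_rpow hx s]
        have h3 : ((2 * c : ℕ) : ℝ) ^ (-2 * s) = 2 ^ (-2 * s) * (c : ℝ) ^ (-2 * s) := by
          push_cast
          exact Real.mul_rpow two_pos.le hc0.le
        have h4 : (2 : ℝ) ^ (2 * s) * 2 ^ (-2 * s) = 1 := by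
          rw [← Real.rpow_add two_pos]
          norm_num
        rw [h3]
        linear_combination (-(√((2 * c : ℕ) : ℝ))⁻¹ * (c : ℝ) ^ (-2 * s)) * h4
      have h5 := congrArg (Complex.ofReal) h1
      rw [Complex.ofReal_mul, Complex.ofReal_mul, Complex.ofReal_inv, Complex.ofReal_div _ ((2 * c : ℕ) : ℝ),
        Complex.ofReal_natCast] at h5
      have h6 : (1 + I)⁻¹ = ee (-1 / 8) * (√2 : ℂ)⁻¹ := by
        rw [show (-1 / 8 : ℂ) = -(1 / 8) by ring, ee_neg, ee_eighth, inv_div]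
        have := ofReal_sqrt_ne_zero (x := 2) two_pos
        field_simp
      rw [RKe_eq t c hc.1 hc.2, mul_inv, h6, Complex.ofReal_div]
      linear_combination (ee (-1 / 8) * (√2 : ℂ)⁻¹
        * primGaussTransform (fun u => ee ((t * u : ℝ) : ℂ)) (2 * c)) * h5
    · rcases Nat.eq_zero_or_pos c with rfl | hpos
      · simp
      · rw [primGaussTransform_two_mul_of_odd _
          (Nat.not_even_iff_odd.mp fun h => hc ⟨h, hpos⟩)]
        simp
  rw [he]
  exact h2

lemma tendsto_inv_Gamma_mul {D : ℝ → ℂ} {L : ℂ}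
    (hD : Tendsto (fun v : ℝ => ((v - 1 : ℝ) : ℂ) * D v) (𝓝[>] 1) (𝓝 L)) :
    Tendsto (fun s : ℝ => (1 / ((Real.Gamma (s - 3 / 4) : ℝ) : ℂ)) * D (2 * s - 1 / 2))
      (𝓝[>] (3 / 4)) (𝓝 (1 / 2 * L)) := by
  have hv : Tendsto (fun s : ℝ => 2 * s - 1 / 2) (𝓝[>] (3 / 4)) (𝓝[>] 1) := by
    refine tendsto_nhdsWithin_iff.mpr ⟨?_, ?_⟩
    · have h : Continuous fun s : ℝ => 2 * s - 1 / 2 := by fun_prop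
      have h2 := (h.tendsto (3 / 4)).mono_left (nhdsWithin_le_nhds (s := Set.Ioi (3 / 4)))
      norm_num at h2 ⊢
      exact h2
    · filter_upwards [self_mem_nhdsWithin] with s (hs : 3 / 4 < s)
      show (1 : ℝ) < 2 * s - 1 / 2
      linarith
  have hG : Tendsto (fun s : ℝ => Real.Gamma (s - 3 / 4 + 1)) (𝓝[>] (3 / 4)) (𝓝 1) := by
    have h1 : ContinuousAt Real.Gamma 1 :=
      (Real.differentiableAt_Gamma fun m => by
        have : (0 : ℝ) ≤ m := Nat.cast_nonneg m
        linarith).continuousAt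
    have h2 : Tendsto (fun s : ℝ => s - 3 / 4 + 1) (𝓝[>] (3 / 4)) (𝓝 1) := by
      have h : Continuous fun s : ℝ => s - 3 / 4 + 1 := by fun_prop
      have h2 := (h.tendsto (3 / 4)).mono_left (nhdsWithin_le_nhds (s := Set.Ioi (3 / 4)))
      norm_num at h2 ⊢
      exact h2
    have h3 := h1.tendsto.comp h2
    rwa [Real.Gamma_one] at h3
  have hGc : Tendsto (fun s : ℝ => 1 / (2 * (Real.Gamma (s - 3 / 4 + 1) : ℂ))) (𝓝[>] (3 / 4))
      (𝓝 (1 / (2 * ((1 : ℝ) : ℂ)))) :=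
    tendsto_const_nhds.div
      (tendsto_const_nhds.mul ((Complex.continuous_ofReal.tendsto _).comp hG)) (by norm_num)
  have h := hGc.mul (hD.comp hv)
  rw [Complex.ofReal_one, mul_one] at h
  refine h.congr' ?_
  filter_upwards [self_mem_nhdsWithin] with s (hs : 3 / 4 < s)
  have hx : (0 : ℝ) < s - 3 / 4 := by linarith
  have hx0 : ((s - 3 / 4 : ℝ) : ℂ) ≠ 0 := by exact_mod_cast hx.ne'
  have hg0 : (Real.Gamma (s - 3 / 4) : ℂ) ≠ 0 := by exact_mod_cast (Real.Gamma_pos_of_pos hx).ne'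
  rw [Real.Gamma_add_one hx.ne', Function.comp_apply,
    show 2 * s - 1 / 2 - 1 = 2 * (s - 3 / 4) by ring]
  generalize s - 3 / 4 = x at *
  push_cast
  field_simp

lemma copInd_one_congr (a b : ℕ) (_ : a % 2 = b % 2) : copInd 1 a = copInd 1 b := by
  rw [copInd_one_left, copInd_one_left]

lemma copInd_two_congr (a b : ℕ) (h : a % 2 = b % 2) : copInd 2 a = copInd 2 b := by
  rw [copInd_two_left, copInd_two_left, h]

/-- **Proposition 8.5 (weight-3/2 zero-frequency limits)**: for `r > 0`, the series
`Σ_{even c>0} K(r²,0,c,ν_Θ³) c^{−2s}` and `Σ_{odd c̃>0} K̃(r²,0,c̃,ν_Θ³) c̃^{−2s}` converge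
absolutely for every real `s > 3/4`, and, divided by `Γ(s−3/4)`, tend to
`e(−1/8) sin(πr²)/(π² r sinh(πr))` and `e(3/8) sin(πr²)/(π² r sinh(πr))` respectively as
`s → 3/4⁺`. -/
theorem weight_three_half_zero_frequency_limits (r : ℝ) (hr : 0 < r) :
    (∀ s : ℝ, 3 / 4 < s →
      (Summable fun c : ℕ => ‖if Even c ∧ 0 < c then
          RKe (r ^ 2) 0 c 3 * (((c : ℝ) ^ (-2 * s) : ℝ) : ℂ) else 0‖) ∧
      (Summable fun c : ℕ => ‖if Odd c then
          RKo (r ^ 2) 0 c 3 * (((c : ℝ) ^ (-2 * s) : ℝ) : ℂ) else 0‖)) ∧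
    Filter.Tendsto
      (fun s : ℝ => (1 / ((Real.Gamma (s - 3 / 4) : ℝ) : ℂ)) *
        ∑' c : ℕ, if Even c ∧ 0 < c then
          RKe (r ^ 2) 0 c 3 * (((c : ℝ) ^ (-2 * s) : ℝ) : ℂ) else 0)
      (nhdsWithin (3 / 4) (Set.Ioi (3 / 4)))
      (nhds (ee (-(1 : ℂ) / 8) *
        ((Real.sin (π * r ^ 2) / (π ^ 2 * r * Real.sinh (π * r)) : ℝ) : ℂ))) ∧
    Filter.Tendsto
      (fun s : ℝ => (1 / ((Real.Gamma (s - 3 / 4) : ℝ) : ℂ)) *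
        ∑' c : ℕ, if Odd c then
          RKo (r ^ 2) 0 c 3 * (((c : ℝ) ^ (-2 * s) : ℝ) : ℂ) else 0)
      (nhdsWithin (3 / 4) (Set.Ioi (3 / 4)))
      (nhds (ee ((3 : ℂ) / 8) *
        ((Real.sin (π * r ^ 2) / (π ^ 2 * r * Real.sinh (π * r)) : ℝ) : ℂ))) := by
  have ht : 0 < r ^ 2 := by positivity
  have h1 := tendsto_primSeries hr copInd_one_congr one_ne_zero tendsto_sub_mul_zetaCop_one
  have h2 := tendsto_primSeries hr copInd_two_congr (by norm_num) tendsto_sub_mul_zetaCop_two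
  rw [zetaCop_one_two] at h1
  rw [zetaCop_two_two] at h2
  have hπ : (π : ℂ) ≠ 0 := by exact_mod_cast Real.pi_ne_zero
  have hrc : (r : ℂ) ≠ 0 := by exact_mod_cast hr.ne'
  have hsh : Complex.sinh (π * r) ≠ 0 := by
    have : Real.sinh (π * r) ≠ 0 := (Real.sinh_pos_iff.mpr (by positivity)).ne'
    rw [← Complex.ofReal_mul, ← Complex.ofReal_sinh]
    exact_mod_cast this
  refine ⟨fun s hs => ⟨(hasSum_RKe ht hs).summable.norm, (hasSum_RKo ht hs).summable.norm⟩, ?_, ?_⟩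
  · have hD := tendsto_inv_Gamma_mul
      (D := fun v => primSeries (fun u => ee ((r ^ 2 * u : ℝ) : ℂ)) 1 v
        - primSeries (fun u => ee ((r ^ 2 * u : ℝ) : ℂ)) 2 v)
      ((h1.sub h2).congr fun v => by ring)
    have hK : Tendsto (fun s : ℝ => ee (-1 / 8) * (((2 : ℝ) ^ (2 * s) / √2 : ℝ) : ℂ))
        (𝓝[>] (3 / 4)) (𝓝 (ee (-1 / 8) * ((2 : ℝ) : ℂ))) := by
      refine Tendsto.const_mul _ ((Complex.continuous_ofReal.tendsto _).comp ?_)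
      have hc : Continuous fun s : ℝ => (2 : ℝ) ^ (2 * s) / √2 :=
        (Continuous.rpow continuous_const (by fun_prop) fun _ => Or.inl two_ne_zero).div_const _
      have h3 := (hc.tendsto (3 / 4)).mono_left (nhdsWithin_le_nhds (s := Set.Ioi (3 / 4)))
      have h4 : (2 : ℝ) ^ (2 * (3 / 4 : ℝ)) / √2 = 2 := by
        rw [Real.sqrt_eq_rpow, ← Real.rpow_sub two_pos]
        norm_num
      rwa [h4] at h3
    have h := hK.mul hD
    have hlim : ee (-(1 : ℂ) / 8) * ((Real.sin (π * r ^ 2) / (π ^ 2 * r * Real.sinh (π * r)) : ℝ) : ℂ)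
        = ee (-1 / 8) * ((2 : ℝ) : ℂ) * (1 / 2 * (((1 / (2 * (π ^ 2 / 6)) : ℝ) : ℂ)
          * ((Real.sin (π * r ^ 2) / (r * Real.sinh (π * r)) : ℝ) : ℂ)
          - ((1 / 2 / (2 * (π ^ 2 / 8)) : ℝ) : ℂ)
          * ((Real.sin (π * r ^ 2) / (r * Real.sinh (π * r)) : ℝ) : ℂ))) := by
      push_cast
      field_simp
      ring
    rw [hlim]
    refine h.congr' ?_
    filter_upwards [self_mem_nhdsWithin] with s (hs : 3 / 4 < s)
    rw [(hasSum_RKe ht hs).tsum_eq]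
    ring
  · have h := (tendsto_inv_Gamma_mul h2).const_mul (ee (3 / 8))
    have hlim : ee ((3 : ℂ) / 8) * ((Real.sin (π * r ^ 2) / (π ^ 2 * r * Real.sinh (π * r)) : ℝ) : ℂ)
        = ee (3 / 8) * (1 / 2 * (((1 / 2 / (2 * (π ^ 2 / 8)) : ℝ) : ℂ)
          * ((Real.sin (π * r ^ 2) / (r * Real.sinh (π * r)) : ℝ) : ℂ))) := by
      push_cast
      field_simp
      ring
    rw [hlim]
    refine h.congr' ?_
    filter_upwards [self_mem_nhdsWithin] with s (hs : 3 / 4 < s)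
    rw [(hasSum_RKo ht hs).tsum_eq]
    ring

end
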